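/- There exists an infinite-dimensional Banach space 𝒢ℳ with a Schauder basis (e_n) such that: (a) 𝒢ℳ contains no unconditional basic sequence, i.e. there is no seminormalized basic sequence (x_n) in 𝒢ℳ and constant C ≥ 1 with ‖Σ_n ε_n a_n x_n‖ ≤ C·‖Σ_n a_n x_n‖ for all finitely supported scalar sequences (a_n) and all choices of signs ε_n ∈ {−1,1}; and (b) every block subspace of 𝒢ℳ contains a block sequence (y_n)_{n≥1} such that (y_{2n})_{n≥1} is equivalent to (y_{2n+1})_{n≥1}. -/

import Mathlib

section BanachDefs

variable {X : Type*} [NormedAddCommGroup X] [NormedSpace ℝ X]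

/-- A sequence is seminormalized if its norms are bounded away from `0` and `∞`. -/
def Seminormalized (x : ℕ → X) : Prop :=
  ∃ c C : ℝ, 0 < c ∧ ∀ n, c ≤ ‖x n‖ ∧ ‖x n‖ ≤ C

/-- A sequence of nonzero vectors is basic if partial sums of expansions are uniformly
dominated by longer ones. -/
def IsBasicSeq (x : ℕ → X) : Prop :=
  (∀ n, x n ≠ 0) ∧ ∃ K : ℝ, 1 ≤ K ∧ ∀ (a : ℕ → ℝ) (m n : ℕ), m ≤ n →
    ‖∑ i ∈ Finset.range m, a i • x i‖ ≤ K * ‖∑ i ∈ Finset.range n, a i • x i‖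

/-- `(e_n)` is a Schauder basis of `X`: nonzero vectors with dense linear span and uniformly
bounded basis projections. -/
def IsSchauderBasis (e : ℕ → X) : Prop :=
  (∀ n, e n ≠ 0) ∧ Dense (↑(Submodule.span ℝ (Set.range e)) : Set X) ∧
  ∃ K : ℝ, 1 ≤ K ∧ ∀ (a : ℕ → ℝ) (m n : ℕ), m ≤ n →
    ‖∑ i ∈ Finset.range m, a i • e i‖ ≤ K * ‖∑ i ∈ Finset.range n, a i • e i‖

/-- `(y_n)` is a block sequence of `(e_n)`: nonzero finite linear combinations of the `e_i`
with successive supports `supp y₀ < supp y₁ < …`. -/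
def IsBlockSeq (e y : ℕ → X) : Prop :=
  (∀ n, y n ≠ 0) ∧ ∃ (I : ℕ → Finset ℕ) (a : ℕ → ℕ → ℝ),
    (∀ n, y n = ∑ i ∈ I n, a n i • e i) ∧
    (∀ n m, n < m → ∀ i ∈ I n, ∀ j ∈ I m, i < j)

/-- Two sequences are equivalent: the map `u_n ↦ v_n` extends to an isomorphism between the
closed linear spans. -/
def SeqEquiv (u v : ℕ → X) : Prop :=
  ∃ c C : ℝ, 0 < c ∧ ∀ (a : ℕ → ℝ) (s : Finset ℕ),
    c * ‖∑ n ∈ s, a n • u n‖ ≤ ‖∑ n ∈ s, a n • v n‖ ∧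
    ‖∑ n ∈ s, a n • v n‖ ≤ C * ‖∑ n ∈ s, a n • u n‖

/-- The closed linear span of a set. -/
def closedSpan (s : Set X) : Submodule ℝ X :=
  (Submodule.span ℝ s).topologicalClosure

/-- A sequence is weakly null if it tends to `0` in the weak topology. -/
def WeaklyNull (x : ℕ → X) : Prop :=
  ∀ φ : X →L[ℝ] ℝ, Filter.Tendsto (fun n => φ (x n)) Filter.atTop (nhds 0)

end BanachDefs

/-- `Y` embeds into `Z`: there is a bounded linear injection which is an isomorphism onto its
range (bounded below). -/
def Embeds (Y Z : Type*) [NormedAddCommGroup Y] [NormedSpace ℝ Y]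
    [NormedAddCommGroup Z] [NormedSpace ℝ Z] : Prop :=
  ∃ T : Y →L[ℝ] Z, ∃ c : ℝ, 0 < c ∧ ∀ y, c * ‖y‖ ≤ ‖T y‖



namespace GM

abbrev FF := ℕ →₀ ℚ
abbrev VV := ℕ →₀ ℝ

/-- duality pairing of a rational functional with a finitely supported vector -/
noncomputable def pr (f : FF) : VV →ₗ[ℝ] ℝ := Finsupp.linearCombination ℝ (fun i => (f i : ℝ))

lemma pr_apply (f : FF) (x : VV) : pr f x = x.sum fun i a => a * (f i : ℝ) := by
  simp [pr, Finsupp.linearCombination_apply]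

lemma pr_eq_sum (f : FF) (x : VV) {s : Finset ℕ} (hs : x.support ⊆ s) :
    pr f x = ∑ i ∈ s, x i * (f i : ℝ) := by
  rw [pr_apply, Finsupp.sum]
  apply Finset.sum_subset hs
  intro i _ hi
  simp at hi
  simp [hi]

@[simp] lemma pr_single (f : FF) (n : ℕ) (a : ℝ) : pr f (Finsupp.single n a) = a * (f n : ℝ) := by
  simp [pr]

lemma pr_add (f g : FF) (x : VV) : pr (f + g) x = pr f x + pr g x := by
  simp only [pr_eq_sum _ x (Finset.Subset.refl _), ← Finset.sum_add_distrib]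
  apply Finset.sum_congr rfl; intros; push_cast [Finsupp.add_apply]; ring

@[simp] lemma pr_zero (x : VV) : pr 0 x = 0 := by
  simp [pr_eq_sum _ x (Finset.Subset.refl _)]

lemma pr_smul (c : ℚ) (f : FF) (x : VV) : pr (c • f) x = (c : ℝ) * pr f x := by
  simp only [pr_eq_sum _ x (Finset.Subset.refl _), Finset.mul_sum]
  apply Finset.sum_congr rfl; intros; push_cast [Finsupp.smul_apply, smul_eq_mul]; ring

lemma pr_neg (f : FF) (x : VV) : pr (-f) x = - pr f x := by
  have := pr_smul (-1) f x
  simpa using this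

lemma pr_sum {ι : Type*} (s : Finset ι) (g : ι → FF) (x : VV) :
    pr (∑ q ∈ s, g q) x = ∑ q ∈ s, pr (g q) x := by
  classical
  induction s using Finset.induction_on with
  | empty => simp
  | insert a s ha ih => rw [Finset.sum_insert ha, Finset.sum_insert ha, pr_add, ih]

/-- restriction of a functional to the interval `[a, b)` -/
noncomputable def res (a b : ℕ) (f : FF) : FF := f.filter (fun i => a ≤ i ∧ i < b)

lemma res_apply (a b : ℕ) (f : FF) (i : ℕ) :
    res a b f i = if a ≤ i ∧ i < b then f i else 0 := by
  simp [res, Finsupp.filter_apply]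

lemma res_smul (a b : ℕ) (c : ℚ) (f : FF) : res a b (c • f) = c • res a b f := by
  ext i; simp [res_apply]

lemma res_neg (a b : ℕ) (f : FF) : res a b (-f) = - res a b f := by
  ext i; simp only [res_apply, Finsupp.neg_apply]; split_ifs <;> simp

lemma res_sum (a b : ℕ) {ι : Type*} (s : Finset ι) (g : ι → FF) :
    res a b (∑ q ∈ s, g q) = ∑ q ∈ s, res a b (g q) := by
  ext i; simp only [res_apply, Finsupp.finsetSum_apply]; split_ifs <;> simp

lemma res_res (a b a' b' : ℕ) (f : FF) : res a b (res a' b' f) = res (max a a') (min b b') f := by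
  ext i; simp only [res_apply]; split_ifs <;> first | rfl | omega

lemma res_ne {a b : ℕ} {f : FF} {i : ℕ} (h : res a b f i ≠ 0) : a ≤ i ∧ i < b ∧ f i ≠ 0 := by
  rw [res_apply] at h; split_ifs at h with h1
  · exact ⟨h1.1, h1.2, h⟩
  · exact absurd rfl h

/-- `x` is supported in `[a,b)` -/
def SuppIn (a b : ℕ) (x : VV) : Prop := ∀ i, x i ≠ 0 → a ≤ i ∧ i < b

lemma pr_congr {f g : FF} {x : VV} (h : ∀ i, x i ≠ 0 → f i = g i) : pr f x = pr g x := by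
  rw [pr_eq_sum _ x (Finset.Subset.refl _), pr_eq_sum _ x (Finset.Subset.refl _)]
  apply Finset.sum_congr rfl
  intro i hi
  rw [h i (by simpa using hi)]

lemma pr_res_of_supp {a b : ℕ} {x : VV} (h : SuppIn a b x) (f : FF) : pr (res a b f) x = pr f x := by
  apply pr_congr
  intro i hi
  rw [res_apply, if_pos (h i hi)]

lemma pr_eq_zero {f : FF} {x : VV} (h : ∀ i, x i ≠ 0 → f i = 0) : pr f x = 0 := by
  rw [pr_congr (g := 0) (by simpa using h)]; simp

lemma pr_ne_zero {f : FF} {x : VV} (h : pr f x ≠ 0) : ∃ i, x i ≠ 0 ∧ f i ≠ 0 := by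
  by_contra hc; push Not at hc; exact h (pr_eq_zero hc)

/-- restriction of a vector -/
noncomputable def resV (a b : ℕ) (x : VV) : VV := x.filter (fun i => a ≤ i ∧ i < b)

lemma resV_apply (a b : ℕ) (x : VV) (i : ℕ) :
    resV a b x i = if a ≤ i ∧ i < b then x i else 0 := by
  simp [resV, Finsupp.filter_apply]

lemma pr_resV (a b : ℕ) (f : FF) (x : VV) : pr f (resV a b x) = pr (res a b f) x := by
  have h1 : (resV a b x).support ⊆ x.support := by
    intro i hi
    rw [Finsupp.mem_support_iff, resV_apply] at hi
    rw [Finsupp.mem_support_iff]; rintro h; simp [h] at hi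
  rw [pr_eq_sum _ _ h1, pr_eq_sum _ x (Finset.Subset.refl _)]
  apply Finset.sum_congr rfl
  intro i _
  rw [resV_apply, res_apply]; split_ifs <;> simp

/-- successive functionals -/
def Succ (g : ℕ → FF) (d : ℕ) : Prop :=
  ∀ q q', q < q' → q' < d → ∀ i i', g q i ≠ 0 → g q' i' ≠ 0 → i < i'

lemma Succ.mono_fun {g g' : ℕ → FF} {d : ℕ} (h : Succ g d)
    (hs : ∀ q < d, ∀ i, g' q i ≠ 0 → g q i ≠ 0) : Succ g' d :=
  fun q q' hqq hd i i' hi hi' => h q q' hqq hd i i' (hs q (by omega) i hi) (hs q' hd i' hi')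

lemma Succ.res {g : ℕ → FF} {d : ℕ} (h : Succ g d) (a b : ℕ) :
    Succ (fun q => res a b (g q)) d :=
  h.mono_fun fun _ _ _ hi => (res_ne hi).2.2

lemma Succ.neg {g : ℕ → FF} {d : ℕ} (h : Succ g d) :
    Succ (fun q => -(g q)) d :=
  h.mono_fun fun _ _ i hi => by simpa using hi

lemma Succ.mono {g : ℕ → FF} {d d' : ℕ} (h : Succ g d) (hd : d' ≤ d) : Succ g d' :=
  fun q q' hqq hd' => h q q' hqq (by omega)

/-- counting function -/
def cnt (R D : ℕ) : ℕ → ℕ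
  | 0 => 0
  | (i+1) => R + D + D * cnt R D i + 1

/-- parameters of the construction -/
structure Par where
  mu : ℕ → ℕ
  m : ℕ → ℕ
  n : ℕ → ℕ
  N : ℕ → ℕ
  k : ℕ → ℕ
  T : ℕ → ℕ
  H : ℕ → Finset (ℕ × FF)
  hmu0 : 256 ≤ mu 0
  hm : ∀ j, m j = mu j ^ 8
  hmu : ∀ j, mu (j+1) = m j ^ 8
  hn : ∀ j, n j = k j ^ T j
  hT : ∀ j, 2 ^ T j = 2 * m j
  hk0 : m 0 ^ 4 ≤ k 0
  hk : ∀ j, m (j+1) ^ 4 * (cnt 1 (n j + j + 1) (m (j+1)) + 1) * (N j + 1) ≤ k (j+1)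
  hNn : ∀ j, n j ≤ N j
  hNc : ∀ j, 2 * cnt (j+10) (n j + j + 1) (140 * mu (j+1)^2) ≤ N j
  hH : ∀ (S : Finset (ℕ × FF)) (n0 : ℕ), ∃ c, n0 ≤ c ∧ Odd c ∧ H c = S

variable (P : Par)

/-- the norming set, with tags recording the weights of the `even` functionals -/
inductive Wt : Option ℕ → FF → Prop
  | zero : Wt none 0
  | unit (n : ℕ) (ε : ℚ) (hε : ε = 1 ∨ ε = -1) : Wt none (Finsupp.single n ε)
  | even (j d : ℕ) (g : ℕ → FF) (τ : ℕ → Option ℕ) (hd : d ≤ P.n j)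
      (hg : ∀ q, q < d → Wt (τ q) (g q)) (hs : Succ g d) :
      Wt (some j) ((1 / (P.m j : ℚ)) • ∑ q ∈ Finset.range d, g q)
  | spec (r d : ℕ) (c : ℕ → ℕ) (g : ℕ → FF) (ε : ℚ) (a b : ℕ) (hd : d ≤ P.N r)
      (hg : ∀ q, q < d → Wt (some (c q)) (g q)) (hodd : ∀ q, q < d → Odd (c q))
      (hc : ∀ q, q + 1 < d → c q < c (q+1) ∧ (c q, g q) ∈ P.H (c (q+1)))
      (hs : Succ g d) (hε : ε = 1 ∨ ε = -1) :
      Wt none ((ε / (P.mu r : ℚ)) • res a b (∑ q ∈ Finset.range d, g q))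

variable {P}

lemma Wt.neg {τ : Option ℕ} {f : FF} (h : Wt P τ f) : Wt P τ (-f) := by
  induction h with
  | zero => simpa using Wt.zero
  | unit n ε hε =>
    rw [← Finsupp.single_neg]
    exact Wt.unit n (-ε) (by rcases hε with h | h <;> simp [h])
  | even j d g τ hd hg hs ih =>
    rw [← smul_neg, ← Finset.sum_neg_distrib]
    exact Wt.even j d (fun q => -(g q)) τ hd ih hs.neg
  | spec r d c g ε a b hd hg hodd hc hs hε ih =>
    rw [← neg_smul, ← neg_div]
    exact Wt.spec r d c g (-ε) a b hd hg hodd hc hs (by rcases hε with h | h <;> simp [h])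

lemma Wt.res {τ : Option ℕ} {f : FF} (h : Wt P τ f) (a b : ℕ) : Wt P τ (res a b f) := by
  induction h with
  | zero =>
    have : GM.res a b 0 = 0 := by ext i; simp [res_apply]
    rw [this]; exact Wt.zero
  | unit n ε hε =>
    by_cases h : a ≤ n ∧ n < b
    · have : GM.res a b (Finsupp.single n ε) = Finsupp.single n ε := by
        ext i
        rw [res_apply]
        split_ifs with h1
        · rfl
        · rw [Finsupp.single_apply, if_neg]; rintro rfl; exact h1 h
      rw [this]; exact Wt.unit n ε hε
    · have : GM.res a b (Finsupp.single n ε) = 0 := by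
        ext i
        rw [res_apply]
        split_ifs with h1
        · rw [Finsupp.single_apply, if_neg]; · rfl
          rintro rfl; exact h h1
        · rfl
      rw [this]; exact Wt.zero
  | even j d g τ hd hg hs ih =>
    rw [res_smul, res_sum]
    exact Wt.even j d (fun q => GM.res a b (g q)) τ hd ih (hs.res a b)
  | spec r d c g ε a' b' hd hg hodd hc hs hε ih =>
    rw [res_smul, res_res]
    exact Wt.spec r d c g ε _ _ hd hg hodd hc hs hε

variable (P)
def InW (f : FF) : Prop := ∃ τ, Wt P τ f
abbrev Ev (j : ℕ) (f : FF) : Prop := Wt P (some j) f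
variable {P}

lemma InW.neg {f : FF} (h : InW P f) : InW P (-f) := h.imp fun _ h => h.neg
lemma InW.res {f : FF} (h : InW P f) (a b : ℕ) : InW P (res a b f) := h.imp fun _ h => h.res a b
lemma InW.zero : InW P 0 := ⟨_, Wt.zero⟩
lemma Wt.inW {τ : Option ℕ} {f : FF} (h : Wt P τ f) : InW P f := ⟨τ, h⟩
lemma InW.sgn {f : FF} (h : InW P f) {ε : ℚ} (hε : ε = 1 ∨ ε = -1) : InW P (ε • f) := by
  rcases hε with h1 | h1
  · simpa [h1] using h
  · simpa [h1] using h.neg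

lemma InW.even {j d : ℕ} {g : ℕ → FF} (hd : d ≤ P.n j)
      (hg : ∀ q, q < d → InW P (g q)) (hs : Succ g d) :
      Ev P j ((1 / (P.m j : ℚ)) • ∑ q ∈ Finset.range d, g q) := by
  have : ∀ q, ∃ τ, q < d → Wt P τ (g q) := by
    intro q
    by_cases h : q < d
    · obtain ⟨τ, h1⟩ := hg q h; exact ⟨τ, fun _ => h1⟩
    · exact ⟨none, fun h' => absurd h' h⟩
  choose τ hτ using this
  exact Wt.even j d g τ hd hτ hs

lemma Succ.sum_abs_le {g : ℕ → FF} {d : ℕ} (h : Succ g d) (i : ℕ) (hb : ∀ q < d, |g q i| ≤ 1) :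
    |∑ q ∈ Finset.range d, g q i| ≤ 1 := by
  by_cases hz : ∀ q < d, g q i = 0
  · rw [Finset.sum_eq_zero]; · simp
    intro q hq; exact hz q (by simpa using hq)
  · push Not at hz
    obtain ⟨q, hq, hqi⟩ := hz
    rw [Finset.sum_eq_single q]
    · exact hb q hq
    · intro q' hq' hne
      by_contra h0
      rcases lt_or_gt_of_ne hne with h1 | h1
      · exact lt_irrefl _ (h q' q h1 hq i i h0 hqi)
      · exact lt_irrefl _ (h q q' h1 (by simpa using hq') i i hqi h0)
    · intro h1; simp at h1; omega

section
variable (P)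
lemma Par.mu_pos (j : ℕ) : 256 ≤ P.mu j := by
  induction j with
  | zero => exact P.hmu0
  | succ j ih =>
    rw [P.hmu, P.hm]
    calc 256 ≤ P.mu j := ih
      _ ≤ P.mu j ^ 8 := Nat.le_self_pow (by norm_num) _
      _ ≤ _ := Nat.le_self_pow (by norm_num) _

lemma Par.mu_le_m (j : ℕ) : P.mu j ≤ P.m j := by
  rw [P.hm]; exact Nat.le_self_pow (by norm_num) _

lemma Par.m_pos (j : ℕ) : 256 ≤ P.m j := (P.mu_pos j).trans (P.mu_le_m j)
lemma Par.muR (j : ℕ) : (256:ℝ) ≤ P.mu j := by exact_mod_cast P.mu_pos j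
lemma Par.mR (j : ℕ) : (256:ℝ) ≤ P.m j := by exact_mod_cast P.m_pos j
lemma Par.muQ (j : ℕ) : (256:ℚ) ≤ P.mu j := by exact_mod_cast P.mu_pos j
lemma Par.mQ (j : ℕ) : (256:ℚ) ≤ P.m j := by exact_mod_cast P.m_pos j
end

lemma Wt.abs_le {τ : Option ℕ} {f : FF} (h : Wt P τ f) (i : ℕ) : |f i| ≤ 1 := by
  induction h with
  | zero => simp
  | unit n ε hε =>
    rw [Finsupp.single_apply]; split_ifs
    · rcases hε with h | h <;> simp [h]
    · simp
  | even j d g τ hd hg hs ih =>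
    have h1 := hs.sum_abs_le i ih
    have h2 := P.mQ j
    simp only [Finsupp.smul_apply, Finsupp.finsetSum_apply, smul_eq_mul, abs_mul]
    have : |1 / (P.m j : ℚ)| ≤ 1 := by
      rw [abs_of_nonneg (by positivity), div_le_one (by linarith)]; linarith
    nlinarith [abs_nonneg (1 / (P.m j : ℚ)), abs_nonneg (∑ q ∈ Finset.range d, g q i)]
  | spec r d c g ε a b hd hg hodd hc hs hε ih =>
    have h1 := hs.sum_abs_le i ih
    have h2 := P.muQ r
    simp only [Finsupp.smul_apply, smul_eq_mul, abs_mul, res_apply]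
    have : |ε / (P.mu r : ℚ)| ≤ 1 := by
      rw [abs_div, abs_of_nonneg (by positivity : (0:ℚ) ≤ P.mu r), div_le_one (by linarith)]
      have : |ε| = 1 := by rcases hε with h | h <;> simp [h]
      linarith
    split_ifs
    · rw [Finsupp.finsetSum_apply]
      nlinarith [abs_nonneg (ε / (P.mu r : ℚ)), abs_nonneg (∑ q ∈ Finset.range d, g q i)]
    · simp

noncomputable def l1 (x : VV) : ℝ := ∑ i ∈ x.support, |x i|

lemma InW.pr_le_l1 {f : FF} (h : InW P f) (x : VV) : |pr f x| ≤ l1 x := by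
  obtain ⟨τ, h⟩ := h
  rw [pr_eq_sum _ x (Finset.Subset.refl _), l1]
  refine (Finset.abs_sum_le_sum_abs _ _).trans (Finset.sum_le_sum fun i _ => ?_)
  rw [abs_mul]
  have : |(f i : ℝ)| ≤ 1 := by exact_mod_cast h.abs_le i
  nlinarith [abs_nonneg (x i)]

section space
variable (P)

abbrev LL := lp (fun _ : {f // InW P f} => ℝ) ⊤

noncomputable def iota : VV →ₗ[ℝ] LL P where
  toFun x := ⟨fun f => pr f.1 x, memℓp_infty ⟨l1 x, by
    rintro _ ⟨f, rfl⟩; exact f.2.pr_le_l1 x⟩⟩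
  map_add' x y := by ext f; exact map_add (pr f.1) x y
  map_smul' c x := by ext f; exact map_smul (pr f.1) c x

noncomputable def nrm (x : VV) : ℝ := ‖iota P x‖
variable {P}

lemma iota_apply (x : VV) (f : {f // InW P f}) : iota P x f = pr f.1 x := rfl

lemma InW.le_nrm {f : FF} (h : InW P f) (x : VV) : |pr f x| ≤ nrm P x :=
  lp.norm_apply_le_norm (by simp) (iota P x) ⟨f, h⟩

lemma nrm_le {x : VV} {c : ℝ} (h : ∀ f, InW P f → |pr f x| ≤ c) : nrm P x ≤ c := by
  have h0 : 0 ≤ c := by simpa using h 0 InW.zero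
  exact lp.norm_le_of_forall_le h0 fun f => h f.1 f.2

lemma nrm_nonneg (x : VV) : 0 ≤ nrm P x := norm_nonneg _

lemma exists_lt_pr {x : VV} {c : ℝ} (h : c < nrm P x) : ∃ f, InW P f ∧ c < pr f x := by
  by_contra hc
  push Not at hc
  refine absurd (nrm_le (c := c) fun f hf => abs_le.2 ⟨?_, hc f hf⟩) (not_le.2 h)
  have := hc _ hf.neg
  rw [pr_neg] at this; linarith

lemma nrm_smul (c : ℝ) (x : VV) : nrm P (c • x) = |c| * nrm P x := by
  simp [nrm, norm_smul]

lemma coord_le_nrm (x : VV) (i : ℕ) : |x i| ≤ nrm P x := by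
  have := InW.le_nrm (P := P) ⟨_, Wt.unit i 1 (Or.inl rfl)⟩ x
  have h2 : pr (Finsupp.single i 1) x = x i := by
    rw [pr_eq_sum _ x (s := insert i x.support) (by simp)]
    rw [Finset.sum_eq_single i]
    · simp
    · intro b _ hb; rw [Finsupp.single_apply, if_neg (Ne.symm hb)]; simp
    · simp
  rwa [h2] at this

lemma nrm_pos {x : VV} (h : x ≠ 0) : 0 < nrm P x := by
  obtain ⟨i, hi⟩ := Finsupp.ne_iff.1 h
  exact lt_of_lt_of_le (abs_pos.2 (by simpa using hi)) (coord_le_nrm x i)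

lemma nrm_resV_le (a b : ℕ) (x : VV) : nrm P (resV a b x) ≤ nrm P x :=
  nrm_le fun f hf => by rw [pr_resV]; exact (hf.res a b).le_nrm x

end space

end GM


namespace GM
variable {P : Par}

/-- successive vectors -/
def SuccV (v : ℕ → VV) : Prop :=
  ∀ n n', n < n' → ∀ i i', v n i ≠ 0 → v n' i' ≠ 0 → i < i'

def Touch (g : FF) (x : VV) : Prop := ∃ i, g i ≠ 0 ∧ x i ≠ 0

lemma pr_of_not_touch {g : FF} {x : VV} (h : ¬ Touch g x) : pr g x = 0 := by
  by_contra h0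
  obtain ⟨i, h1, h2⟩ := pr_ne_zero h0
  exact h ⟨i, h2, h1⟩

open Classical in
lemma touch_card {g : ℕ → FF} {d : ℕ} (hg : Succ g d) {v : ℕ → VV} (hv : SuccV v) (A : Finset ℕ) :
    ((Finset.range d ×ˢ A).filter (fun p => Touch (g p.1) (v p.2))).card ≤ d + A.card := by
  have : (Finset.range (d + A.card)).card = d + A.card := by simp
  rw [← this]
  apply Finset.card_le_card_of_injOn (fun p => p.1 + (A.filter (· < p.2)).card)
  · rintro ⟨q, n⟩ hp
    simp only [Finset.coe_filter, Finset.mem_product, Finset.mem_range, Set.mem_ofPred_eq] at hp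
    simp only [Finset.coe_range, Set.mem_Iio]
    have : (A.filter (· < n)).card ≤ A.card := Finset.card_filter_le _ _
    omega
  · have key : ∀ q n q' n', q < q' → q' < d → Touch (g q) (v n) → Touch (g q') (v n') →
        q + (A.filter (· < n)).card < q' + (A.filter (· < n')).card := by
      rintro q n q' n' hqq hd ⟨i, hi, hi2⟩ ⟨i', hi', hi2'⟩
      have h1 := hg q q' hqq hd i i' hi hi'
      have h2 : n ≤ n' := by
        by_contra hlt
        have := hv n' n (by omega) i' i hi2' hi2
        omega
      have : (A.filter (· < n)).card ≤ (A.filter (· < n')).card := by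
        apply Finset.card_le_card
        intro x; simp only [Finset.mem_filter]; rintro ⟨h, h'⟩; exact ⟨h, by omega⟩
      omega
    rintro ⟨q, n⟩ hp ⟨q', n'⟩ hp' heq
    simp only [Finset.coe_filter, Finset.mem_product, Finset.mem_range, Set.mem_ofPred_eq] at hp hp' heq
    rcases lt_trichotomy q q' with h | h | h
    · have := key q n q' n' h hp'.1.1 hp.2 hp'.2; omega
    · subst h
      have h3 : (A.filter (· < n)).card = (A.filter (· < n')).card := by omega
      have lt : ∀ a b, a ∈ A → a < b → (A.filter (· < a)).card < (A.filter (· < b)).card := by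
        intro a b ha hab
        apply Finset.card_lt_card
        rw [Finset.ssubset_iff_of_subset]
        · exact ⟨a, by simp [ha, hab], by simp⟩
        · intro x; simp only [Finset.mem_filter]; rintro ⟨h, h'⟩; exact ⟨h, by omega⟩
      rcases lt_trichotomy n n' with h | h | h
      · have := lt n n' hp.1.2 h; omega
      · rw [h]
      · have := lt n' n hp'.1.2 h; omega
    · have := key q' n' q n h hp.1.1 hp'.2 hp.2; omega

open Classical in
/-- summing bounds of the form `c * #I + e` over the members of a successive family -/
lemma touch_sum {g : ℕ → FF} {d : ℕ} (hg : Succ g d) {v : ℕ → VV} (hv : SuccV v) (A : Finset ℕ)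
    {c e : ℝ} (hc : 0 ≤ c)
    (hb : ∀ q < d, ∀ I ⊆ A, ∑ n ∈ I, |pr (g q) (v n)| ≤ c * I.card + e) :
    ∑ q ∈ Finset.range d, ∑ n ∈ A, |pr (g q) (v n)| ≤ c * (d + A.card) + d * e := by
  have h1 : ∀ q ∈ Finset.range d, ∑ n ∈ A, |pr (g q) (v n)| ≤
      c * (A.filter (fun n => Touch (g q) (v n))).card + e := by
    intro q hq
    rw [← Finset.sum_filter_of_ne (p := fun n => Touch (g q) (v n))]
    · exact hb q (by simpa using hq) _ (Finset.filter_subset _ _)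
    · intro n _ hne
      by_contra h
      exact hne (by rw [pr_of_not_touch h, abs_zero])
  refine (Finset.sum_le_sum h1).trans ?_
  rw [Finset.sum_add_distrib, ← Finset.mul_sum]
  have h2 := touch_card hg hv A
  have h3 : ∑ q ∈ Finset.range d, ((A.filter (fun n => Touch (g q) (v n))).card) =
    ((Finset.range d ×ˢ A).filter (fun p => Touch (g p.1) (v p.2))).card := by
    rw [Finset.card_filter, Finset.sum_product]
    simp only [Finset.card_filter]
  rw [← h3] at h2
  have h4 : ((∑ q ∈ Finset.range d, ((A.filter (fun n => Touch (g q) (v n))).card : ℝ))) ≤ d + A.card := by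
    exact_mod_cast h2
  simp only [Finset.sum_const, Finset.card_range, nsmul_eq_mul]
  nlinarith [mul_le_mul_of_nonneg_left h4 hc]

lemma touch_sum' {g : ℕ → FF} {d : ℕ} (hg : Succ g d) {v : ℕ → VV} (hv : SuccV v) (A : Finset ℕ)
    {c : ℝ} (hc : 0 ≤ c)
    (hb : ∀ q < d, ∀ n ∈ A, |pr (g q) (v n)| ≤ c) :
    ∑ q ∈ Finset.range d, |pr (g q) (∑ n ∈ A, v n)| ≤ c * (d + A.card) := by
  have := touch_sum hg hv A (e := 0) hc (fun q hq I hI => by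
    calc ∑ n ∈ I, |pr (g q) (v n)| ≤ ∑ n ∈ I, c := Finset.sum_le_sum fun n hn => hb q hq n (hI hn)
      _ = _ := by simp [mul_comm])
  simp only [mul_zero, add_zero] at this
  refine le_trans (Finset.sum_le_sum fun q _ => ?_) this
  rw [map_sum]; exact Finset.abs_sum_le_sum_abs _ _

open Classical in
lemma count_aux {g : ℕ → FF} {d : ℕ} (hg : Succ g d) {v : ℕ → VV} (hv : SuccV v)
    {t : ℝ} (ht : 0 ≤ t) {c : ℕ}
    (hq : ∀ q < d, ∀ A : Finset ℕ, (∀ n ∈ A, t < |pr (g q) (v n)|) → A.card ≤ c)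
    (A : Finset ℕ) (hA : ∀ n ∈ A, t < |∑ q ∈ Finset.range d, pr (g q) (v n)|) :
    A.card ≤ d + d * c := by
  set A1 := A.filter (fun n => ∃ q < d, t < |pr (g q) (v n)|) with hA1
  set A2 := A.filter (fun n => ¬ ∃ q < d, t < |pr (g q) (v n)|) with hA2
  have hsplit : A1.card + A2.card = A.card := Finset.card_filter_add_card_filter_not _
  have h1 : A1.card ≤ d * c := by
    have hsub : A1 ⊆ (Finset.range d).biUnion (fun q => A.filter (fun n => t < |pr (g q) (v n)|)) := by
      intro n hn
      simp only [hA1, Finset.mem_filter] at hn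
      obtain ⟨hn, q, hqd, h⟩ := hn
      simp only [Finset.mem_biUnion, Finset.mem_range, Finset.mem_filter]
      exact ⟨q, hqd, hn, h⟩
    refine (Finset.card_le_card hsub).trans ?_
    have := Finset.card_biUnion_le_card_mul (Finset.range d)
      (fun q => A.filter (fun n => t < |pr (g q) (v n)|)) c
      (fun q hqd => hq q (by simpa using hqd) _ (fun n hn => (Finset.mem_filter.1 hn).2))
    simpa using this
  have h2 : A2.card ≤ d := by
    have h3 := touch_card hg hv A2
    have h4 : 2 * A2.card ≤ ((Finset.range d ×ˢ A2).filter (fun p => Touch (g p.1) (v p.2))).card := by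
      have he : ((Finset.range d ×ˢ A2).filter (fun p => Touch (g p.1) (v p.2))).card =
          ∑ n ∈ A2, ((Finset.range d).filter (fun q => Touch (g q) (v n))).card := by
        generalize A2 = B
        rw [Finset.card_filter, Finset.sum_product_right]
        simp only [Finset.card_filter]
      rw [he, mul_comm, ← smul_eq_mul, ← Finset.sum_const]
      apply Finset.sum_le_sum
      intro n hn
      simp only [hA2, Finset.mem_filter] at hn
      obtain ⟨hn, hno⟩ := hn
      push Not at hno
      by_contra hlt
      have h5 : ((Finset.range d).filter (fun q => Touch (g q) (v n))).card ≤ 1 := by omega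
      have h6 := hA n hn
      rw [← Finset.sum_filter_of_ne (p := fun q => Touch (g q) (v n))] at h6
      · rcases Finset.card_le_one_iff_subset_singleton.1 h5 with ⟨q0, hq0⟩
        rcases Finset.subset_singleton_iff.1 hq0 with h7 | h7
        · rw [h7] at h6; simp at h6; linarith
        · have hm : q0 ∈ (Finset.range d).filter (fun q => Touch (g q) (v n)) := by rw [h7]; simp
          rw [h7] at h6
          simp only [Finset.sum_singleton] at h6
          have := hno q0 (by simpa using (Finset.mem_filter.1 hm).1)
          linarith
      · intro q _ hne
        by_contra h
        exact hne (pr_of_not_touch h)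
    omega
  omega

/-- data of a special functional -/
structure Spec (P : Par) (r d : ℕ) (c : ℕ → ℕ) (g : ℕ → FF) : Prop where
  hd : d ≤ P.N r
  hg : ∀ q, q < d → Ev P (c q) (g q)
  hodd : ∀ q, q < d → Odd (c q)
  hc : ∀ q, q + 1 < d → c q < c (q+1) ∧ (c q, g q) ∈ P.H (c (q+1))
  hs : Succ g d

lemma Spec.lt {r d : ℕ} {c : ℕ → ℕ} {g : ℕ → FF} (h : Spec P r d c g) {q q' : ℕ} (hq : q < q')
    (hd : q' < d) : c q < c q' := by
  induction q', hq using Nat.le_induction with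
  | base => exact (h.hc q hd).1
  | succ k hk ih => exact (ih (by omega)).trans (h.hc k hd).1

lemma Spec.initial {r d : ℕ} {c : ℕ → ℕ} {g : ℕ → FF} (h : Spec P r d c g) (L : ℕ) :
    ∃ d' ≤ d, d' ≤ L ∧ ∀ q < d, (c q < L ↔ q < d') := by
  have hge : ∀ q < d, q ≤ c q := by
    intro q hq
    induction q with
    | zero => omega
    | succ q ih => have := ih (by omega); have := (h.hc q hq).1; omega
  have hex : ∃ e, e = d ∨ L ≤ c e := ⟨d, Or.inl rfl⟩
  classical
  set e := Nat.find hex with he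
  have h1 := Nat.find_spec hex
  rw [← he] at h1
  have h2 : ∀ x < e, x ≠ d ∧ c x < L := by
    intro x hx
    have := Nat.find_min hex hx
    push Not at this; exact this
  have hed : e ≤ d := Nat.find_min' hex (Or.inl rfl)
  refine ⟨e, hed, ?_, ?_⟩
  · rcases Nat.eq_zero_or_pos e with h0 | h0
    · omega
    · have := h2 (e-1) (by omega)
      have := hge (e-1) (by omega)
      omega
  · intro q hq
    constructor
    · intro hcq
      by_contra hlt
      rcases h1 with h1 | h1
      · omega
      · rcases Nat.lt_or_ge e q with h3 | h3
        · have := h.lt h3 hq; omega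
        · have : e = q := by omega
          rw [this] at h1; omega
    · intro hqe; exact (h2 q hqe).2

lemma pr_spec {r d : ℕ} {g : ℕ → FF} {ε : ℚ} {a b : ℕ} (hε : ε = 1 ∨ ε = -1) (x : VV) :
    |pr ((ε / (P.mu r : ℚ)) • res a b (∑ q ∈ Finset.range d, g q)) x| =
      (1 / (P.mu r : ℝ)) * |∑ q ∈ Finset.range d, pr (res a b (g q)) x| := by
  rw [pr_smul, res_sum, pr_sum, abs_mul]
  congr 1
  push_cast
  rw [abs_div, abs_of_nonneg (by positivity : (0:ℝ) ≤ P.mu r)]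
  congr 1
  rcases hε with h | h <;> simp [h]

lemma pr_even {j d : ℕ} {g : ℕ → FF} (x : VV) :
    |pr ((1 / (P.m j : ℚ)) • (∑ q ∈ Finset.range d, g q)) x| =
      (1 / (P.m j : ℝ)) * |∑ q ∈ Finset.range d, pr (g q) x| := by
  rw [pr_smul, pr_sum, abs_mul]
  congr 1
  push_cast
  rw [abs_of_nonneg (by positivity)]

open Classical in
theorem count_lemma {v : ℕ → VV} (hv : SuccV v) {θ C : ℝ} (hθ : 0 < θ) {L R D : ℕ}
    (hD : ∀ i < L, P.n i ≤ D) (hL : L ≤ D) (hC : ∀ g, InW P g → ∀ n, |pr g (v n)| ≤ C)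
    (Ha : ∀ i ≥ L, ∀ g, Ev P i g → ∀ A : Finset ℕ, (∀ n ∈ A, θ < |pr g (v n)|) → A.card ≤ R)
    (Hb : ∀ r d c g a b, Spec P r d c g → ∀ A : Finset ℕ,
      (∀ n ∈ A, θ < (1 / (P.mu r : ℝ)) * |∑ q ∈ Finset.range d, pr (res a b (g q)) (v n)| ∧
        θ / 4 < |∑ q ∈ (Finset.range d).filter (fun q => L ≤ c q), pr (res a b (g q)) (v n)|) →
      A.card ≤ R) (S : ℕ) :
    ∀ τ ≥ θ, C ≤ τ * (7/4)^S → ∀ g, InW P g → ∀ A : Finset ℕ,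
      (∀ n ∈ A, τ < |pr g (v n)|) → A.card ≤ cnt R D S := by
  induction S with
  | zero =>
    intro τ _ hτ g hg A hA
    rcases A.eq_empty_or_nonempty with h | ⟨n, hn⟩
    · simp [h]
    · have := hA n hn
      have := hC g hg n
      simp at hτ; linarith
  | succ S ih =>
    intro τ hτ hCτ g hg A hA
    have ih' := ih (7/4 * τ) (by linarith) (by rw [pow_succ] at hCτ; linarith)
    have hτ0 : 0 < τ := by linarith
    rw [cnt]
    obtain ⟨tg, hg⟩ := hg
    cases hg with
    | zero =>
      rcases A.eq_empty_or_nonempty with h | ⟨n, hn⟩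
      · simp [h]
      · have := hA n hn
        simp at this; linarith
    | unit k ε hε =>
      have : A.card ≤ 1 := by
        rw [Finset.card_le_one]
        have hk : ∀ n ∈ A, v n k ≠ 0 := by
          intro n hn h0
          have h1 := hA n hn
          rw [pr_eq_zero] at h1
          · simp at h1; linarith
          · intro i hi
            rw [Finsupp.single_apply, if_neg]; rintro rfl; exact hi h0
        intro n hn n' hn'
        by_contra hne
        rcases lt_or_gt_of_ne hne with h | h
        · have := hv n n' h k k (hk n hn) (hk n' hn'); omega
        · have := hv n' n h k k (hk n' hn') (hk n hn); omega
      omega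
    | even i d g τ' hd hg hs =>
      by_cases hi : L ≤ i
      · have := Ha i hi _ (Wt.even i d g τ' hd hg hs) A (fun n hn => by
          have := hA n hn; linarith)
        omega
      · have h1 := count_aux hs hv (t := 7/4*τ) (by linarith) (c := cnt R D S)
          (fun q hq A' hA' => ih' (g q) ⟨_, hg q hq⟩ A' hA') A (fun n hn => by
            have h2 := hA n hn
            rw [pr_even] at h2
            have h3 := P.mR i
            rw [one_div, inv_mul_eq_div, lt_div_iff₀ (by linarith)] at h2
            nlinarith)
        have h2 : d ≤ D := hd.trans (hD i (by omega))
        have : d * cnt R D S ≤ D * cnt R D S := Nat.mul_le_mul_right _ h2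
        omega
    | spec r d c g ε a b hd hg hodd hc hs hε =>
      have hsp : Spec P r d c g := ⟨hd, hg, hodd, hc, hs⟩
      set Q : ℕ → Prop := fun n =>
        θ / 4 < |∑ q ∈ (Finset.range d).filter (fun q => L ≤ c q), pr (res a b (g q)) (v n)| with hQ
      have hsplit : (A.filter Q).card + (A.filter (fun n => ¬ Q n)).card = A.card :=
        Finset.card_filter_add_card_filter_not _
      have h1 : (A.filter Q).card ≤ R := by
        apply Hb r d c g a b hsp
        intro n hn
        rw [Finset.mem_filter] at hn
        refine ⟨?_, hn.2⟩
        have := hA n hn.1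
        rw [pr_spec hε] at this
        linarith
      obtain ⟨d', hd'd, hd'L, hd'⟩ := hsp.initial L
      have h2 : (A.filter (fun n => ¬ Q n)).card ≤ d' + d' * cnt R D S := by
        apply count_aux ((hs.res a b).mono hd'd) hv (t := 7/4*τ) (by linarith) (c := cnt R D S)
          (fun q hq A' hA' => ih' _ (InW.res ⟨_, hg q (by omega)⟩ a b) A' hA')
        intro n hn
        rw [Finset.mem_filter] at hn
        have h3 := hA n hn.1
        rw [pr_spec hε] at h3
        have h4 := P.muR r
        rw [one_div, inv_mul_eq_div, lt_div_iff₀ (by linarith)] at h3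
        have h5 := hn.2
        simp only [hQ, not_lt] at h5
        rw [← Finset.sum_filter_add_sum_filter_not _ (fun q => L ≤ c q)] at h3
        have h6 : (Finset.range d).filter (fun q => ¬ L ≤ c q) = Finset.range d' := by
          ext q
          simp only [Finset.mem_filter, Finset.mem_range, not_le]
          constructor
          · rintro ⟨h, h'⟩; exact (hd' q h).1 h'
          · intro h; exact ⟨by omega, (hd' q (by omega)).2 h⟩
        rw [h6] at h3
        have h7 := abs_add_le (∑ q ∈ (Finset.range d).filter (fun q => L ≤ c q), pr (res a b (g q)) (v n))
          (∑ q ∈ Finset.range d', pr (res a b (g q)) (v n))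
        nlinarith
      have h3 : d' * cnt R D S ≤ D * cnt R D S := Nat.mul_le_mul_right _ (by omega)
      omega

end GM


namespace GM
variable {P : Par}

noncomputable def lo (x : VV) : ℕ := sInf {i | x i ≠ 0}
noncomputable def hi (x : VV) : ℕ := x.support.sup id + 1

lemma lo_le {x : VV} {i : ℕ} (h : x i ≠ 0) : lo x ≤ i := Nat.sInf_le h
lemma lt_hi {x : VV} {i : ℕ} (h : x i ≠ 0) : i < hi x :=
  Nat.lt_succ_of_le (Finset.le_sup (f := id) (by simpa using h))

lemma suppIn_lo_hi (x : VV) : SuppIn (lo x) (hi x) x := fun _ h => ⟨lo_le h, lt_hi h⟩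

lemma exists_lo {x : VV} (h : x ≠ 0) : x (lo x) ≠ 0 := by
  obtain ⟨i, hi⟩ := Finsupp.ne_iff.1 h
  exact Nat.sInf_mem (s := {i | x i ≠ 0}) ⟨i, by simpa using hi⟩

lemma exists_hi {x : VV} (h : x ≠ 0) : ∃ i, x i ≠ 0 ∧ hi x = i + 1 := by
  have hne : x.support.Nonempty := by simpa using h
  obtain ⟨i, hi1, hi2⟩ := Finset.exists_mem_eq_sup x.support hne id
  exact ⟨i, by simpa using hi1, by rw [hi, hi2]; rfl⟩

lemma rng_lt {x y : VV} (hx : x ≠ 0) (hy : y ≠ 0) (h : ∀ i i', x i ≠ 0 → y i' ≠ 0 → i < i')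
    {i i' : ℕ} (h1 : i < hi x) (h2 : lo y ≤ i') : i < i' := by
  obtain ⟨k, hk, hk'⟩ := exists_hi hx
  have := h k (lo y) hk (exists_lo hy)
  omega

lemma diag_succ {v : ℕ → VV} (hv : SuccV v) (hne : ∀ n, v n ≠ 0) (f : ℕ → FF) (d : ℕ) :
    Succ (fun q => res (lo (v q)) (hi (v q)) (f q)) d := by
  intro q q' hq _ i i' h1 h2
  have h1 := res_ne h1
  have h2 := res_ne h2
  exact rng_lt (hne q) (hne q') (hv q q' hq) h1.2.1 h2.1

lemma diag_pr {v : ℕ → VV} (hv : SuccV v) (hne : ∀ n, v n ≠ 0) (f : FF) (q n : ℕ) :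
    pr (res (lo (v q)) (hi (v q)) f) (v n) = if n = q then pr f (v q) else 0 := by
  split_ifs with h
  · subst h; exact pr_res_of_supp (suppIn_lo_hi _) f
  · apply pr_eq_zero
    intro i hi1
    by_contra h0
    have h1 := res_ne h0
    rcases lt_or_gt_of_ne h with h2 | h2
    · have := rng_lt (hne n) (hne q) (hv n q h2) (lt_hi hi1) h1.1; omega
    · have := rng_lt (hne q) (hne n) (hv q n h2) h1.2.1 (lo_le hi1); omega

lemma diag_sum {v : ℕ → VV} (hv : SuccV v) (hne : ∀ n, v n ≠ 0) (f : ℕ → FF) (d : ℕ) :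
    ∑ q ∈ Finset.range d, pr (res (lo (v q)) (hi (v q)) (f q)) (∑ n ∈ Finset.range d, v n)
      = ∑ q ∈ Finset.range d, pr (f q) (v q) := by
  apply Finset.sum_congr rfl
  intro q hq
  rw [map_sum]
  simp only [diag_pr hv hne]
  rw [Finset.sum_ite_eq' ]
  simp [hq]

lemma sum_Ico_blocks {E : Type*} [AddCommMonoid E] (v : ℕ → E) (M p q : ℕ) (h : p ≤ q) :
    ∑ b ∈ Finset.Ico p q, ∑ i ∈ Finset.Ico (b*M) ((b+1)*M), v i
      = ∑ i ∈ Finset.Ico (p*M) (q*M), v i := by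
  induction q, h using Nat.le_induction with
  | base => simp
  | succ q hq ih =>
    rw [Finset.sum_Ico_succ_top hq, ih, Finset.sum_Ico_consecutive]
    · exact Nat.mul_le_mul_right _ hq
    · exact Nat.mul_le_mul_right _ (by omega)

lemma sum_apply_ne {A : Finset ℕ} {v : ℕ → VV} {i : ℕ} (h : (∑ n ∈ A, v n) i ≠ 0) :
    ∃ n ∈ A, v n i ≠ 0 := by
  rw [Finsupp.finsetSum_apply] at h
  exact Finset.exists_ne_zero_of_sum_ne_zero h

lemma blk_succ {v : ℕ → VV} (hv : SuccV v) (M : ℕ) :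
    SuccV (fun b => ∑ i ∈ Finset.Ico (b*M) ((b+1)*M), v i) := by
  intro n n' h i i' hi hi'
  obtain ⟨a, ha, hai⟩ := sum_apply_ne hi
  obtain ⟨a', ha', hai'⟩ := sum_apply_ne hi'
  rw [Finset.mem_Ico] at ha ha'
  have : (n+1)*M ≤ n'*M := Nat.mul_le_mul_right _ (by omega)
  exact hv a a' (by omega) i i' hai hai'

theorem lemmaA (j : ℕ) (hk : 1 ≤ P.k j) {v : ℕ → VV} (hv : SuccV v)
    (hub : ∀ f, InW P f → ∀ i, |pr f (v i)| ≤ 1)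
    (hlb : ∀ i, ∃ f, InW P f ∧ 3/4 < pr f (v i)) :
    ∃ (l len : ℕ) (α : ℝ) (x : VV), x = α • ∑ i ∈ Finset.Ico l (l + len), v i ∧
      0 < α ∧ P.k j ≤ len ∧ α * len ≤ P.m j ∧
      (∀ f, InW P f → |pr f x| ≤ 1) ∧ (∃ f, InW P f ∧ 1/2 < pr f x) ∧
      (∀ d ≤ P.k j, ∀ g : ℕ → FF, (∀ q < d, InW P (g q)) → Succ g d →
        ∑ q ∈ Finset.range d, |pr (g q) x| ≤ 2) := by
  set K := P.k j with hK
  set blk : ℕ → ℕ → VV := fun t b => ∑ i ∈ Finset.Ico (b*K^t) ((b+1)*K^t), v i with hblk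
  have hK0 : (0:ℝ) < K := by exact_mod_cast hk
  have hm0 : (0:ℝ) < P.m j := by linarith [P.mR j]
  by_cases hall : ∀ t ≤ P.T j, ∀ a, ∀ f, InW P f → |pr f (blk t a)| ≤ ((K:ℝ)/2)^t
  · exfalso
    have h1 := hall (P.T j) le_rfl 0
    choose f hf hf2 using hlb
    have hne : ∀ n, v n ≠ 0 := by
      intro n h0
      have := hf2 n
      rw [h0] at this; simp at this; linarith
    have h2 := InW.even (P := P) (j := j) (d := P.n j) le_rfl
      (fun q _ => (hf q).res (lo (v q)) (hi (v q))) (diag_succ hv hne f (P.n j))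
    have h3 := h1 _ h2.inW
    rw [pr_even] at h3
    have h4 : blk (P.T j) 0 = ∑ n ∈ Finset.range (P.n j), v n := by
      simp [hblk, P.hn, hK]
    rw [h4, diag_sum hv hne] at h3
    have h5 : (3/4 : ℝ) * P.n j ≤ ∑ q ∈ Finset.range (P.n j), pr (f q) (v q) := by
      have := Finset.sum_le_sum (s := Finset.range (P.n j)) (fun q _ => (hf2 q).le)
      simp at this; linarith
    have h6 : ((K:ℝ)/2)^(P.T j) = P.n j / (2 * P.m j) := by
      rw [div_pow]
      congr 1
      · rw [P.hn]; push_cast; rfl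
      · have := P.hT j
        exact_mod_cast this
    have h7 : (0:ℝ) < P.n j := by rw [P.hn]; push_cast; positivity
    rw [h6] at h3
    have h8 := h5.trans (le_abs_self _)
    rw [one_div, inv_mul_eq_div, div_le_div_iff₀ hm0 (by positivity)] at h3
    have h9 := mul_le_mul_of_nonneg_right h8 (by positivity : (0:ℝ) ≤ 2 * P.m j)
    have h10 : 0 < (P.n j : ℝ) * P.m j := by positivity
    nlinarith
  · have hex : ∃ t, ∃ a, ∃ f, InW P f ∧ ((K:ℝ)/2)^t < |pr f (blk t a)| ∧ t ≤ P.T j := by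
      push Not at hall
      obtain ⟨t, ht, a, f, hf, h⟩ := hall
      exact ⟨t, a, f, hf, h, ht⟩
    classical
    set t0 := Nat.find hex with ht0
    obtain ⟨a, f, hf, hlt, htT⟩ := Nat.find_spec hex
    rw [← ht0] at hlt htT
    have hmin : ∀ t < t0, ∀ a f, InW P f → |pr f (blk t a)| ≤ ((K:ℝ)/2)^t := by
      intro t ht a f hf
      by_contra hc
      exact Nat.find_min hex ht ⟨a, f, hf, not_le.1 hc, by omega⟩
    have hpos : t0 ≠ 0 := by
      intro h0
      rw [h0] at hlt
      have : blk 0 a = v a := by simp [hblk]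
      rw [this] at hlt
      have := hub f hf a
      simp at hlt; linarith
    obtain ⟨t, ht⟩ : ∃ t, t0 = t + 1 := ⟨t0 - 1, by omega⟩
    rw [ht] at hlt htT
    have hsub : blk (t+1) a = ∑ b ∈ Finset.Ico (a*K) ((a+1)*K), blk t b := by
      simp only [hblk]
      rw [sum_Ico_blocks _ _ _ _ (Nat.mul_le_mul_right _ (by omega))]
      congr 2 <;> rw [pow_succ] <;> ring
    set α : ℝ := 2^t / (K:ℝ)^(t+1) with hα
    have hα0 : 0 < α := by positivity
    have hαK : α * ((K:ℝ)/2)^t * K = 1 := by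
      rw [hα, div_pow, pow_succ]; field_simp
    refine ⟨a*K^(t+1), K^(t+1), α, α • blk (t+1) a, ?_, hα0, ?_, ?_, ?_, ?_, ?_⟩
    · congr 1
      simp only [hblk]; congr 2; ring
    · exact Nat.le_self_pow (by omega) _
    · rw [hα]; push_cast
      rw [div_mul_cancel₀ _ (by positivity)]
      have h1 : 2^(t+1) ≤ 2 * P.m j := by rw [← P.hT]; exact Nat.pow_le_pow_right (by norm_num) htT
      have h2 : 2^t ≤ P.m j := by rw [pow_succ] at h1; omega
      exact_mod_cast h2
    · intro f hf
      rw [map_smul, smul_eq_mul, abs_mul, abs_of_pos hα0, hsub, map_sum]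
      have : |∑ b ∈ Finset.Ico (a*K) ((a+1)*K), pr f (blk t b)| ≤ K * ((K:ℝ)/2)^t := by
        refine (Finset.abs_sum_le_sum_abs _ _).trans ?_
        refine (Finset.sum_le_sum fun b _ => hmin t (by omega) b f hf).trans ?_
        rw [Finset.sum_const, Nat.card_Ico, ← Nat.sub_mul]
        simp
      calc _ ≤ α * (K * ((K:ℝ)/2)^t) := mul_le_mul_of_nonneg_left this hα0.le
        _ = 1 := by rw [← hαK]; ring
    · have h1 : ∃ f', InW P f' ∧ pr f' (blk (t+1) a) = |pr f (blk (t+1) a)| := by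
        rcases abs_cases (pr f (blk (t+1) a)) with ⟨h, _⟩ | ⟨h, _⟩
        · exact ⟨f, hf, h.symm⟩
        · exact ⟨-f, hf.neg, by rw [pr_neg, h]⟩
      obtain ⟨f', hf', he⟩ := h1
      refine ⟨f', hf', ?_⟩
      rw [map_smul, smul_eq_mul, he]
      calc (1/2 : ℝ) = α * ((K:ℝ)/2)^(t+1) := by rw [pow_succ]; linarith
        _ < _ := mul_lt_mul_of_pos_left hlt hα0
    · intro d hd g hg hs
      have h1 := touch_sum' hs (blk_succ hv (K^t)) (Finset.Ico (a*K) ((a+1)*K))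
        (c := ((K:ℝ)/2)^t) (by positivity) (fun q hq n _ => hmin t (by omega) n (g q) (hg q hq))
      rw [Nat.card_Ico, ← Nat.sub_mul] at h1
      have h2 : (d:ℝ) ≤ K := by exact_mod_cast hd
      have h3 : ∀ q, |pr (g q) (α • blk (t+1) a)| = α * |pr (g q) (blk (t+1) a)| := by
        intro q; rw [map_smul, smul_eq_mul, abs_mul, abs_of_pos hα0]
      simp only [h3]
      rw [← Finset.mul_sum, hsub]
      calc _ ≤ α * (((K:ℝ)/2)^t * (d + ((a + 1 - a) * K : ℕ))) := mul_le_mul_of_nonneg_left h1 hα0.le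
        _ ≤ α * (((K:ℝ)/2)^t * (K + K)) := by
          have : a + 1 - a = 1 := by omega
          rw [this, one_mul]; gcongr
        _ = 2 := by linarith

theorem exists_seq {α : Type*} (R : List α → α → Prop) (h : ∀ l, ∃ a, R l a) :
    ∃ f : ℕ → α, ∀ n, R ((List.range n).map f) (f n) := by
  choose F hF using h
  let L : ℕ → List α := fun n => Nat.rec [] (fun _ l => l ++ [F l]) n
  refine ⟨fun n => F (L n), fun n => ?_⟩
  have : ∀ n, (List.range n).map (fun n => F (L n)) = L n := by
    intro n
    induction n with
    | zero => rfl
    | succ n ih => rw [List.range_succ, List.map_append, ih]; rfl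
  rw [this]; exact hF _

section par
variable (P)
lemma Par.mu_lt_succ (j : ℕ) : P.mu j < P.mu (j+1) := by
  have h := P.mu_pos j
  rw [P.hmu, P.hm, ← pow_mul]
  calc P.mu j = P.mu j ^ 1 := (pow_one _).symm
    _ < _ := Nat.pow_lt_pow_right (by omega) (by norm_num)
lemma Par.mu_strict : StrictMono P.mu := strictMono_nat_of_lt_succ P.mu_lt_succ
lemma Par.m_strict : StrictMono P.m := fun i j h => by
  rw [P.hm, P.hm]; exact Nat.pow_lt_pow_left (P.mu_strict h) (by norm_num)
lemma Par.k_ge (j : ℕ) : P.m j ^ 4 ≤ P.k j := by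
  cases j with
  | zero => exact P.hk0
  | succ j =>
    refine le_trans ?_ (P.hk j)
    rw [mul_assoc]; exact Nat.le_mul_of_pos_right _ (by positivity)
lemma Par.k_ge_N (j : ℕ) : P.m (j+1) ^ 4 * (P.N j + 1) ≤ P.k (j+1) := by
  refine le_trans ?_ (P.hk j)
  rw [mul_right_comm]; exact Nat.le_mul_of_pos_right _ (by positivity)
lemma Par.k_pos (j : ℕ) : 1 ≤ P.k j := le_trans (Nat.one_le_pow _ _ (by linarith [P.m_pos j])) (P.k_ge j)
lemma Par.T_pos (j : ℕ) : P.T j ≠ 0 := by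
  intro h; have := P.hT j; rw [h] at this; have := P.m_pos j; omega
lemma Par.k_le_n (j : ℕ) : P.k j ≤ P.n j := by
  rw [P.hn]; exact Nat.le_self_pow (P.T_pos j) _
lemma Par.N_lt_k_succ (j : ℕ) : P.N j < P.k (j+1) := by
  have h := P.k_ge_N j
  have : 1 ≤ P.m (j+1)^4 := Nat.one_le_pow _ _ (by linarith [P.m_pos (j+1)])
  nlinarith
lemma Par.N_strict : StrictMono P.N := strictMono_nat_of_lt_succ fun j =>
  (P.N_lt_k_succ j).trans_le ((P.k_le_n _).trans (P.hNn _))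
/-- `m_j^4 (N_i+1) ≤ k_j` for `i < j` -/
lemma Par.k_ge_N' {i j : ℕ} (h : i < j) : P.m j ^ 4 * (P.N i + 1) ≤ P.k j := by
  obtain ⟨j, rfl⟩ : ∃ l, j = l + 1 := ⟨j-1, by omega⟩
  refine le_trans ?_ (P.k_ge_N j)
  have : P.N i ≤ P.N j := P.N_strict.monotone (by omega)
  gcongr
lemma Par.N_le_k {i j : ℕ} (h : i < j) : P.N i ≤ P.k j := by
  have := P.k_ge_N' h
  have h1 : 1 ≤ P.m j^4 := Nat.one_le_pow _ _ (by linarith [P.m_pos j])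
  nlinarith
end par

/-- an averaging operation of weight `v` and length at most `d` -/
def Op (P : Par) (v : ℝ) (d : ℕ) (g : FF) : Prop :=
  InW P g ∧ ∃ d' ≤ d, ∃ h : ℕ → FF, (∀ q < d', InW P (h q)) ∧ Succ h d' ∧
    ∀ x, |pr g x| = (1 / v) * |∑ q ∈ Finset.range d', pr (h q) x|

lemma Wt.op {i : ℕ} {g : FF} (h : Ev P i g) : Op P (P.m i) (P.n i) g := by
  refine ⟨h.inW, ?_⟩
  cases h with
  | even j d g τ hd hg hs =>
    exact ⟨d, hd, g, fun q hq => ⟨_, hg q hq⟩, hs, fun x => pr_even x⟩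

lemma Spec.op {r d : ℕ} {c : ℕ → ℕ} {g : ℕ → FF} (h : Spec P r d c g) {ε : ℚ}
    (hε : ε = 1 ∨ ε = -1) (a b : ℕ) :
    Op P (P.mu r) (P.N r) ((ε / (P.mu r : ℚ)) • res a b (∑ q ∈ Finset.range d, g q)) :=
  ⟨⟨_, Wt.spec r d c g ε a b h.hd h.hg h.hodd h.hc h.hs hε⟩, d, h.hd, fun q => res a b (g q),
    fun q hq => ⟨_, (h.hg q hq).res a b⟩, h.hs.res a b, fun x => pr_spec hε x⟩

lemma Op.mono {v : ℝ} {d d' : ℕ} {g : FF} (h : Op P v d g) (hd : d ≤ d') : Op P v d' g := by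
  obtain ⟨h1, e, he, h2⟩ := h
  exact ⟨h1, e, he.trans hd, h2⟩

lemma pr_le_l1' {f : FF} (h : ∀ i, |f i| ≤ 1) (x : VV) : |pr f x| ≤ l1 x := by
  rw [pr_eq_sum _ x (Finset.Subset.refl _), l1]
  refine (Finset.abs_sum_le_sum_abs _ _).trans (Finset.sum_le_sum fun i _ => ?_)
  rw [abs_mul]
  have : |(f i : ℝ)| ≤ 1 := by exact_mod_cast h i
  nlinarith [abs_nonneg (x i)]

lemma Op.le_l1 {v : ℝ} {d : ℕ} {g : FF} (h : Op P v d g) (hv : 0 < v) (x : VV) :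
    |pr g x| ≤ (1/v) * l1 x := by
  obtain ⟨_, e, _, f, hf, hs, heq⟩ := h
  rw [heq x, ← pr_sum]
  apply mul_le_mul_of_nonneg_left _ (by positivity)
  apply pr_le_l1'
  intro i
  rw [Finsupp.finsetSum_apply]
  exact hs.sum_abs_le i fun q hq => (hf q hq).choose_spec.abs_le i

lemma Op.le_fam {v : ℝ} {d : ℕ} {g : FF} (h : Op P v d g) (hv : 0 < v) {x : VV} {K : ℕ} {c : ℝ}
    (hd : d ≤ K) (hx : ∀ d ≤ K, ∀ g : ℕ → FF, (∀ q < d, InW P (g q)) → Succ g d →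
        ∑ q ∈ Finset.range d, |pr (g q) x| ≤ c) : |pr g x| ≤ c / v := by
  obtain ⟨_, e, he, f, hf, hs, heq⟩ := h
  rw [heq x, one_div, inv_mul_eq_div]
  apply div_le_div_of_nonneg_right _ hv.le
  exact (Finset.abs_sum_le_sum_abs _ _).trans (hx e (by omega) f hf hs)

/-- block sequence of nonzero vectors -/
def Blk (z : ℕ → VV) : Prop := SuccV z ∧ ∀ n, z n ≠ 0

lemma SuccV.ge {z : ℕ → VV} (h : Blk z) (n : ℕ) : ∀ i, z n i ≠ 0 → n ≤ i := by
  induction n with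
  | zero => intros; omega
  | succ n ih =>
    intro i hi
    have h1 := h.1 n (n+1) (by omega) _ i (exists_lo (h.2 n)) hi
    have h2 := ih _ (exists_lo (h.2 n))
    omega

lemma lemmaB0 {z : ℕ → VV} (hz : Blk z) (j M : ℕ) :
    ∃ b ∈ Submodule.span ℝ (Set.range z), (∀ i, b i ≠ 0 → M ≤ i) ∧ nrm P b = 1 ∧
      (∀ d ≤ P.k j, ∀ g : ℕ → FF, (∀ q < d, InW P (g q)) → Succ g d →
        ∑ q ∈ Finset.range d, |pr (g q) b| ≤ 4) := by
  set v : ℕ → VV := fun n => (1 / nrm P (z (n + M))) • z (n + M) with hv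
  have hn0 : ∀ n, 0 < nrm P (z n) := fun n => nrm_pos (hz.2 n)
  have hvs : SuccV v := by
    intro n n' h i i' h1 h2
    simp only [hv, Finsupp.smul_apply, smul_eq_mul] at h1 h2
    exact hz.1 _ _ (by omega) i i' (right_ne_zero_of_mul h1) (right_ne_zero_of_mul h2)
  have hnv : ∀ n, nrm P (v n) = 1 := by
    intro n
    have := hn0 (n+M)
    simp only [hv]; rw [nrm_smul, abs_of_pos (by positivity)]; field_simp
  obtain ⟨l, len, α, x, hx, hα, hlen, hαm, hub, ⟨f, hf, hlb⟩, hfam⟩ := lemmaA (P := P) j (P.k_pos j) hvs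
    (fun f hf i => (hf.le_nrm _).trans (hnv i).le) (fun i => exists_lt_pr (by rw [hnv]; norm_num))
  have hnx : 1/2 < nrm P x := lt_of_lt_of_le hlb ((le_abs_self _).trans (hf.le_nrm _))
  refine ⟨(1 / nrm P x) • x, ?_, ?_, ?_, ?_⟩
  · apply Submodule.smul_mem
    rw [hx]
    apply Submodule.smul_mem
    apply Submodule.sum_mem
    intro i _
    exact Submodule.smul_mem _ _ (Submodule.subset_span ⟨_, rfl⟩)
  · intro i hi
    simp only [hx, Finsupp.smul_apply, smul_eq_mul] at hi
    obtain ⟨n, _, h2⟩ := sum_apply_ne (right_ne_zero_of_mul (right_ne_zero_of_mul hi))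
    simp only [hv, Finsupp.smul_apply, smul_eq_mul] at h2
    have := SuccV.ge hz _ i (right_ne_zero_of_mul h2)
    omega
  · rw [nrm_smul, abs_of_pos (by positivity)]; field_simp
  · intro d hd g hg hs
    have h1 := hfam d hd g hg hs
    have h3 : ∀ q, |pr (g q) ((1 / nrm P x) • x)| = (1 / nrm P x) * |pr (g q) x| := by
      intro q; rw [map_smul, smul_eq_mul, abs_mul, abs_of_pos (by positivity)]
    simp only [h3]
    rw [← Finset.mul_sum, one_div, inv_mul_eq_div, div_le_iff₀ (by linarith)]
    linarith

lemma lemmaB1 {z : ℕ → VV} (hz : Blk z) (M : ℕ) :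
    ∃ (a : ℕ → ℕ) (b : ℕ → VV), StrictMono a ∧ SuccV b ∧
      (∀ s, b s ∈ Submodule.span ℝ (Set.range z)) ∧ (∀ s i, b s i ≠ 0 → M ≤ i) ∧
      (∀ s, nrm P (b s) = 1) ∧
      (∀ s, ∀ d ≤ P.k (a s), ∀ g : ℕ → FF, (∀ q < d, InW P (g q)) → Succ g d →
        ∑ q ∈ Finset.range d, |pr (g q) (b s)| ≤ 4) ∧
      ∀ s, ∑ s' ∈ Finset.range s, l1 (b s') ≤ P.mu (a s) := by
  obtain ⟨F, hF⟩ := exists_seq (α := ℕ × VV) (fun l p =>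
    p.2 ∈ Submodule.span ℝ (Set.range z) ∧ (∀ i, p.2 i ≠ 0 → M ≤ i) ∧ nrm P p.2 = 1 ∧
      (∀ d ≤ P.k p.1, ∀ g : ℕ → FF, (∀ q < d, InW P (g q)) → Succ g d →
        ∑ q ∈ Finset.range d, |pr (g q) p.2| ≤ 4) ∧
      (∀ p' ∈ l, p'.1 < p.1) ∧ (∀ p' ∈ l, ∀ i i', p'.2 i ≠ 0 → p.2 i' ≠ 0 → i < i') ∧
      (l.map (fun p => l1 p.2)).sum ≤ P.mu p.1) (by
    intro l
    obtain ⟨A, hA⟩ := exists_nat_ge ((l.map (fun p => l1 p.2)).sum)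
    obtain ⟨b, h1, h2, h3, h4⟩ := lemmaB0 (P := P) hz (A + (l.map (fun p => p.1)).sum + 1)
      (M + (l.map (fun p => hi p.2)).sum)
    refine ⟨⟨_, b⟩, h1, fun i hi => by have := h2 i hi; omega, h3, h4, ?_, ?_, ?_⟩
    · intro p' hp'
      have := List.single_le_sum (l := l.map (fun p => p.1)) (by simp) p'.1 (List.mem_map_of_mem hp')
      simp only; omega
    · intro p' hp' i i' hi1 hi1'
      have := List.single_le_sum (l := l.map (fun p => hi p.2)) (by simp) (hi p'.2)
        (List.mem_map.2 ⟨p', hp', rfl⟩)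
      have := lt_hi hi1
      have := h2 i' hi1'
      omega
    · refine hA.trans ?_
      have := P.mu_strict.le_apply (x := A + (l.map (fun p => p.1)).sum + 1)
      have : A ≤ P.mu (A + (l.map (fun p => p.1)).sum + 1) := by omega
      exact_mod_cast this)
  refine ⟨fun s => (F s).1, fun s => (F s).2, ?_, ?_, fun s => (hF s).1, fun s => (hF s).2.1,
    fun s => (hF s).2.2.1, fun s => (hF s).2.2.2.1, ?_⟩
  · intro s s' h
    exact (hF s').2.2.2.2.1 (F s) (List.mem_map.2 ⟨s, by simpa using h, rfl⟩)
  · intro s s' h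
    exact (hF s').2.2.2.2.2.1 (F s) (List.mem_map.2 ⟨s, by simpa using h, rfl⟩)
  · intro s
    have := (hF s).2.2.2.2.2.2
    rw [List.map_map] at this
    exact this

structure IsX (P : Par) (j : ℕ) (x : VV) : Prop where
  h0 : ∀ g, InW P g → |pr g x| ≤ 1
  h0' : ∃ h, InW P h ∧ 1/2 < pr h x
  h1 : ∀ d ≤ P.k j, ∀ g : ℕ → FF, (∀ q < d, InW P (g q)) → Succ g d →
        ∑ q ∈ Finset.range d, |pr (g q) x| ≤ 2
  h2 : ∀ (i : ℕ) (v : ℝ) (d : ℕ) (g : FF), (P.mu i : ℝ) ≤ v → d ≤ P.N i → Op P v d g →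
        |pr g x| ≤ 4 * P.m j / v + 2 * P.m j / P.k j

theorem lemmaX {z : ℕ → VV} (hz : Blk z) (j M : ℕ) :
    ∃ x ∈ Submodule.span ℝ (Set.range z), (∀ i, x i ≠ 0 → M ≤ i) ∧ IsX P j x := by
  obtain ⟨a, b, ha, hb, hspan, hM, hn, hfam, hl1⟩ := lemmaB1 (P := P) hz M
  obtain ⟨l, len, α, x, hx, hα, hlen, hαm, hub, hlb, hfamx⟩ := lemmaA (P := P) j (P.k_pos j) hb
    (fun f hf i => (hf.le_nrm _).trans (hn i).le) (fun i => exists_lt_pr (by rw [hn]; norm_num))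
  refine ⟨x, ?_, ?_, hub, hlb, hfamx, ?_⟩
  · rw [hx]
    exact Submodule.smul_mem _ _ (Submodule.sum_mem _ fun i _ => hspan i)
  · intro i hi
    simp only [hx, Finsupp.smul_apply, smul_eq_mul] at hi
    obtain ⟨n, _, h2⟩ := sum_apply_ne (right_ne_zero_of_mul hi)
    exact hM n i h2
  · intro i v d g hv hd hop
    have hv0 : 0 < v := lt_of_lt_of_le (by linarith [P.muR i]) hv
    have key : ∀ S : Finset ℕ, ∑ s ∈ S, |pr g (b s)| ≤ 4 * S.card / v + 2 := by
      intro S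
      classical
      rw [← Finset.sum_filter_add_sum_filter_not S (fun s => i < a s)]
      apply add_le_add
      · calc ∑ s ∈ S.filter (fun s => i < a s), |pr g (b s)|
            ≤ ∑ s ∈ S.filter (fun s => i < a s), 4 / v := by
              apply Finset.sum_le_sum
              intro s hs
              exact hop.le_fam hv0 (hd.trans (P.N_le_k (Finset.mem_filter.1 hs).2)) (hfam s)
          _ = (S.filter (fun s => i < a s)).card * (4 / v) := by simp
          _ ≤ S.card * (4 / v) := by
              gcongr; exact Finset.filter_subset _ _
          _ = _ := by ring
      · rcases (S.filter (fun s => ¬ i < a s)).eq_empty_or_nonempty with h | h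
        · rw [h]; simp
        · set s0 := (S.filter (fun s => ¬ i < a s)).max' h with hs0
          have hmem := Finset.max'_mem _ h
          rw [← hs0] at hmem
          have hsub : S.filter (fun s => ¬ i < a s) ⊆ Finset.range (s0+1) := by
            intro s hs
            have := Finset.le_max' _ s hs
            rw [Finset.mem_range]; omega
          have h1 : a s0 ≤ i := not_lt.1 (Finset.mem_filter.1 hmem).2
          calc _ ≤ ∑ s ∈ Finset.range (s0+1), |pr g (b s)| :=
                Finset.sum_le_sum_of_subset_of_nonneg hsub (fun _ _ _ => abs_nonneg _)
            _ = ∑ s ∈ Finset.range s0, |pr g (b s)| + |pr g (b s0)| := Finset.sum_range_succ _ _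
            _ ≤ ∑ s ∈ Finset.range s0, (1/v) * l1 (b s) + 1 := by
                apply add_le_add
                · exact Finset.sum_le_sum fun s _ => hop.le_l1 hv0 _
                · exact (hop.1.le_nrm _).trans (hn s0).le
            _ ≤ 1 + 1 := by
                apply add_le_add _ le_rfl
                rw [← Finset.mul_sum, one_div, inv_mul_eq_div, div_le_one hv0]
                refine (hl1 s0).trans (le_trans ?_ hv)
                exact_mod_cast P.mu_strict.monotone h1
            _ = 2 := by norm_num
    have hk0 : (0:ℝ) < P.k j := by exact_mod_cast P.k_pos j
    have hlenR : (P.k j : ℝ) ≤ len := by exact_mod_cast hlen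
    have hα' : α ≤ P.m j / P.k j := by
      rw [le_div_iff₀ hk0]
      exact le_trans (mul_le_mul_of_nonneg_left hlenR hα.le) hαm
    calc |pr g x| = α * |∑ s ∈ Finset.Ico l (l+len), pr g (b s)| := by
          rw [hx, map_smul, smul_eq_mul, abs_mul, abs_of_pos hα, map_sum]
      _ ≤ α * (4 * len / v + 2) := by
          apply mul_le_mul_of_nonneg_left _ hα.le
          refine (Finset.abs_sum_le_sum_abs _ _).trans ((key _).trans_eq ?_)
          simp
      _ = 4 * (α * len) / v + 2 * α := by ring
      _ ≤ 4 * P.m j / v + 2 * (P.m j / P.k j) := by gcongr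
      _ = _ := by ring

end GM


namespace GM
variable {P : Par}

section par
variable (P)
lemma Par.m_succ (j : ℕ) : P.m (j+1) = P.m j ^ 64 := by
  rw [P.hm (j+1), P.hmu j, ← pow_mul]
lemma Par.m_prod {i c : ℕ} (h : i < c) : 256 * P.m i * P.m (c-1) ≤ P.m c := by
  obtain ⟨c, rfl⟩ : ∃ l, c = l + 1 := ⟨c-1, by omega⟩
  have h1 : P.m i ≤ P.m c := P.m_strict.monotone (by omega)
  have h2 := P.m_pos c
  rw [P.m_succ, Nat.add_sub_cancel]
  calc 256 * P.m i * P.m c ≤ P.m c * P.m c * P.m c := by gcongr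
    _ = P.m c ^ 3 := by ring
    _ ≤ _ := Nat.pow_le_pow_right (by omega) (by norm_num)
lemma Par.m_geo {j c : ℕ} (h : j ≤ c) : P.m j * 2^(c - j) ≤ P.m c := by
  induction c, h using Nat.le_induction with
  | base => simp
  | succ c hc ih =>
    have h1 := P.m_prod (i := c) (c := c+1) (by omega)
    have h2 := P.m_pos c
    rw [Nat.add_sub_cancel] at h1
    have : c + 1 - j = (c - j) + 1 := by omega
    rw [this, pow_succ]
    nlinarith
lemma Par.n_mono {i j : ℕ} (h : i ≤ j) : P.n i ≤ P.n j := by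
  rcases Nat.eq_or_lt_of_le h with h | h
  · rw [h]
  · exact (P.hNn i).trans ((P.N_le_k h).trans (P.k_le_n j))
/-- `m_j/k_j` is at most `1/(m_j^3 (N_i+1))` for `i<j`. -/
lemma Par.mk_le {i j : ℕ} (h : i < j) : (P.m j : ℝ) / P.k j ≤ 1 / ((P.m j : ℝ)^3 * (P.N i + 1)) := by
  have h1 := P.k_ge_N' h
  have h2 : ((P.m j : ℝ)^4 * (P.N i + 1)) ≤ P.k j := by exact_mod_cast h1
  have h3 := P.mR j
  have h4 : (0:ℝ) < P.k j := by exact_mod_cast P.k_pos j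
  rw [div_le_div_iff₀ h4 (by positivity)]
  nlinarith
lemma Par.mk_le' (j : ℕ) : (P.m j : ℝ) / P.k j ≤ 1 / ((P.m j : ℝ)^3) := by
  have h1 := P.k_ge j
  have h2 : ((P.m j : ℝ)^4) ≤ P.k j := by exact_mod_cast h1
  have h3 := P.mR j
  have h4 : (0:ℝ) < P.k j := by exact_mod_cast P.k_pos j
  rw [div_le_div_iff₀ h4 (by positivity)]
  nlinarith
lemma Par.mmonoR {i j : ℕ} (h : i ≤ j) : (P.m i : ℝ) ≤ P.m j := by
  exact_mod_cast P.m_strict.monotone h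
lemma Par.mumonoR {i j : ℕ} (h : i ≤ j) : (P.mu i : ℝ) ≤ P.mu j := by
  exact_mod_cast P.mu_strict.monotone h
lemma Par.mk_cube {i j : ℕ} (h : i ≤ j) : 1 / ((P.m j : ℝ)^3) ≤ 1 / P.m i := by
  have h1 := P.mR j
  have h2 := P.mR i
  have h3 := P.mmonoR h
  apply one_div_le_one_div_of_le (by linarith)
  calc (P.m i : ℝ) ≤ P.m j := h3
    _ ≤ (P.m j : ℝ)^3 := le_self_pow₀ (by linarith) (by norm_num)
end par

lemma geo_sum {Q : Finset ℕ} {e : ℕ → ℕ} (h : Set.InjOn e Q) :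
    ∑ q ∈ Q, (1/2:ℝ)^(e q) ≤ 2 := by
  classical
  rw [← Finset.sum_image (f := fun i => (1/2:ℝ)^i) (by exact h)]
  refine le_trans ?_ tsum_geometric_two.le
  exact summable_geometric_two.sum_le_tsum _ (fun _ _ => by positivity)

lemma IsX.lt {s i : ℕ} {x : VV} (hx : IsX P s x) (h : i < s) {v : ℝ} (hv : (P.mu i : ℝ) ≤ v)
    {d : ℕ} (hd : d ≤ P.N i) {g : FF} (hg : Op P v d g) : |pr g x| ≤ 2 / v :=
  hg.le_fam (by linarith [P.muR i]) (hd.trans (P.N_le_k h)) hx.h1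

/-- even functionals of weight `≠ s` act on an `IsX s` vector as follows -/
lemma IsX.ev {j s i : ℕ} {x : VV} (hx : IsX P s x) (hj : j < s) (hi : i ≠ s) (hij : j ≤ i) {g : FF}
    (hg : Ev P i g) : |pr g x| ≤ 2 / P.m j * (1/2)^(i - j) + 2 * (P.m s / P.k s) := by
  have hmi := P.mR i
  have hmj := P.mR j
  have hk0 : (0:ℝ) < P.k s := by exact_mod_cast P.k_pos s
  have hpos : (0:ℝ) ≤ 2 * (P.m s / P.k s) := by positivity
  have hmu : (P.mu i : ℝ) ≤ P.m i := by exact_mod_cast P.mu_le_m i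
  have h0 := hg.op.mono (P.hNn i)
  have e1 : 2 / (P.m j:ℝ) * (1/2)^(i - j) = 2 / (P.m j * 2^(i-j)) := by
    rw [one_div, inv_pow]; field_simp
  rw [e1]
  rcases lt_or_gt_of_ne hi with h | h
  · have h1 := hx.lt h hmu le_rfl h0
    have h2 : ((P.m j : ℝ) * 2^(i-j)) ≤ P.m i := by exact_mod_cast P.m_geo hij
    have : 2 / (P.m i : ℝ) ≤ 2 / (P.m j * 2^(i-j)) := by gcongr
    linarith
  · have h1 := hx.h2 i _ _ g hmu le_rfl h0
    have h2 : (256 * P.m s * P.m (i-1) : ℝ) ≤ P.m i := by exact_mod_cast P.m_prod h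
    have h3 : ((P.m j : ℝ) * 2^(i-1-j)) ≤ P.m (i-1) := by exact_mod_cast P.m_geo (by omega)
    have h4 : i - j = (i - 1 - j) + 1 := by omega
    have hms := P.mR s
    have : 4 * (P.m s:ℝ) / P.m i ≤ 2 / (P.m j * 2^(i-j)) := by
      rw [div_le_div_iff₀ (by linarith) (by positivity), h4, pow_succ]
      have := mul_le_mul_of_nonneg_left h3 (by positivity : (0:ℝ) ≤ P.m s)
      nlinarith
    have e2 : 2 * (P.m s : ℝ) / P.k s = 2 * (P.m s / P.k s) := by ring
    linarith

structure IsY (P : Par) (j : ℕ) (y : VV) (p : FF) : Prop where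
  h1 : ∀ g, InW P g → |pr g y| ≤ 66
  h2 : ∀ i ≠ j, ∀ g, Ev P i g → |pr g y| ≤ 66 / (P.mu i : ℝ)^4 + 6 * (P.m j / P.k j)
  h3 : ∀ r > j, ∀ g, Op P (P.mu r) (P.N r) g → |pr g y| ≤ 1 / (P.m j : ℝ)^5 + 6 * (P.m j / P.k j)
  hp : Ev P j p
  hpy : pr p y = 1

lemma count_x {j : ℕ} (hj : Odd j) {x : ℕ → VV} (hx : ∀ s, IsX P (j+1+2*s) (x s)) (hs : SuccV x)
    (g : FF) (hg : InW P g) (A : Finset ℕ) (hA : ∀ n ∈ A, 32 / (P.m j : ℝ) < |pr g (x n)|) :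
    A.card ≤ cnt 1 (P.n (j-1) + j) (P.m j) := by
  have hmj := P.mR j
  have hinv : (0:ℝ) < 1 / P.m j := by positivity
  have hkk : ∀ s, (P.m (j+1+2*s) : ℝ) / P.k (j+1+2*s) ≤ 1 / P.m j := fun s =>
    (P.mk_le' _).trans (P.mk_cube (by omega))
  have e32 : 32 / (P.m j : ℝ) = 32 * (1 / P.m j) := by ring
  refine count_lemma (P := P) hs (θ := 32 / P.m j) (C := 1) (by positivity) (L := j) (R := 1)
    (D := P.n (j-1) + j) ?_ (by omega) (fun g hg n => (hx n).h0 g hg) ?_ ?_ (P.m j) _ le_rfl ?_ g hg A hA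
  · intro i hi
    have := P.n_mono (i := i) (j := j-1) (by omega)
    omega
  · intro i hi g hg A hA
    rw [Finset.card_le_one]
    have : ∀ s ∈ A, i = j+1+2*s := by
      intro s hs
      by_contra hne
      have h1 := (hx s).ev (by omega) hne hi hg
      have h2 := hA s hs
      have h3 := hkk s
      have h4 : (1/2:ℝ)^(i-j) ≤ 1 := pow_le_one₀ (by norm_num) (by norm_num)
      have h5 : 2 / (P.m j:ℝ) * (1/2)^(i-j) ≤ 2 * (1 / P.m j) := by
        have : 2 / (P.m j:ℝ) = 2 * (1 / P.m j) := by ring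
        rw [this]; nlinarith
      linarith
    intro s hs s' hs'
    have t1 := this s hs
    have t2 := this s' hs'
    omega
  · intro r d c g a b hsp A hA
    rcases Nat.lt_or_ge j r with hr | hr
    · rw [Finset.card_le_one]
      have : ∀ s ∈ A, r = j+1+2*s := by
        intro s hs
        by_contra hne
        have h2 := (hA s hs).1
        have h0 := hsp.op (ε := 1) (Or.inl rfl) a b
        rw [← pr_spec (P := P) (ε := 1) (Or.inl rfl)] at h2
        have hmur := P.muR r
        have hrm : ∀ l < r, (P.m l : ℝ)^8 ≤ P.mu r := by
          intro l hl
          have h1 : P.m l ^ 8 = P.mu (l+1) := (P.hmu l).symm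
          have : P.mu (l+1) ≤ P.mu r := P.mu_strict.monotone hl
          rw [← h1] at this
          exact_mod_cast this
        rcases lt_or_gt_of_ne hne with h | h
        · have h1 := (hx s).lt h le_rfl le_rfl h0
          have h3 : (P.m j : ℝ) ≤ P.mu r := le_trans (le_self_pow₀ (by linarith) (by norm_num)) (hrm j hr)
          have : 2 / (P.mu r : ℝ) ≤ 2 / P.m j := by gcongr
          have : 2 / (P.m j:ℝ) = 2 * (1 / P.m j) := by ring
          linarith
        · have h1 := (hx s).h2 r _ _ _ le_rfl le_rfl h0
          have h3 := hrm _ h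
          have hms := P.mR (j+1+2*s)
          have h4 := P.mmonoR (i := j) (j := j+1+2*s) (by omega)
          have h5 : 4 * (P.m (j+1+2*s):ℝ) / P.mu r ≤ 4 * (1 / P.m j) := by
            have : (P.m (j+1+2*s):ℝ)^2 ≤ P.mu r :=
              le_trans (pow_le_pow_right₀ (by linarith) (by norm_num)) h3
            rw [mul_one_div, div_le_div_iff₀ (by linarith) (by linarith)]
            nlinarith
          have h6 := hkk s
          have e2 : 2 * (P.m (j+1+2*s) : ℝ) / P.k (j+1+2*s) = 2 * (P.m (j+1+2*s) / P.k (j+1+2*s)) := by ring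
          linarith
      intro s hs s' hs'
      have t1 := this s hs
      have t2 := this s' hs'
      omega
    · have : A = ∅ := by
        rw [Finset.eq_empty_iff_forall_notMem]
        intro s hs
        have h2 := (hA s hs).2
        set Q := (Finset.range d).filter (fun q => j ≤ c q) with hQ
        have hb : ∀ q ∈ Q, |pr (res a b (g q)) (x s)| ≤ 2 / P.m j * (1/2)^(c q - j) +
            2 * (P.m (j+1+2*s) / P.k (j+1+2*s)) := by
          intro q hq
          rw [hQ, Finset.mem_filter, Finset.mem_range] at hq
          apply (hx s).ev (by omega) _ hq.2 ((hsp.hg q hq.1).res a b)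
          have h1 := hsp.hodd q hq.1
          intro h; rw [h] at h1
          rw [Nat.odd_iff] at h1 hj; omega
        have h3 := (Finset.abs_sum_le_sum_abs _ _).trans (Finset.sum_le_sum hb)
        rw [Finset.sum_add_distrib, ← Finset.mul_sum, Finset.sum_const, nsmul_eq_mul] at h3
        have h4 : ∑ q ∈ Q, (1/2:ℝ)^(c q - j) ≤ 2 := by
          apply geo_sum
          intro q hq q' hq' he
          simp only [hQ, Finset.coe_filter, Finset.mem_range, Set.mem_ofPred_eq] at hq hq' he
          rcases lt_trichotomy q q' with h | h | h
          · have := hsp.lt h hq'.1; omega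
          · exact h
          · have := hsp.lt h hq.1; omega
        have h5 : (Q.card : ℝ) ≤ P.N j + 1 := by
          have : Q.card ≤ P.N j := by
            calc Q.card ≤ d := by simpa using Finset.card_filter_le (Finset.range d) _
              _ ≤ P.N r := hsp.hd
              _ ≤ _ := P.N_strict.monotone hr
          have : (Q.card : ℝ) ≤ P.N j := by exact_mod_cast this
          linarith
        have h6 : (Q.card : ℝ) * (2 * (P.m (j+1+2*s) / P.k (j+1+2*s))) ≤ 2 * (1 / P.m j) := by
          have h7 := P.mk_le (i := j) (j := j+1+2*s) (by omega)
          have h8 := P.mk_cube (i := j) (j := j+1+2*s) (by omega)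
          have h9 : (0:ℝ) < P.N j + 1 := by positivity
          have hms := P.mR (j+1+2*s)
          calc (Q.card : ℝ) * (2 * (P.m (j+1+2*s) / P.k (j+1+2*s)))
              ≤ (P.N j + 1) * (2 * (1 / ((P.m (j+1+2*s) : ℝ)^3 * (P.N j + 1)))) := by gcongr
            _ = 2 * (1 / ((P.m (j+1+2*s) : ℝ)^3)) := by field_simp
            _ ≤ _ := by linarith
        have e3 : 2 / (P.m j:ℝ) = 2 * (1 / P.m j) := by ring
        have h10 : 2 / (P.m j:ℝ) * ∑ q ∈ Q, (1/2:ℝ)^(c q - j) ≤ 2 / (P.m j:ℝ) * 2 :=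
          mul_le_mul_of_nonneg_left h4 (by positivity)
        linarith
      rw [this]; simp
  · have h1 := one_add_mul_le_pow (a := (3/4:ℝ)) (by norm_num) (P.m j)
    have h2 : (1:ℝ) + 3/4 = 7/4 := by norm_num
    rw [h2] at h1
    rw [div_mul_eq_mul_div, le_div_iff₀ (by linarith)]
    linarith

lemma sum_x {j : ℕ} (hj : Odd j) {x : ℕ → VV} (hx : ∀ s, IsX P (j+1+2*s) (x s)) (hs : SuccV x)
    (g : FF) (hg : InW P g) (I : Finset ℕ) :
    ∑ s ∈ I, |pr g (x s)| ≤ 32 / P.m j * I.card + cnt 1 (P.n (j-1) + j) (P.m j) := by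
  classical
  have hmj := P.mR j
  rw [← Finset.sum_filter_add_sum_filter_not I (fun s => 32 / (P.m j : ℝ) < |pr g (x s)|), add_comm]
  apply add_le_add
  · calc _ ≤ ∑ s ∈ I.filter (fun s => ¬ 32 / (P.m j : ℝ) < |pr g (x s)|), 32 / (P.m j : ℝ) :=
          Finset.sum_le_sum fun s hs => not_lt.1 (Finset.mem_filter.1 hs).2
      _ = (I.filter (fun s => ¬ 32 / (P.m j : ℝ) < |pr g (x s)|)).card * (32 / (P.m j : ℝ)) := by simp
      _ ≤ I.card * (32 / (P.m j : ℝ)) := by gcongr; exact Finset.filter_subset _ _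
      _ = _ := by ring
  · calc _ ≤ ∑ s ∈ I.filter (fun s => 32 / (P.m j : ℝ) < |pr g (x s)|), (1:ℝ) :=
          Finset.sum_le_sum fun s _ => (hx s).h0 g hg
      _ = ((I.filter (fun s => 32 / (P.m j : ℝ) < |pr g (x s)|)).card : ℝ) := by simp
      _ ≤ _ := by
          exact_mod_cast count_x hj hx hs g hg _ fun n hn => (Finset.mem_filter.1 hn).2

lemma lemmaY_seq {z : ℕ → VV} (hz : Blk z) (j M : ℕ) :
    ∃ x : ℕ → VV, (∀ s, x s ∈ Submodule.span ℝ (Set.range z)) ∧ (∀ s i, x s i ≠ 0 → M ≤ i) ∧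
      (∀ s, IsX P (j+1+2*s) (x s)) ∧ SuccV x := by
  obtain ⟨x, hx⟩ := exists_seq (α := VV) (fun l x =>
    x ∈ Submodule.span ℝ (Set.range z) ∧ (∀ i, x i ≠ 0 → M ≤ i) ∧ IsX P (j+1+2*l.length) x ∧
      (∀ x' ∈ l, ∀ i i', x' i ≠ 0 → x i' ≠ 0 → i < i')) (by
    intro l
    obtain ⟨x, h1, h2, h3⟩ := lemmaX (P := P) hz (j+1+2*l.length) (M + (l.map hi).sum)
    refine ⟨x, h1, fun i hi => by have := h2 i hi; omega, h3, ?_⟩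
    intro p' hp' i i' hi1 hi1'
    have := List.single_le_sum (l := l.map hi) (by simp) (hi p')
      (List.mem_map.2 ⟨p', hp', rfl⟩)
    have := lt_hi hi1
    have := h2 i' hi1'
    omega)
  refine ⟨x, fun s => (hx s).1, fun s => (hx s).2.1, fun s => ?_, ?_⟩
  · have := (hx s).2.2.1
    simpa using this
  · intro s s' h
    exact (hx s').2.2.2 (x s) (List.mem_map.2 ⟨s, by simpa using h, rfl⟩)

theorem lemmaY {z : ℕ → VV} (hz : Blk z) {j : ℕ} (hj : Odd j) (M : ℕ) :
    ∃ y ∈ Submodule.span ℝ (Set.range z), ∃ p, (∀ i, y i ≠ 0 → M ≤ i) ∧ (∀ i, p i ≠ 0 → M ≤ i) ∧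
      IsY P j y p := by
  obtain ⟨x, hspan, hM, hx, hs⟩ := lemmaY_seq (P := P) hz j M
  choose h hh hh2 using fun s => (hx s).h0'
  have hne : ∀ n, x n ≠ 0 := by
    intro n h0
    have := hh2 n
    rw [h0] at this; simp at this; linarith
  set n := P.n j with hn
  set m := P.m j with hm
  set h' : ℕ → FF := fun q => res (lo (x q)) (hi (x q)) (h q) with hh'
  set p : FF := (1 / (m : ℚ)) • ∑ q ∈ Finset.range n, h' q with hp
  have hEv : Ev P j p := InW.even le_rfl (fun q _ => (hh q).res _ _) (diag_succ hs hne h n)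
  have hmR : (256:ℝ) ≤ m := P.mR j
  have hk1 := P.k_pos j
  have hkn := P.k_le_n j
  have hkR : (1:ℝ) ≤ P.k j := by exact_mod_cast hk1
  have hknR : (P.k j:ℝ) ≤ n := by exact_mod_cast hkn
  have hn0 : (0:ℝ) < n := by linarith
  set X := ∑ s ∈ Finset.range n, x s with hX
  have hpX : pr p X = (1 / (m:ℝ)) * ∑ q ∈ Finset.range n, pr (h q) (x q) := by
    rw [hp, pr_smul, pr_sum, diag_sum hs hne]; push_cast; rfl
  set S := ∑ q ∈ Finset.range n, pr (h q) (x q) with hS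
  have hS1 : (n:ℝ)/2 ≤ S := by
    have := Finset.sum_le_sum (s := Finset.range n) (fun q _ => (hh2 q).le)
    simp at this; rw [hS]; linarith
  have hS0 : 0 < S := by linarith
  clear_value S X p h'
  clear_value n m
  -- the vector
  set β : ℝ := m / S with hβ
  clear_value β
  have hβ0 : 0 < β := by rw [hβ]; exact div_pos (by linarith) hS0
  have hβ2 : β ≤ 2 * (m / n) := by
    rw [hβ, div_le_iff₀ hS0]
    calc (m:ℝ) = 2 * (m/n) * (n/2) := by field_simp
      _ ≤ _ := by gcongr
  have hkey : ∀ g, |pr g (β • X)| ≤ 2 * (m/n) * ∑ s ∈ Finset.range n, |pr g (x s)| := by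
    intro g
    rw [map_smul, smul_eq_mul, abs_mul, abs_of_pos hβ0, hX, map_sum]
    apply mul_le_mul hβ2 (Finset.abs_sum_le_sum_abs _ _) (abs_nonneg _) (by positivity)
  obtain ⟨M', hM'⟩ : ∃ M', M' = cnt 1 (P.n (j-1) + j) m := ⟨_, rfl⟩
  have hbig : (m:ℝ)^4 * (M' + 1) * (P.N (j-1) + 1) ≤ n := by
    have h1 := P.hk (j-1)
    have h2 : j - 1 + 1 = j := by have := hj.pos; omega
    rw [add_assoc (P.n (j-1)), h2] at h1
    have := h1.trans hkn
    rw [← hm, ← hM', ← hn] at this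
    exact_mod_cast this
  have hM0 : (0:ℝ) ≤ M' := by positivity
  have hN0 : (0:ℝ) ≤ P.N (j-1) := by positivity
  have hsum := sum_x hj hx hs
  rw [← hm, ← hM'] at hsum
  -- weights larger than `j`
  have hlarge : ∀ i > j, ∀ (v : ℝ) g, (P.mu i : ℝ) ≤ v → Op P v (P.N i) g →
      |pr g (β • X)| ≤ 8 * (P.m (i-1) : ℝ)^2 / v + 6 * (m / P.k j) := by
    intro i hi v g hv hop
    have hv0 : 0 < v := by linarith [P.muR i]
    have hmi := P.mR (i-1)
    have hmi2 : (m:ℝ) ≤ P.m (i-1) := by rw [hm]; exact P.mmonoR (by omega)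
    have hb : ∀ s ∈ Finset.range n, |pr g (x s)| ≤ (4 * (P.m (i-1):ℝ) / v + 1 / P.k j) +
        if j + 1 + 2*s = i then 1 else 0 := by
      intro s _
      have hmk : 2 * (P.m (j+1+2*s) : ℝ) / P.k (j+1+2*s) ≤ 1 / P.k j := by
        have h7 := P.mk_le (i := j) (j := j+1+2*s) (by omega)
        have h8 := P.mR (j+1+2*s)
        have h9 : (P.k j : ℝ) ≤ P.N j + 1 := by
          have : P.k j ≤ P.N j + 1 := by have := P.hNn j; omega
          exact_mod_cast this
        calc 2 * (P.m (j+1+2*s) : ℝ) / P.k (j+1+2*s) = 2 * (P.m (j+1+2*s) / P.k (j+1+2*s)) := by ring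
          _ ≤ 2 * (1 / ((P.m (j+1+2*s) : ℝ)^3 * (P.N j + 1))) := by linarith
          _ ≤ 2 * (1 / (2 * P.k j)) := by
            have : (2:ℝ) ≤ (P.m (j+1+2*s) : ℝ)^3 :=
              le_trans (by linarith) (le_self_pow₀ (by linarith) (by norm_num))
            gcongr
          _ = _ := by field_simp
      rcases lt_trichotomy i (j+1+2*s) with h | h | h
      · rw [if_neg (by omega)]
        have h1 := (hx s).lt h hv le_rfl hop
        have h2 : 2 / v ≤ 4 * (P.m (i-1):ℝ) / v := by gcongr; linarith
        have h3 : 0 < 1 / (P.k j : ℝ) := by positivity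
        linarith
      · rw [if_pos h.symm]
        have h1 := (hx s).h0 g hop.1
        have h2 : 0 ≤ 4 * (P.m (i-1):ℝ) / v := by positivity
        have h3 : 0 < 1 / (P.k j : ℝ) := by positivity
        linarith
      · rw [if_neg (by omega)]
        have h1 := (hx s).h2 i v _ g hv le_rfl hop
        have h2 : 4 * (P.m (j+1+2*s):ℝ) / v ≤ 4 * (P.m (i-1):ℝ) / v := by
          have := P.mmonoR (i := j+1+2*s) (j := i-1) (by omega)
          gcongr
        linarith
    have h4 := Finset.sum_le_sum hb
    rw [Finset.sum_add_distrib, Finset.sum_const, Finset.card_range, nsmul_eq_mul] at h4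
    have h5 : ∑ s ∈ Finset.range n, (if j + 1 + 2*s = i then (1:ℝ) else 0) ≤ 1 := by
      rw [← Finset.sum_filter, Finset.sum_const, nsmul_eq_mul, mul_one]
      have : ((Finset.range n).filter (fun s => j + 1 + 2*s = i)).card ≤ 1 := by
        rw [Finset.card_le_one]
        intro a ha b hb
        rw [Finset.mem_filter] at ha hb
        omega
      exact_mod_cast this
    calc |pr g (β • X)| ≤ 2 * (m/n) * ∑ s ∈ Finset.range n, |pr g (x s)| := hkey g
      _ ≤ 2 * (m/n) * (n * (4 * (P.m (i-1):ℝ) / v + 1 / P.k j) + 1) := by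
          gcongr; linarith
      _ = 8 * (m * P.m (i-1)) / v + 2 * (m / P.k j) + 2 * (m / n) := by field_simp; ring
      _ ≤ 8 * (P.m (i-1):ℝ)^2 / v + 2 * (m / P.k j) + 2 * (m / P.k j) := by
          gcongr
          rw [pow_two]; gcongr
      _ ≤ _ := by
          have : 0 ≤ (m:ℝ) / P.k j := by positivity
          linarith
  refine ⟨β • X, ?_, p, ?_, ?_, ?_, ?_, ?_, hEv, ?_⟩
  · rw [hX]; exact Submodule.smul_mem _ _ (Submodule.sum_mem _ fun i _ => hspan i)
  · intro i hi
    simp only [hX, Finsupp.smul_apply, smul_eq_mul] at hi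
    obtain ⟨s, _, h2⟩ := sum_apply_ne (right_ne_zero_of_mul hi)
    exact hM s i h2
  · intro i hi
    simp only [hp, hh', Finsupp.smul_apply, smul_eq_mul, Finsupp.finsetSum_apply] at hi
    obtain ⟨s, _, h2⟩ := Finset.exists_ne_zero_of_sum_ne_zero (right_ne_zero_of_mul hi)
    exact (hM s _ (exists_lo (hne s))).trans (res_ne h2).1
  · intro g hg
    have h1 := hsum g hg (Finset.range n)
    rw [Finset.card_range] at h1
    calc |pr g (β • X)| ≤ 2 * (m/n) * ∑ s ∈ Finset.range n, |pr g (x s)| := hkey g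
      _ ≤ 2 * (m/n) * (32 / m * n + M') := by gcongr
      _ = 64 + 2 * (m * M') / n := by field_simp; ring
      _ ≤ 64 + 2 * n / n := by
          gcongr
          refine le_trans ?_ hbig
          calc (m:ℝ) * M' ≤ m^4 * (M' + 1) := by
                gcongr
                · exact le_self_pow₀ (by linarith) (by norm_num)
                · linarith
            _ ≤ _ := le_mul_of_one_le_right (by positivity) (by linarith)
      _ = 66 := by field_simp; norm_num
  · intro i hi g hg
    rw [← hm]
    rcases lt_or_gt_of_ne hi with hij | hij
    · -- smaller weights
      have hmi := P.mR i
      have hmui := P.muR i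
      have hni : (P.n i : ℝ) ≤ P.N (j-1) := by
        have : P.n i ≤ P.N (j-1) := (P.hNn i).trans (P.N_strict.monotone (by omega))
        exact_mod_cast this
      have hni0 : (0:ℝ) ≤ P.n i := by positivity
      have hop := hg.op
      obtain ⟨_, d, hd, f, hf, hfs, heq⟩ := hop
      have hdR : (d:ℝ) ≤ P.n i := by exact_mod_cast hd
      have h1 := touch_sum hfs hs (Finset.range n) (c := 32 / m) (e := M') (by positivity)
        (fun q hq I _ => hsum (f q) (hf q hq) I)
      rw [Finset.card_range] at h1
      have h2 : ∑ s ∈ Finset.range n, |pr g (x s)| ≤ 1 / P.m i *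
          (32 / m * (P.n i + n) + P.n i * M') := by
        simp only [heq]
        rw [← Finset.mul_sum]
        apply mul_le_mul_of_nonneg_left _ (by positivity)
        calc ∑ s ∈ Finset.range n, |∑ q ∈ Finset.range d, pr (f q) (x s)|
            ≤ ∑ s ∈ Finset.range n, ∑ q ∈ Finset.range d, |pr (f q) (x s)| :=
              Finset.sum_le_sum fun s _ => Finset.abs_sum_le_sum_abs _ _
          _ = ∑ q ∈ Finset.range d, ∑ s ∈ Finset.range n, |pr (f q) (x s)| := Finset.sum_comm
          _ ≤ _ := h1
          _ ≤ _ := by gcongr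
      have h3 : 32 * (P.n i : ℝ) + m * (P.n i * M') ≤ n := by
        refine le_trans ?_ hbig
        have h256 : (256:ℝ) ≤ m^4 := hmR.trans (le_self_pow₀ (by linarith) (by norm_num))
        have hmm : (m:ℝ) ≤ m^4 := le_self_pow₀ (by linarith) (by norm_num)
        calc 32 * (P.n i : ℝ) + m * (P.n i * M') ≤ m^4 * P.n i + m^4 * (P.n i * M') := by
              gcongr; linarith
          _ = m^4 * (M' + 1) * P.n i := by ring
          _ ≤ _ := by gcongr; linarith
      have h4 : |pr g (β • X)| ≤ 66 / P.m i := by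
        calc |pr g (β • X)| ≤ 2 * (m/n) * ∑ s ∈ Finset.range n, |pr g (x s)| := hkey g
          _ ≤ 2 * (m/n) * (1 / P.m i * (32 / m * (P.n i + n) + P.n i * M')) := by gcongr
          _ = (64 + 2 * (32 * (P.n i : ℝ) + m * (P.n i * M')) / n) / P.m i := by field_simp; ring
          _ ≤ (64 + 2 * n / n) / P.m i := by gcongr
          _ = 66 / P.m i := by
              have : (64:ℝ) + 2 * n / n = 66 := by field_simp; norm_num
              rw [this]
      have h5 : 66 / (P.m i : ℝ) ≤ 66 / (P.mu i : ℝ)^4 := by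
        rw [P.hm i]; push_cast
        gcongr
        · linarith
        · norm_num
      have : 0 ≤ 6 * ((m:ℝ) / P.k j) := by positivity
      linarith
    · have hmu : (P.mu i : ℝ) ≤ P.m i := by exact_mod_cast P.mu_le_m i
      have h1 := hlarge i hij _ g hmu (hg.op.mono (P.hNn i))
      have h2 : 8 * (P.m (i-1) : ℝ)^2 / P.m i ≤ 66 / (P.mu i : ℝ)^4 := by
        have h3 : (P.mu i : ℝ) = (P.m (i-1) : ℝ)^8 := by
          have := P.hmu (i-1)
          have h4 : i - 1 + 1 = i := by omega
          rw [h4] at this; exact_mod_cast this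
        have h5 : (P.m i : ℝ) = (P.mu i : ℝ)^8 := by exact_mod_cast P.hm i
        have h6 := P.muR i
        have h8 := P.mR (i-1)
        have h7 : (P.m (i-1) : ℝ)^2 ≤ (P.mu i : ℝ)^4 := by
          rw [h3, ← pow_mul]; exact pow_le_pow_right₀ (by linarith) (by norm_num)
        rw [h5, div_le_div_iff₀ (by positivity) (by positivity)]
        have : (P.mu i : ℝ)^8 = (P.mu i : ℝ)^4 * (P.mu i : ℝ)^4 := by ring
        rw [this]
        have h9 : 0 < (P.mu i : ℝ)^4 := by positivity
        nlinarith [mul_le_mul_of_nonneg_right h7 h9.le, mul_pos h9 h9]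
      linarith
  · intro r hr g hg
    rw [← hm]
    have h1 := hlarge r hr _ g le_rfl hg
    have h2 : 8 * (P.m (r-1) : ℝ)^2 / P.mu r ≤ 1 / (m:ℝ)^5 := by
      have h3 : (P.mu r : ℝ) = (P.m (r-1) : ℝ)^8 := by
        have := P.hmu (r-1)
        have h4 : r - 1 + 1 = r := by omega
        rw [h4] at this; exact_mod_cast this
      have h8 := P.mR (r-1)
      have h9 : (m:ℝ) ≤ P.m (r-1) := by rw [hm]; exact P.mmonoR (by omega)
      calc 8 * (P.m (r-1) : ℝ)^2 / P.mu r = 8 / (P.m (r-1) : ℝ)^6 := by rw [h3]; field_simp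
        _ ≤ P.m (r-1) / (P.m (r-1) : ℝ)^6 := by gcongr; linarith
        _ = 1 / (P.m (r-1) : ℝ)^5 := by field_simp
        _ ≤ _ := by gcongr
    linarith
  · rw [map_smul, hpX, smul_eq_mul, hβ]; field_simp

end GM


namespace GM
variable {P : Par}

/-- the main sequence inside a block subspace -/
structure Main (P : Par) (j s : ℕ → ℕ) (y : ℕ → VV) (p : ℕ → FF) : Prop where
  odd : ∀ n, Odd (j n)
  jm : StrictMono j
  sm : Monotone s
  hy : ∀ n i, y n i ≠ 0 → s n ≤ i ∧ i < s (n+1)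
  hp : ∀ n i, p n i ≠ 0 → s n ≤ i ∧ i < s (n+1)
  isY : ∀ n, IsY P (j n) (y n) (p n)
  H1 : ∀ k, P.H (j (2*k+1)) = {(j (2*k), p (2*k))}
  H2 : ∀ k, P.H (j (2*k)) = (Finset.range k).image (fun k' => (j (2*k'+1), p (2*k'+1)))

theorem exists_main {z : ℕ → VV} (hz : Blk z) :
    ∃ j s y p, Main P j s y p ∧ ∀ n, y n ∈ Submodule.span ℝ (Set.range z) := by
  classical
  let D : ℕ × FF × VV × ℕ := (0, 0, 0, 0)
  let Hs : List (ℕ × FF × VV × ℕ) → Finset (ℕ × FF) := fun l =>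
    if l.length % 2 = 1 then {((l.getD (l.length - 1) D).1, (l.getD (l.length - 1) D).2.1)}
    else (Finset.range (l.length / 2)).image
      (fun k' => ((l.getD (2*k'+1) D).1, (l.getD (2*k'+1) D).2.1))
  obtain ⟨f, hf⟩ := exists_seq (α := ℕ × FF × VV × ℕ) (fun l x =>
    x.2.2.1 ∈ Submodule.span ℝ (Set.range z) ∧ Odd x.1 ∧ (∀ x' ∈ l, x'.1 < x.1 ∧ x'.2.2.2 ≤ x.2.2.2) ∧
    P.H x.1 = Hs l ∧ IsY P x.1 x.2.2.1 x.2.1 ∧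
    (∀ i, x.2.2.1 i ≠ 0 ∨ x.2.1 i ≠ 0 → (∀ x' ∈ l, x'.2.2.2 ≤ i) ∧ i < x.2.2.2)) (by
    intro l
    obtain ⟨c, hc1, hc2, hc3⟩ := P.hH (Hs l) ((l.map (fun x => x.1 + 1)).sum)
    obtain ⟨y, hy1, p, hy2, hy3, hy4⟩ := lemmaY (P := P) hz hc2 ((l.map (fun x => x.2.2.2)).sum)
    obtain ⟨e, he⟩ : ∃ e, e = hi y + (p.support.sup id + 1) + ((l.map (fun x => x.2.2.2)).sum) :=
      ⟨_, rfl⟩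
    have hsum : ∀ x' ∈ l, x'.2.2.2 ≤ ((l.map (fun x => x.2.2.2)).sum) := fun x' hx' =>
      List.single_le_sum (by simp) _ (List.mem_map.2 ⟨x', hx', rfl⟩)
    have hsum1 : ∀ x' ∈ l, x'.1 + 1 ≤ ((l.map (fun x => x.1 + 1)).sum) := fun x' hx' =>
      List.single_le_sum (by simp) _ (List.mem_map.2 ⟨x', hx', rfl⟩)
    refine ⟨(c, p, y, e), hy1, hc2, ?_, hc3, hy4, ?_⟩
    · intro x' hx'
      have h1 := hsum x' hx'
      have h2 := hsum1 x' hx'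
      dsimp only
      exact ⟨by omega, by omega⟩
    · intro i hi
      dsimp only at hi ⊢
      have h1 : ((l.map (fun x => x.2.2.2)).sum) ≤ i := by
        rcases hi with h | h
        · exact hy2 i h
        · exact hy3 i h
      refine ⟨fun x' hx' => (hsum x' hx').trans h1, ?_⟩
      rcases hi with h | h
      · have := lt_hi h; omega
      · have : i ≤ p.support.sup id := Finset.le_sup (f := id) (by simpa using h)
        omega)
  have hget : ∀ n i, i < n → ((List.range n).map f).getD i D = f i := by
    intro n i hi
    rw [List.getD_eq_getElem?_getD]; simp [hi]
  have hmem : ∀ n i, i < n → f i ∈ (List.range n).map f := fun n i h =>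
    List.mem_map.2 ⟨i, by simpa using h, rfl⟩
  let s : ℕ → ℕ := fun n => match n with
    | 0 => 0
    | n+1 => (f n).2.2.2
  have hs0 : s 0 = 0 := rfl
  have hs1 : ∀ n, s (n+1) = (f n).2.2.2 := fun n => rfl
  have hsup : ∀ n i, (f n).2.2.1 i ≠ 0 ∨ (f n).2.1 i ≠ 0 → s n ≤ i ∧ i < s (n+1) := by
    intro n i hi
    have := (hf n).2.2.2.2.2 i hi
    refine ⟨?_, this.2⟩
    cases n with
    | zero => simp [hs0]
    | succ n => exact this.1 _ (hmem _ n (by omega))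
  refine ⟨fun n => (f n).1, s, fun n => (f n).2.2.1, fun n => (f n).2.1,
    ⟨fun n => (hf n).2.1, strictMono_nat_of_lt_succ fun n => ?_, monotone_nat_of_le_succ fun n => ?_,
      fun n i hi => hsup n i (Or.inl hi), fun n i hi => hsup n i (Or.inr hi),
      fun n => (hf n).2.2.2.2.1, ?_, ?_⟩,
    fun n => (hf n).1⟩
  · exact ((hf (n+1)).2.2.1 _ (hmem _ n (by omega))).1
  · cases n with
    | zero => simp [hs0]
    | succ n => exact ((hf (n+1)).2.2.1 _ (hmem _ n (by omega))).2
  · intro k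
    rw [(hf (2*k+1)).2.2.2.1]
    simp only [Hs, List.length_map, List.length_range]
    rw [if_pos (by omega), Nat.add_sub_cancel, hget _ _ (by omega)]
  · intro k
    rw [(hf (2*k)).2.2.2.1]
    simp only [Hs, List.length_map, List.length_range]
    rw [if_neg (by omega)]
    have : 2 * k / 2 = k := by omega
    rw [this]
    apply Finset.image_congr
    intro k' hk'
    simp only [Finset.coe_range, Set.mem_Iio] at hk'
    simp only [hget (2*k) (2*k'+1) (by omega)]

namespace Main
variable {j s : ℕ → ℕ} {y : ℕ → VV} {p : ℕ → FF}

lemma le_j (M : Main P j s y p) (n : ℕ) : n ≤ j n := M.jm.id_le n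

lemma orth (M : Main P j s y p) (n n' : ℕ) : pr (p n) (y n') = if n = n' then 1 else 0 := by
  split_ifs with h
  · subst h; exact (M.isY n).hpy
  · apply pr_eq_zero
    intro i hi
    by_contra hc
    have h1 := M.hy _ _ hi
    have h2 := M.hp _ _ hc
    rcases lt_or_gt_of_ne h with h | h
    · have := M.sm (show n + 1 ≤ n' by omega); omega
    · have := M.sm (show n' + 1 ≤ n by omega); omega

lemma yne (M : Main P j s y p) (n : ℕ) : y n ≠ 0 := by
  intro h
  have := (M.isY n).hpy
  rw [h] at this; simp at this

lemma blk (M : Main P j s y p) : Blk y := by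
  refine ⟨?_, M.yne⟩
  intro n n' h i i' hi hi'
  have h1 := M.hy _ _ hi
  have h2 := M.hy _ _ hi'
  have := M.sm (show n + 1 ≤ n' by omega); omega

/-- the special functionals on the main sequence -/
lemma special (M : Main P j s y p) (B : Finset ℕ) (r : ℕ) (hB : 2 * B.card ≤ P.N r) :
    ∃ f, InW P f ∧ ∀ x, pr f x = (1 / (P.mu r : ℝ)) *
      ∑ k ∈ B, (pr (p (2*k)) x + pr (p (2*k+1)) x) := by
  classical
  obtain ⟨κ, hκ1, hκ2⟩ : ∃ κ : ℕ → ℕ, (∀ i i', i < i' → i' < B.card → κ i < κ i') ∧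
      ∀ F : ℕ → ℝ, ∑ k ∈ B, F k = ∑ i ∈ Finset.range B.card, F (κ i) := by
    let e := B.orderEmbOfFin rfl
    refine ⟨fun i => if h : i < B.card then e ⟨i, h⟩ else 0, ?_, ?_⟩
    · intro i i' h h'
      simp only [h', h.trans h', dif_pos]
      exact e.strictMono (by simpa using h)
    · intro F
      rw [Finset.sum_range]
      have h1 : B = Finset.univ.image e := by simp [e]
      conv_lhs => rw [h1]
      rw [Finset.sum_image (fun a _ b _ h => e.injective h)]
      apply Finset.sum_congr rfl
      intro i _
      simp
  obtain ⟨idx, hidx⟩ : ∃ idx : ℕ → ℕ, idx = fun q => 2 * κ (q/2) + q % 2 := ⟨_, rfl⟩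
  have hlt : ∀ q q', q < q' → q' < 2 * B.card → idx q < idx q' := by
    intro q q' h h'
    rw [hidx]; dsimp only
    rcases Nat.lt_or_ge (q/2) (q'/2) with h1 | h1
    · have := hκ1 _ _ h1 (by omega); omega
    · have : q/2 = q'/2 := by omega
      rw [this]; omega
  obtain ⟨b, hb⟩ : ∃ b, b = (∑ q ∈ Finset.range (2*B.card), p (idx q)).support.sup id + 1 := ⟨_, rfl⟩
  refine ⟨_, ⟨_, Wt.spec r (2*B.card) (fun q => j (idx q)) (fun q => p (idx q)) 1 0 b hB
    (fun q _ => (M.isY _).hp) (fun q _ => M.odd _) ?_ ?_ (Or.inl rfl)⟩, ?_⟩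
  · intro q hq
    refine ⟨M.jm (hlt _ _ (by omega) hq), ?_⟩
    rcases Nat.even_or_odd' q with ⟨e, he | he⟩
    · have h1 : idx q = 2 * κ e := by
        rw [hidx]; dsimp only
        have h1 : q / 2 = e := by omega
        have h2 : q % 2 = 0 := by omega
        rw [h1, h2]; omega
      have h2 : idx (q+1) = 2 * κ e + 1 := by
        rw [hidx]; dsimp only
        have h1 : (q+1) / 2 = e := by omega
        have h2 : (q+1) % 2 = 1 := by omega
        rw [h1, h2]
      rw [h1, h2, M.H1]; simp
    · have h1 : idx q = 2 * κ e + 1 := by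
        rw [hidx]; dsimp only
        have h1 : q / 2 = e := by omega
        have h2 : q % 2 = 1 := by omega
        rw [h1, h2]
      have h2 : idx (q+1) = 2 * κ (e+1) := by
        rw [hidx]; dsimp only
        have h1 : (q+1) / 2 = e+1 := by omega
        have h2 : (q+1) % 2 = 0 := by omega
        rw [h1, h2]; omega
      rw [h1, h2, M.H2]
      exact Finset.mem_image.2 ⟨κ e, by simpa using hκ1 e (e+1) (by omega) (by omega), rfl⟩
  · intro q q' h h' i i' hi hi'
    have h1 := M.hp _ _ hi
    have h2 := M.hp _ _ hi'
    have := M.sm (show idx q + 1 ≤ idx q' from hlt _ _ h h')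
    omega
  · intro x
    have e1 : res 0 b (∑ q ∈ Finset.range (2*B.card), p (idx q))
        = ∑ q ∈ Finset.range (2*B.card), p (idx q) := by
      ext i
      rw [res_apply]
      split_ifs with h
      · rfl
      · by_contra hc
        apply h
        refine ⟨Nat.zero_le _, ?_⟩
        rw [hb]
        exact Nat.lt_succ_of_le (Finset.le_sup (f := id) (Finsupp.mem_support_iff.2 (Ne.symm hc)))
    rw [e1, pr_smul, pr_sum]
    push_cast
    congr 1
    rw [hκ2 (fun k => pr (p (2*k)) x + pr (p (2*k+1)) x)]
    have e2 : ∀ n, ∑ q ∈ Finset.range (2*n), pr (p (idx q)) x =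
        ∑ i ∈ Finset.range n, (pr (p (2 * κ i)) x + pr (p (2 * κ i + 1)) x) := by
      intro n
      induction n with
      | zero => simp
      | succ n ih =>
        rw [Nat.mul_succ, Finset.sum_range_succ, Finset.sum_range_succ, Finset.sum_range_succ, ih, add_assoc]
        have h1 : idx (2*n) = 2 * κ n := by
          rw [hidx]; dsimp only
          have h1 : (2*n) / 2 = n := by omega
          have h2 : (2*n) % 2 = 0 := by omega
          rw [h1, h2]; omega
        have h2 : idx (2*n+1) = 2 * κ n + 1 := by
          rw [hidx]; dsimp only
          have h1 : (2*n+1) / 2 = n := by omega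
          have h2 : (2*n+1) % 2 = 1 := by omega
          rw [h1, h2]
        rw [h1, h2]
    exact e2 _

lemma low_sum (M : Main P j s y p) (Q r : ℕ) (hQ : 2 * Q ≤ P.N r) :
    2 * Q / (P.mu r : ℝ) ≤ nrm P (∑ k ∈ Finset.range Q, (y (2*k) + y (2*k+1))) := by
  obtain ⟨f, hf, hfx⟩ := M.special (Finset.range Q) r (by simpa using hQ)
  refine le_trans ?_ ((le_abs_self _).trans (hf.le_nrm _))
  rw [hfx]
  have : ∀ k ∈ Finset.range Q, (pr (p (2*k)) (∑ k ∈ Finset.range Q, (y (2*k) + y (2*k+1))) +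
      pr (p (2*k+1)) (∑ k ∈ Finset.range Q, (y (2*k) + y (2*k+1)))) = 2 := by
    intro k hk
    simp only [map_sum, map_add, M.orth]
    have e1 : ∀ k', (if 2*k = 2*k'+1 then (1:ℝ) else 0) = 0 := fun k' => if_neg (by omega)
    have e2 : ∀ k', (if 2*k+1 = 2*k' then (1:ℝ) else 0) = 0 := fun k' => if_neg (by omega)
    have e3 : ∀ k', (if 2*k = 2*k' then (1:ℝ) else 0) = if k = k' then 1 else 0 := fun k' => by
      congr 1; simp
    have e4 : ∀ k', (if 2*k+1 = 2*k'+1 then (1:ℝ) else 0) = if k = k' then 1 else 0 := fun k' => by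
      congr 1; simp
    simp only [e1, e2, e3, e4, zero_add, add_zero, Finset.sum_ite_eq, if_pos hk]
    norm_num
  rw [Finset.sum_congr rfl this]
  simp
  apply le_of_eq; ring

lemma low_pos (M : Main P j s y p) (B S : Finset ℕ) (hBS : B ⊆ S) (a : ℕ → ℝ) (r δ : ℕ) (hδ : δ < 2)
    (hB : 2 * B.card ≤ P.N r) :
    |∑ k ∈ B, a k| ≤ P.mu r * nrm P (∑ k ∈ S, a k • y (2*k+δ)) := by
  obtain ⟨f, hf, hfx⟩ := M.special B r hB
  have hmu := P.muR r
  have h1 := hf.le_nrm (∑ k ∈ S, a k • y (2*k+δ))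
  rw [hfx] at h1
  have : ∀ k ∈ B, (pr (p (2*k)) (∑ k ∈ S, a k • y (2*k+δ)) +
      pr (p (2*k+1)) (∑ k ∈ S, a k • y (2*k+δ))) = a k := by
    intro k hk
    simp only [map_sum, map_smul, M.orth, smul_eq_mul, mul_ite, mul_one, mul_zero]
    rcases (show δ = 0 ∨ δ = 1 by omega) with h | h
    · subst h
      have e2 : ∀ k', (if 2*k+1 = 2*k'+0 then a k' else 0) = 0 := fun k' => if_neg (by omega)
      have e3 : ∀ k', (if 2*k = 2*k'+0 then a k' else 0) = if k = k' then a k' else 0 := fun k' => by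
        congr 1; simp
      simp only [e2, e3, Finset.sum_ite_eq, if_pos (hBS hk)]; simp
    · subst h
      have e2 : ∀ k', (if 2*k = 2*k'+1 then a k' else 0) = 0 := fun k' => if_neg (by omega)
      have e3 : ∀ k', (if 2*k+1 = 2*k'+1 then a k' else 0) = if k = k' then a k' else 0 := fun k' => by
        congr 1; simp
      simp only [e2, e3, Finset.sum_ite_eq, if_pos (hBS hk)]; simp
  rw [Finset.sum_congr rfl this, abs_mul, abs_of_pos (by positivity), one_div, inv_mul_eq_div,
    div_le_iff₀ (by linarith)] at h1
  linarith

lemma low (M : Main P j s y p) (B S : Finset ℕ) (hBS : B ⊆ S) (a : ℕ → ℝ) (r δ : ℕ) (hδ : δ < 2)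
    (hB : 2 * B.card ≤ P.N r) :
    ∑ k ∈ B, |a k| ≤ 2 * P.mu r * nrm P (∑ k ∈ S, a k • y (2*k+δ)) := by
  classical
  rw [← Finset.sum_filter_add_sum_filter_not B (fun k => 0 ≤ a k)]
  have hc : ∀ (q : ℕ → Prop) [DecidablePred q], 2 * (B.filter q).card ≤ P.N r := fun q _ => by
    have := Finset.card_filter_le B q; omega
  have h1 := M.low_pos (B.filter (fun k => 0 ≤ a k)) S ((Finset.filter_subset _ _).trans hBS) a r δ hδ (hc _)
  have h2 := M.low_pos (B.filter (fun k => ¬ 0 ≤ a k)) S ((Finset.filter_subset _ _).trans hBS) a r δ hδ (hc _)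
  have e1 : ∑ k ∈ B.filter (fun k => 0 ≤ a k), |a k| = ∑ k ∈ B.filter (fun k => 0 ≤ a k), a k :=
    Finset.sum_congr rfl fun k hk => abs_of_nonneg (Finset.mem_filter.1 hk).2
  have e2 : ∑ k ∈ B.filter (fun k => ¬ 0 ≤ a k), |a k| = -∑ k ∈ B.filter (fun k => ¬ 0 ≤ a k), a k := by
    rw [← Finset.sum_neg_distrib]
    exact Finset.sum_congr rfl fun k hk => abs_of_nonpos (not_le.1 (Finset.mem_filter.1 hk).2).le
  rw [e1, e2]
  have := le_abs_self (∑ k ∈ B.filter (fun k => 0 ≤ a k), a k)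
  have := neg_le_abs (∑ k ∈ B.filter (fun k => ¬ 0 ≤ a k), a k)
  linarith

end Main
end GM


namespace GM
variable {P : Par}

lemma uniq {Q : ℕ → Prop} (h : ∀ k k', Q k → Q k' → k = k') : ∃ k0, ∀ k, Q k → k = k0 := by
  by_cases h1 : ∃ k, Q k
  · obtain ⟨k0, hk0⟩ := h1
    exact ⟨k0, fun k hk => h _ _ hk hk0⟩
  · exact ⟨0, fun k hk => absurd ⟨k, hk⟩ h1⟩

namespace Main
variable {j s : ℕ → ℕ} {y : ℕ → VV} {p : ℕ → FF}

lemma step (M : Main P j s y p) {r d : ℕ} {c : ℕ → ℕ} {g : ℕ → FF} (h : Spec P r d c g) {q n : ℕ} (hq : q + 1 < d)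
    (hn : c (q+1) = j n) : ∃ n', c q = j n' ∧ g q = p n' ∧ (n % 2 = 0 → n' % 2 = 1) ∧
      (n % 2 = 1 → n' + 1 = n) := by
  have h1 := (h.hc q hq).2
  rw [hn] at h1
  rcases Nat.even_or_odd' n with ⟨e, he | he⟩
  · rw [he, M.H2] at h1
    obtain ⟨k', _, hk'⟩ := Finset.mem_image.1 h1
    rw [Prod.mk.injEq] at hk'
    exact ⟨2*k'+1, hk'.1.symm, hk'.2.symm, by omega, by omega⟩
  · rw [he, M.H1, Finset.mem_singleton, Prod.mk.injEq] at h1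
    exact ⟨2*e, h1.1, h1.2, by omega, by omega⟩

lemma chain (M : Main P j s y p) {r d : ℕ} {c : ℕ → ℕ} {g : ℕ → FF} (h : Spec P r d c g) :
    ∃ K0 K1, ∀ k, k ≠ K0 → k ≠ K1 → (∀ q < d, c q ≠ j (2*k) ∧ c q ≠ j (2*k+1)) ∨
      ∃ q, q + 1 < d ∧ c q = j (2*k) ∧ c (q+1) = j (2*k+1) ∧ g q = p (2*k) ∧ g (q+1) = p (2*k+1) := by
  classical
  by_cases hex : ∃ q < d, ∃ n, c q = j n
  swap
  · refine ⟨0, 0, fun k _ _ => Or.inl fun q hq => ⟨fun he => hex ⟨q, hq, _, he⟩, fun he => hex ⟨q, hq, _, he⟩⟩⟩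
  have hne : ((Finset.range d).filter (fun q => ∃ n, c q = j n)).Nonempty := by
    obtain ⟨q, hq, hn⟩ := hex
    exact ⟨q, by simp [hq, hn]⟩
  obtain ⟨qs, hqs, hmax⟩ := Finset.exists_max_image _ id hne
  rw [Finset.mem_filter, Finset.mem_range] at hqs
  obtain ⟨hqsd, ns, hns⟩ := hqs
  have hle : ∀ q < d, ∀ n, c q = j n → q ≤ qs := fun q hq n hn =>
    hmax q (by simp only [Finset.mem_filter, Finset.mem_range]; exact ⟨hq, n, hn⟩)
  have hall : ∀ e q, q + e = qs → ∃ n, c q = j n := by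
    intro e
    induction e with
    | zero => intro q hq; exact ⟨ns, by rw [← hns, ← hq]; rfl⟩
    | succ e ih =>
      intro q hq
      obtain ⟨n, hn⟩ := ih (q+1) (by omega)
      obtain ⟨n', hn', _⟩ := M.step h (by omega) hn
      exact ⟨n', hn'⟩
  obtain ⟨K1, hK1⟩ := uniq (Q := fun k => c 0 = j (2*k+1)) (fun k k' h1 h2 => by
    have := M.jm.injective (h1.symm.trans h2); omega)
  -- an even entry is followed by its partner
  have hev : ∀ k, k ≠ ns/2 → ∀ q < d, c q = j (2*k) → q + 1 < qs ∧ c (q+1) = j (2*k+1) ∧ g q = p (2*k) := by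
    intro k hk q hq hcq
    have h1 := hle q hq _ hcq
    have h2 : q ≠ qs := by
      rintro rfl
      have := M.jm.injective (hns.symm.trans hcq); omega
    obtain ⟨n, hn⟩ := hall (qs - (q+1)) (q+1) (by omega)
    obtain ⟨n', hn', hg, ha, hb⟩ := M.step h (by omega) hn
    have h3 := M.jm.injective (hn'.symm.trans hcq)
    rw [h3] at ha hb hg
    have h4 : n = 2*k+1 := by
      rcases Nat.mod_two_eq_zero_or_one n with h5 | h5
      · have := ha h5; omega
      · exact (hb h5).symm
    rw [h4] at hn
    refine ⟨?_, hn, hg⟩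
    have h5 : q + 1 ≠ qs := by
      intro h5
      rw [h5] at hn
      have := M.jm.injective (hns.symm.trans hn); omega
    omega
  refine ⟨ns/2, K1, fun k hk0 hk1 => ?_⟩
  by_cases hm : ∃ q < d, c q = j (2*k)
  · right
    obtain ⟨q, hq, hcq⟩ := hm
    obtain ⟨h1, h2, h3⟩ := hev k hk0 q hq hcq
    refine ⟨q, by omega, hcq, h2, h3, ?_⟩
    obtain ⟨n, hn⟩ := hall (qs - (q+2)) (q+2) (by omega)
    obtain ⟨n', hn', hg, _⟩ := M.step h (by omega : (q+1)+1 < d) hn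
    have h3 := M.jm.injective (hn'.symm.trans h2)
    rw [hg, h3]
  · left
    intro q hq
    refine ⟨fun he => hm ⟨q, hq, he⟩, fun he => ?_⟩
    cases q with
    | zero => exact hk1 (hK1 k he)
    | succ q =>
      obtain ⟨n', hn', _, _, hb⟩ := M.step h hq he
      have := hb (by omega)
      exact hm ⟨q, by omega, by rw [hn']; congr 1; omega⟩

/-- the differences -/
lemma cancel (M : Main P j s y p) (a b : ℕ) : ∃ K2 K3, ∀ k, k ≠ K2 → k ≠ K3 →
    pr (res a b (p (2*k))) (y (2*k+1) - y (2*k)) + pr (res a b (p (2*k+1))) (y (2*k+1) - y (2*k)) = 0 := by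
  have hu : ∀ a, ∃ K, ∀ k, s (2*k) < a ∧ a < s (2*k+2) → k = K := fun a => uniq (fun k k' h1 h2 => by
    rcases lt_trichotomy k k' with h | h | h
    · have := M.sm (show 2*k+2 ≤ 2*k' by omega); omega
    · exact h
    · have := M.sm (show 2*k'+2 ≤ 2*k by omega); omega)
  obtain ⟨K2, h2⟩ := hu a
  obtain ⟨K3, h3⟩ := hu b
  refine ⟨K2, K3, fun k hk2 hk3 => ?_⟩
  have hs1 := M.sm (show 2*k ≤ 2*k+1 by omega)
  have hs2 := M.sm (show 2*k+1 ≤ 2*k+2 by omega)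
  have hsupp : ∀ i, (y (2*k+1) - y (2*k)) i ≠ 0 → s (2*k) ≤ i ∧ i < s (2*k+2) := by
    intro i hi
    by_cases h : y (2*k+1) i = 0
    · have : y (2*k) i ≠ 0 := by
        intro h'; apply hi; simp [h, h']
      have := M.hy _ _ this; omega
    · have := M.hy _ _ h
      have hss : s (2*k+1+1) = s (2*k+2) := rfl
      omega
  by_cases hc : a ≤ s (2*k) ∧ s (2*k+2) ≤ b
  · have : SuppIn a b (y (2*k+1) - y (2*k)) := fun i hi => by
      have := hsupp i hi; omega
    rw [pr_res_of_supp this, pr_res_of_supp this, map_sub, map_sub, M.orth, M.orth, M.orth, M.orth]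
    simp
  · have hz : ∀ f, pr (res a b f) (y (2*k+1) - y (2*k)) = 0 := by
      intro f
      apply pr_eq_zero
      intro i hi
      rw [res_apply, if_neg]
      have h4 := hsupp i hi
      by_cases ha : a ≤ s (2*k)
      · have h5 : ¬ (s (2*k) < b) := fun h => hk3 (h3 k ⟨h, by omega⟩)
        omega
      · have h5 : ¬ (a < s (2*k+2)) := fun h => hk2 (h2 k ⟨by omega, h⟩)
        omega
    rw [hz, hz, add_zero]

lemma w_le (M : Main P j s y p) (k : ℕ) {g : FF} {e1 e2 : ℝ} (h1 : |pr g (y (2*k+1))| ≤ e1) (h2 : |pr g (y (2*k))| ≤ e2) :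
    |pr g (y (2*k+1) - y (2*k))| ≤ e1 + e2 := by
  rw [map_sub]
  exact (abs_sub _ _).trans (add_le_add h1 h2)

lemma jgt (M : Main P j s y p) {t k : ℕ} (hk : k ∉ Finset.range (t+2)) (δ : ℕ) : t + 1 < j (2*k+δ) := by
  have := M.le_j (2*k+δ)
  simp at hk; omega

lemma eps_le (M : Main P j s y p) {t k : ℕ} (hk : k ∉ Finset.range (t+2)) (δ : ℕ) :
    6 * ((P.m (j (2*k+δ)) : ℝ) / P.k (j (2*k+δ))) ≤ 6 * (1 / (P.mu (t+1) : ℝ)^4) := by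
  have h0 := M.jgt hk δ
  have h1 := P.mk_le' (j (2*k+δ))
  have h2 := P.mmonoR h0.le
  have h3 := P.muR (t+1)
  have h4 : (P.m (t+1) : ℝ) = (P.mu (t+1) : ℝ)^8 := by exact_mod_cast P.hm (t+1)
  have h5 := P.mR (t+1)
  have h6 : 1 / (P.m (j (2*k+δ)) : ℝ)^3 ≤ 1 / (P.mu (t+1) : ℝ)^4 := by
    apply one_div_le_one_div_of_le (by positivity)
    calc (P.mu (t+1) : ℝ)^4 ≤ (P.mu (t+1) : ℝ)^8 := pow_le_pow_right₀ (by linarith) (by norm_num)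
      _ ≤ P.m (j (2*k+δ)) := by rw [← h4]; exact h2
      _ ≤ _ := le_self_pow₀ (by linarith) (by norm_num)
  linarith

end Main

lemma theta_big (t : ℕ) : 1200 * (1 / (P.mu (t+1) : ℝ)^4) ≤ 1 / (P.mu (t+1) : ℝ)^2 := by
  have h := P.muR (t+1)
  rw [← div_eq_mul_one_div]
  rw [div_le_div_iff₀ (by positivity) (by positivity)]
  have : (1200:ℝ) ≤ (P.mu (t+1) : ℝ)^2 := by nlinarith
  have h2 : 0 ≤ (P.mu (t+1) : ℝ)^2 := by positivity
  nlinarith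

lemma mu_geo {L c : ℕ} (h : L ≤ c) : 1 / (P.mu c : ℝ)^4 ≤ 1 / (P.mu L : ℝ)^4 * (1/2)^(c - L) := by
  have h0 := P.muR L
  have hx : ∀ e, P.mu L * 2^e ≤ P.mu (L+e) := by
    intro e
    induction e with
    | zero => simp
    | succ e ih =>
      have h1 := P.mu_pos (L+e)
      have : 2 * P.mu (L+e) ≤ P.mu (L+e+1) := by
        rw [P.hmu, P.hm, ← pow_mul]
        calc 2 * P.mu (L+e) ≤ P.mu (L+e) * P.mu (L+e) := by gcongr; omega
          _ = P.mu (L+e) ^ 2 := by ring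
          _ ≤ _ := Nat.pow_le_pow_right (by omega) (by norm_num)
      rw [← add_assoc, pow_succ]
      linarith
  have h1 : ((P.mu L : ℝ) * 2^(c-L)) ≤ P.mu c := by
    have := hx (c - L)
    rw [Nat.add_sub_cancel' h] at this
    exact_mod_cast this
  have h2 : 1 / (P.mu L : ℝ)^4 * (1/2)^(c - L) = 1 / ((P.mu L : ℝ)^4 * 2^(c-L)) := by
    rw [one_div_pow, one_div_mul_one_div]
  rw [h2]
  apply one_div_le_one_div_of_le (by positivity)
  calc (P.mu L : ℝ)^4 * 2^(c-L) ≤ (P.mu L : ℝ)^4 * (2^(c-L))^4 := by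
        gcongr
        exact le_self_pow₀ (one_le_pow₀ (by norm_num)) (by norm_num)
    _ = ((P.mu L : ℝ) * 2^(c-L))^4 := by ring
    _ ≤ _ := by gcongr

lemma card_five {A : Finset ℕ} {t a b c d e : ℕ}
    (h : ∀ k ∈ A, k ∉ Finset.range (t+2) → k = a ∨ k = b ∨ k = c ∨ k = d ∨ k = e) : A.card ≤ t + 10 := by
  classical
  have : A ⊆ Finset.range (t+2) ∪ {a,b,c,d,e} := by
    intro k hk
    rw [Finset.mem_union]
    by_cases h1 : k ∈ Finset.range (t+2)
    · exact Or.inl h1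
    · right; have := h k hk h1; simpa using this
  have h1 := Finset.card_le_card this
  have h2 := Finset.card_union_le (Finset.range (t+2)) {a,b,c,d,e}
  have h3 : ({a,b,c,d,e} : Finset ℕ).card ≤ 5 := Finset.card_le_five
  simp only [Finset.card_range] at h2
  omega

namespace Main
variable {j s : ℕ → ℕ} {y : ℕ → VV} {p : ℕ → FF}

lemma wsucc (M : Main P j s y p) : SuccV (fun k => y (2*k+1) - y (2*k)) := by
  have hsupp : ∀ k i, (y (2*k+1) - y (2*k)) i ≠ 0 → s (2*k) ≤ i ∧ i < s (2*k+2) := by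
    intro k i hi
    have hs1 := M.sm (show 2*k ≤ 2*k+1 by omega)
    have hs2 := M.sm (show 2*k+1 ≤ 2*k+2 by omega)
    by_cases h : y (2*k+1) i = 0
    · have : y (2*k) i ≠ 0 := by
        intro h'; apply hi; simp [h, h']
      have := M.hy _ _ this; omega
    · have := M.hy _ _ h
      have hss : s (2*k+1+1) = s (2*k+2) := rfl
      omega
  intro k k' h i i' hi hi'
  have h1 := hsupp _ _ hi
  have h2 := hsupp _ _ hi'
  have := M.sm (show 2*k+2 ≤ 2*k' by omega)
  omega

lemma Ha (M : Main P j s y p) (t i : ℕ) (hi : t + 1 ≤ i) (g : FF) (hg : Ev P i g) (A : Finset ℕ)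
    (hA : ∀ k ∈ A, 1 / (P.mu (t+1) : ℝ)^2 < |pr g (y (2*k+1) - y (2*k))|) : A.card ≤ t + 10 := by
  obtain ⟨K, hK⟩ := uniq (Q := fun k => j (2*k) = i ∨ j (2*k+1) = i) (fun k k' h1 h2 => by
    rcases h1 with h1 | h1 <;> rcases h2 with h2 | h2 <;>
      have := M.jm.injective (h1.trans h2.symm) <;> omega)
  apply card_five (a := K) (b := K) (c := K) (d := K) (e := K)
  intro k hk hkt
  left
  by_contra hne
  have h1 : i ≠ j (2*k+0) := fun h => hne (hK k (Or.inl h.symm))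
  have h2 : i ≠ j (2*k+1) := fun h => hne (hK k (Or.inr h.symm))
  have h3 := M.w_le k ((M.isY _).h2 i h2 g hg) ((M.isY _).h2 i h1 g hg)
  have h4 := hA k hk
  have e1 := M.eps_le hkt 0
  have e2 := M.eps_le hkt 1
  have h5 := theta_big (P := P) t
  have h6 : 66 / (P.mu i : ℝ)^4 ≤ 66 / (P.mu (t+1) : ℝ)^4 := by
    have := P.muR (t+1)
    have := P.mumonoR hi
    gcongr
  have h7 : 0 < 1 / (P.mu (t+1) : ℝ)^4 := by
    have := P.muR (t+1)
    positivity
  rw [div_eq_mul_one_div 66 ((P.mu (t+1) : ℝ)^4)] at h6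
  linarith

lemma Hb (M : Main P j s y p) (t r d : ℕ) (c : ℕ → ℕ) (g : ℕ → FF) (a b : ℕ) (hsp : Spec P r d c g) (A : Finset ℕ)
    (hA : ∀ k ∈ A, 1 / (P.mu (t+1) : ℝ)^2 < (1 / (P.mu r : ℝ)) *
        |∑ q ∈ Finset.range d, pr (res a b (g q)) (y (2*k+1) - y (2*k))| ∧
      1 / (P.mu (t+1) : ℝ)^2 / 4 <
        |∑ q ∈ (Finset.range d).filter (fun q => t + 1 ≤ c q), pr (res a b (g q)) (y (2*k+1) - y (2*k))|) :
    A.card ≤ t + 10 := by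
  classical
  obtain ⟨K, hK⟩ := uniq (Q := fun k => j (2*k) ≤ r ∧ r ≤ j (2*k+1)) (fun k k' h1 h2 => by
    rcases lt_trichotomy k k' with h | h | h
    · have := M.jm (show 2*k+1 < 2*k' by omega); omega
    · exact h
    · have := M.jm (show 2*k'+1 < 2*k by omega); omega)
  obtain ⟨K0, K1, hch⟩ := M.chain hsp
  obtain ⟨K2, K3, hcan⟩ := M.cancel a b
  apply card_five (a := K) (b := K0) (c := K1) (d := K2) (e := K3)
  intro k hk hkt
  by_contra hne
  push Not at hne
  obtain ⟨n0, n1, n2, n3, n4⟩ := hne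
  have hjj := M.jm (show 2*k+0 < 2*k+1 by omega)
  have hnK : ¬ (j (2*k) ≤ r ∧ r ≤ j (2*k+1)) := fun h => n0 (hK k h)
  have e1 := M.eps_le hkt 0
  have e2 := M.eps_le hkt 1
  have h5 := theta_big (P := P) t
  have h7 : 0 < 1 / (P.mu (t+1) : ℝ)^4 := by
    have := P.muR (t+1)
    positivity
  by_cases hr : j (2*k+1) < r
  · have hop := hsp.op (ε := 1) (Or.inl rfl) a b
    have h3 := M.w_le k ((M.isY _).h3 r hr _ hop) ((M.isY (2*k+0)).h3 r (by omega) _ hop)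
    rw [pr_spec (Or.inl rfl)] at h3
    have h4 := (hA k hk).1
    have hm5 : ∀ δ, 1 / (P.m (j (2*k+δ)) : ℝ)^5 ≤ 1 / (P.mu (t+1) : ℝ)^4 := by
      intro δ
      have h0 := M.jgt hkt δ
      have h2 := P.mmonoR h0.le
      have h3 := P.muR (t+1)
      have h4 : (P.m (t+1) : ℝ) = (P.mu (t+1) : ℝ)^8 := by exact_mod_cast P.hm (t+1)
      have h5 := P.mR (t+1)
      apply one_div_le_one_div_of_le (by positivity)
      calc (P.mu (t+1) : ℝ)^4 ≤ (P.mu (t+1) : ℝ)^8 := pow_le_pow_right₀ (by linarith) (by norm_num)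
        _ ≤ P.m (j (2*k+δ)) := by rw [← h4]; exact h2
        _ ≤ _ := le_self_pow₀ (by linarith) (by norm_num)
    have h8 := hm5 0
    have h9 := hm5 1
    linarith
  have hr' : r < j (2*k) := by
    by_contra hc
    exact hnK ⟨by omega, by omega⟩
  have h4 := (hA k hk).2
  -- tail analysis
  obtain ⟨Q, hQ⟩ : ∃ Q, Q = (Finset.range d).filter (fun q => t + 1 ≤ c q) := ⟨_, rfl⟩
  rw [← hQ, ← Finset.sum_filter_add_sum_filter_not Q (fun q => c q = j (2*k) ∨ c q = j (2*k+1))] at h4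
  have hz : ∑ q ∈ Q.filter (fun q => c q = j (2*k) ∨ c q = j (2*k+1)),
      pr (res a b (g q)) (y (2*k+1) - y (2*k)) = 0 := by
    rcases hch k n1 n2 with hno | ⟨q, hq, hc0, hc1, hg0, hg1⟩
    · apply Finset.sum_eq_zero
      intro q hq
      rw [hQ] at hq
      simp only [Finset.mem_filter, Finset.mem_range] at hq
      have := hno q hq.1.1
      tauto
    · have heq : Q.filter (fun q => c q = j (2*k) ∨ c q = j (2*k+1)) = {q, q+1} := by
        ext q'
        have hj0 := M.jgt hkt 0
        have hj1 := M.jgt hkt 1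
        have hcinj : ∀ q1 < d, ∀ q2 < d, c q1 = c q2 → q1 = q2 := by
          intro q1 h1 q2 h2 he
          rcases lt_trichotomy q1 q2 with h | h | h
          · have := hsp.lt h h2; omega
          · exact h
          · have := hsp.lt h h1; omega
        simp only [hQ, Finset.mem_filter, Finset.mem_range, Finset.mem_insert, Finset.mem_singleton]
        constructor
        · rintro ⟨⟨h1, _⟩, h2 | h2⟩
          · left; exact hcinj _ h1 _ (by omega) (h2.trans hc0.symm)
          · right; exact hcinj _ h1 _ (by omega) (h2.trans hc1.symm)
        · rintro (h | h)
          · subst h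
            exact ⟨⟨by omega, by rw [hc0]; exact hj0.le⟩, Or.inl hc0⟩
          · subst h
            exact ⟨⟨by omega, by rw [hc1]; exact hj1.le⟩, Or.inr hc1⟩
      rw [heq, Finset.sum_pair (by omega), hg0, hg1]
      exact hcan k n3 n4
  rw [hz, zero_add] at h4
  obtain ⟨Q', hQ'⟩ : ∃ Q', Q' = Q.filter (fun q => ¬ (c q = j (2*k) ∨ c q = j (2*k+1))) := ⟨_, rfl⟩
  rw [← hQ'] at h4
  have hmem : ∀ q ∈ Q', q < d ∧ t + 1 ≤ c q ∧ c q ≠ j (2*k+0) ∧ c q ≠ j (2*k+1) := by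
    intro q hq
    rw [hQ', hQ] at hq
    simp only [Finset.mem_filter, Finset.mem_range] at hq
    have h1 := hq.2
    push Not at h1
    exact ⟨hq.1.1, hq.1.2, h1.1, h1.2⟩
  obtain ⟨E, hE⟩ : ∃ E : ℝ, E = 6 * ((P.m (j (2*k+1)) : ℝ) / P.k (j (2*k+1))) +
      6 * ((P.m (j (2*k+0)) : ℝ) / P.k (j (2*k+0))) := ⟨_, rfl⟩
  have hb : ∀ q ∈ Q', |pr (res a b (g q)) (y (2*k+1) - y (2*k))| ≤
      132 * (1 / (P.mu (t+1) : ℝ)^4) * (1/2)^(c q - (t+1)) + E := by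
    intro q hq
    obtain ⟨m1, m2, m3, m4⟩ := hmem q hq
    have hev := (hsp.hg q m1).res a b
    have h3 := M.w_le k ((M.isY _).h2 _ m4 _ hev) ((M.isY _).h2 _ m3 _ hev)
    have h6 := mu_geo (P := P) m2
    rw [div_eq_mul_one_div 66] at h3
    rw [hE]
    linarith
  have h3 := (Finset.abs_sum_le_sum_abs _ _).trans (Finset.sum_le_sum hb)
  rw [Finset.sum_add_distrib, ← Finset.mul_sum, Finset.sum_const, nsmul_eq_mul] at h3
  have hgs : ∑ q ∈ Q', (1/2:ℝ)^(c q - (t+1)) ≤ 2 := by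
    apply geo_sum
    intro q hq q' hq' he
    have hq := hmem q hq
    have hq' := hmem q' hq'
    dsimp only at he
    rcases lt_trichotomy q q' with h | h | h
    · have := hsp.lt h hq'.1; omega
    · exact h
    · have := hsp.lt h hq.1; omega
  have hcard : (Q'.card : ℝ) ≤ P.N r + 1 := by
    have : Q'.card ≤ P.N r := by
      calc Q'.card ≤ (Finset.range d).card := Finset.card_le_card fun q hq => by
            simpa using (hmem q hq).1
        _ ≤ _ := by simpa using hsp.hd
    have : (Q'.card : ℝ) ≤ P.N r := by exact_mod_cast this
    linarith
  have hε : ∀ δ, (P.N r + 1 : ℝ) * (6 * ((P.m (j (2*k+δ)) : ℝ) / P.k (j (2*k+δ)))) ≤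
      6 * (1 / (P.mu (t+1) : ℝ)^4) := by
    intro δ
    have h0 := M.jgt hkt δ
    have hrj : r < j (2*k+δ) := hr'.trans_le (M.jm.monotone (by omega))
    have h1 := P.mk_le hrj
    have h2 := P.mmonoR h0.le
    have h3 := P.muR (t+1)
    have h4 : (P.m (t+1) : ℝ) = (P.mu (t+1) : ℝ)^8 := by exact_mod_cast P.hm (t+1)
    have h5 := P.mR (t+1)
    have h6 : 1 / (P.m (j (2*k+δ)) : ℝ)^3 ≤ 1 / (P.mu (t+1) : ℝ)^4 := by
      apply one_div_le_one_div_of_le (by positivity)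
      calc (P.mu (t+1) : ℝ)^4 ≤ (P.mu (t+1) : ℝ)^8 := pow_le_pow_right₀ (by linarith) (by norm_num)
        _ ≤ P.m (j (2*k+δ)) := by rw [← h4]; exact h2
        _ ≤ _ := le_self_pow₀ (by linarith) (by norm_num)
    have h8 := P.mR (j (2*k+δ))
    have hN : (0:ℝ) < P.N r + 1 := by positivity
    calc (P.N r + 1 : ℝ) * (6 * ((P.m (j (2*k+δ)) : ℝ) / P.k (j (2*k+δ))))
        ≤ (P.N r + 1 : ℝ) * (6 * (1 / ((P.m (j (2*k+δ)) : ℝ)^3 * (P.N r + 1)))) := by gcongr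
      _ = 6 * (1 / (P.m (j (2*k+δ)) : ℝ)^3) := by field_simp
      _ ≤ _ := by linarith
  have hE0 : 0 ≤ E := by rw [hE]; positivity
  have h10 : (Q'.card : ℝ) * E ≤ (P.N r + 1) * E := mul_le_mul_of_nonneg_right hcard hE0
  have h11 : (P.N r + 1 : ℝ) * E ≤ 12 * (1 / (P.mu (t+1) : ℝ)^4) := by
    rw [hE, mul_add]
    have := hε 0
    have := hε 1
    linarith
  have h12 : 132 * (1 / (P.mu (t+1) : ℝ)^4) * ∑ q ∈ Q', (1/2:ℝ)^(c q - (t+1)) ≤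
      132 * (1 / (P.mu (t+1) : ℝ)^4) * 2 := mul_le_mul_of_nonneg_left hgs (by linarith)
  linarith

/-- the upper estimate -/
theorem upper (M : Main P j s y p) (t : ℕ) (g : FF) (hg : InW P g) (A : Finset ℕ)
    (hA : ∀ k ∈ A, 1 / (P.mu (t+1) : ℝ)^2 < |pr g (y (2*k+1) - y (2*k))|) : 2 * A.card ≤ P.N t := by
  have hmu := P.muR (t+1)
  have h0 : (0:ℝ) < 1 / (P.mu (t+1) : ℝ)^2 := by positivity
  have key := count_lemma (P := P) M.wsucc (θ := 1 / (P.mu (t+1) : ℝ)^2) (C := 132) h0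
    (L := t+1) (R := t+10) (D := P.n t + t + 1)
    (fun i hi => by have := P.n_mono (show i ≤ t by omega); omega) (by omega)
    (fun g hg k => by
      have := M.w_le k ((M.isY _).h1 g hg) ((M.isY _).h1 g hg)
      linarith)
    (fun i hi g hg A hA => M.Ha t i hi g hg A hA)
    (fun r d c g a b hsp A hA => M.Hb t r d c g a b hsp A hA)
    (140 * P.mu (t+1)^2) (1 / (P.mu (t+1) : ℝ)^2) le_rfl (by
      have h1 := one_add_mul_le_pow (a := (33/16:ℝ)) (by norm_num) (70 * P.mu (t+1)^2)
      have h2 : ((7/4:ℝ))^(140 * P.mu (t+1)^2) = (1 + 33/16)^(70 * P.mu (t+1)^2) := by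
        have : (1:ℝ) + 33/16 = (7/4)^2 := by norm_num
        rw [this, ← pow_mul]; congr 1; ring
      rw [h2, one_div, inv_mul_eq_div, le_div_iff₀ (by positivity)]
      push_cast at h1
      nlinarith [sq_nonneg (P.mu (t+1) : ℝ)]) g hg A hA
  have := P.hNc t
  omega

lemma w_bound (M : Main P j s y p) (g : FF) (hg : InW P g) (k : ℕ) : |pr g (y (2*k+1) - y (2*k))| ≤ 132 := by
  have := M.w_le k ((M.isY _).h1 g hg) ((M.isY _).h1 g hg)
  linarith

end Main
end GM


namespace GM
variable {P : Par}

lemma Par.mu_two (P : Par) (e : ℕ) : 256 * 2^e ≤ P.mu e := by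
  induction e with
  | zero => simpa using P.hmu0
  | succ e ih =>
    have h1 := P.mu_pos e
    have : 2 * P.mu e ≤ P.mu (e+1) := by
      rw [P.hmu, P.hm, ← pow_mul]
      calc 2 * P.mu e ≤ P.mu e * P.mu e := by gcongr; omega
        _ = P.mu e ^ 2 := by ring
        _ ≤ _ := Nat.pow_le_pow_right (by omega) (by norm_num)
    rw [pow_succ]
    linarith

lemma Par.mu_half (P : Par) (e : ℕ) : 2 / (P.mu e : ℝ) ≤ (1/2)^e := by
  have h := P.mu_two e
  have h1 : (256 * 2^e : ℝ) ≤ P.mu e := by exact_mod_cast h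
  have h2 : (0:ℝ) < 2^e := by positivity
  rw [one_div_pow, div_le_div_iff₀ (by linarith) h2]
  linarith

namespace Main
variable {j s : ℕ → ℕ} {y : ℕ → VV} {p : ℕ → FF}

lemma est_level (M : Main P j s y p) (a : ℕ → ℝ) (S : Finset ℕ) (δ : ℕ) (hδ : δ < 2) (g : FF) (hg : InW P g) (T : ℕ) :
    ∑ k ∈ S.filter (fun k => 1 / (P.mu (T+1) : ℝ)^2 < |pr g (y (2*k+1) - y (2*k))|),
      |a k| * |pr g (y (2*k+1) - y (2*k))| ≤
      (264 * P.mu 0 + 1 - (1/2)^T) * nrm P (∑ k ∈ S, a k • y (2*k+δ)) := by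
  classical
  obtain ⟨Nn, hN⟩ : ∃ Nn, Nn = nrm P (∑ k ∈ S, a k • y (2*k+δ)) := ⟨_, rfl⟩
  have hN0 : 0 ≤ Nn := hN ▸ nrm_nonneg _
  rw [← hN]
  have hlow : ∀ T, ∑ k ∈ S.filter (fun k => 1 / (P.mu (T+1) : ℝ)^2 < |pr g (y (2*k+1) - y (2*k))|),
      |a k| ≤ 2 * P.mu T * Nn := by
    intro T
    rw [hN]
    apply M.low _ S (Finset.filter_subset _ _) a T δ hδ
    exact M.upper T g hg _ fun k hk => (Finset.mem_filter.1 hk).2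
  induction T with
  | zero =>
    calc _ ≤ ∑ k ∈ S.filter (fun k => 1 / (P.mu (0+1) : ℝ)^2 < |pr g (y (2*k+1) - y (2*k))|),
          |a k| * 132 := Finset.sum_le_sum fun k _ =>
            mul_le_mul_of_nonneg_left (M.w_bound g hg k) (abs_nonneg _)
      _ = (∑ k ∈ S.filter (fun k => 1 / (P.mu (0+1) : ℝ)^2 < |pr g (y (2*k+1) - y (2*k))|),
          |a k|) * 132 := by rw [Finset.sum_mul]
      _ ≤ 2 * P.mu 0 * Nn * 132 := by gcongr; exact hlow 0
      _ ≤ _ := by apply le_of_eq; ring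
  | succ T ih =>
    rw [← Finset.sum_filter_add_sum_filter_not _
      (fun k => 1 / (P.mu (T+1) : ℝ)^2 < |pr g (y (2*k+1) - y (2*k))|)]
    have hmu := P.muR (T+1)
    have h1 : ∑ k ∈ (S.filter (fun k => 1 / (P.mu (T+1+1) : ℝ)^2 < |pr g (y (2*k+1) - y (2*k))|)).filter
        (fun k => 1 / (P.mu (T+1) : ℝ)^2 < |pr g (y (2*k+1) - y (2*k))|),
        |a k| * |pr g (y (2*k+1) - y (2*k))| ≤ (264 * P.mu 0 + 1 - (1/2)^T) * Nn := by
      refine le_trans ?_ ih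
      apply Finset.sum_le_sum_of_subset_of_nonneg
      · intro k hk
        simp only [Finset.mem_filter] at hk ⊢
        exact ⟨hk.1.1, hk.2⟩
      · intros; positivity
    have h2 : ∑ k ∈ (S.filter (fun k => 1 / (P.mu (T+1+1) : ℝ)^2 < |pr g (y (2*k+1) - y (2*k))|)).filter
        (fun k => ¬ 1 / (P.mu (T+1) : ℝ)^2 < |pr g (y (2*k+1) - y (2*k))|),
        |a k| * |pr g (y (2*k+1) - y (2*k))| ≤ (1/2)^(T+1) * Nn := by
      calc _ ≤ ∑ k ∈ (S.filter (fun k => 1 / (P.mu (T+1+1) : ℝ)^2 < |pr g (y (2*k+1) - y (2*k))|)).filter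
              (fun k => ¬ 1 / (P.mu (T+1) : ℝ)^2 < |pr g (y (2*k+1) - y (2*k))|),
              |a k| * (1 / (P.mu (T+1) : ℝ)^2) := Finset.sum_le_sum fun k hk =>
                mul_le_mul_of_nonneg_left (not_lt.1 (Finset.mem_filter.1 hk).2) (abs_nonneg _)
        _ ≤ ∑ k ∈ (S.filter (fun k => 1 / (P.mu (T+1+1) : ℝ)^2 < |pr g (y (2*k+1) - y (2*k))|)),
              |a k| * (1 / (P.mu (T+1) : ℝ)^2) :=
            Finset.sum_le_sum_of_subset_of_nonneg (Finset.filter_subset _ _) (by intros; positivity)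
        _ = (∑ k ∈ (S.filter (fun k => 1 / (P.mu (T+1+1) : ℝ)^2 < |pr g (y (2*k+1) - y (2*k))|)),
              |a k|) * (1 / (P.mu (T+1) : ℝ)^2) := by rw [Finset.sum_mul]
        _ ≤ 2 * P.mu (T+1) * Nn * (1 / (P.mu (T+1) : ℝ)^2) := by gcongr; exact hlow (T+1)
        _ = 2 / P.mu (T+1) * Nn := by field_simp
        _ ≤ _ := by gcongr; exact P.mu_half (T+1)
    have e : (1/2:ℝ)^(T+1) = (1/2)^T * (1/2) := pow_succ _ _
    have hexp : (264 * (P.mu 0:ℝ) + 1 - (1/2)^(T+1)) * Nn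
        = (264 * P.mu 0 + 1 - (1/2)^T) * Nn + (1/2)^(T+1) * Nn := by rw [e]; ring
    rw [hexp]; linarith

/-- estimate for part (b) -/
theorem est_b (M : Main P j s y p) (a : ℕ → ℝ) (S : Finset ℕ) (δ : ℕ) (hδ : δ < 2) :
    nrm P (∑ k ∈ S, a k • (y (2*k+1) - y (2*k))) ≤
      (264 * P.mu 0 + 1) * nrm P (∑ k ∈ S, a k • y (2*k+δ)) := by
  classical
  apply nrm_le
  intro g hg
  obtain ⟨Nn, hN⟩ : ∃ Nn, Nn = nrm P (∑ k ∈ S, a k • y (2*k+δ)) := ⟨_, rfl⟩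
  have hN0 : 0 ≤ Nn := hN ▸ nrm_nonneg _
  have h0 : |pr g (∑ k ∈ S, a k • (y (2*k+1) - y (2*k)))| ≤
      ∑ k ∈ S, |a k| * |pr g (y (2*k+1) - y (2*k))| := by
    rw [map_sum]
    refine (Finset.abs_sum_le_sum_abs _ _).trans (le_of_eq ?_)
    apply Finset.sum_congr rfl
    intro k _
    rw [map_smul, smul_eq_mul, abs_mul]
  refine h0.trans ?_
  have h1 : ∀ T : ℕ, ∑ k ∈ S, |a k| * |pr g (y (2*k+1) - y (2*k))| ≤
      (264 * P.mu 0 + 1) * Nn + (1/2)^T * ∑ k ∈ S, |a k| := by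
    intro T
    rw [← Finset.sum_filter_add_sum_filter_not S
      (fun k => 1 / (P.mu (T+1) : ℝ)^2 < |pr g (y (2*k+1) - y (2*k))|)]
    have h2 := M.est_level a S δ hδ g hg T
    rw [← hN] at h2
    have hmu := P.muR (T+1)
    have h3 : 1 / (P.mu (T+1) : ℝ)^2 ≤ (1/2)^T := by
      have h4 := P.mu_half (T+1)
      have h5 : 1 / (P.mu (T+1) : ℝ)^2 ≤ 2 / P.mu (T+1) := by
        rw [div_le_div_iff₀ (by positivity) (by positivity)]; nlinarith
      have h6 : (1/2:ℝ)^(T+1) ≤ (1/2)^T := by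
        rw [pow_succ]; have : (0:ℝ) < (1/2)^T := by positivity
        linarith
      linarith
    have h4 : ∑ k ∈ S.filter (fun k => ¬ 1 / (P.mu (T+1) : ℝ)^2 < |pr g (y (2*k+1) - y (2*k))|),
        |a k| * |pr g (y (2*k+1) - y (2*k))| ≤ (1/2)^T * ∑ k ∈ S, |a k| := by
      rw [Finset.mul_sum]
      calc _ ≤ ∑ k ∈ S.filter (fun k => ¬ 1 / (P.mu (T+1) : ℝ)^2 < |pr g (y (2*k+1) - y (2*k))|),
            (1/2)^T * |a k| := Finset.sum_le_sum fun k hk => by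
              rw [mul_comm]
              exact mul_le_mul_of_nonneg_right ((not_lt.1 (Finset.mem_filter.1 hk).2).trans h3) (abs_nonneg _)
        _ ≤ _ := Finset.sum_le_sum_of_subset_of_nonneg (Finset.filter_subset _ _) (by intros; positivity)
    have h5 : (0:ℝ) ≤ (1/2)^T * Nn := by positivity
    linarith
  rw [← hN]
  have h2 : Filter.Tendsto (fun T : ℕ => (264 * P.mu 0 + 1) * Nn + (1/2)^T * ∑ k ∈ S, |a k|)
      Filter.atTop (nhds ((264 * P.mu 0 + 1) * Nn + 0 * ∑ k ∈ S, |a k|)) :=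
    ((tendsto_pow_atTop_nhds_zero_of_lt_one (by norm_num) (by norm_num)).mul_const _).const_add _
  rw [zero_mul, add_zero] at h2
  exact ge_of_tendsto' h2 h1

/-- estimate for part (a) -/
theorem est_a (M : Main P j s y p) (r : ℕ) : ∃ Q : ℕ, (P.mu (r+1) : ℝ)^2 ≤ Q ∧
    nrm P (∑ k ∈ Finset.range Q, (y (2*k+1) - y (2*k))) ≤ 67 * Q / (P.mu (r+1) : ℝ)^2 ∧
    2 * Q / (P.mu (r+1) : ℝ) ≤ nrm P (∑ k ∈ Finset.range Q, (y (2*k) + y (2*k+1))) := by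
  classical
  have hmu := P.muR (r+1)
  have hQ : P.mu (r+1)^2 * (P.N r + 1) ≤ P.N (r+1) / 2 := by
    rw [Nat.le_div_iff_mul_le (by norm_num)]
    refine le_trans ?_ ((P.k_ge_N r).trans ((P.k_le_n _).trans (P.hNn _)))
    have h1 := P.mu_pos (r+1)
    calc P.mu (r+1)^2 * (P.N r + 1) * 2 = (P.mu (r+1)^2 * 2) * (P.N r + 1) := by ring
      _ ≤ P.m (r+1) ^ 4 * (P.N r + 1) := by
        gcongr
        rw [P.hm, ← pow_mul]
        calc P.mu (r+1)^2 * 2 ≤ P.mu (r+1)^2 * P.mu (r+1) := by gcongr; omega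
          _ = P.mu (r+1)^3 := by ring
          _ ≤ _ := Nat.pow_le_pow_right (by omega) (by norm_num)
  refine ⟨P.N (r+1) / 2, ?_, ?_, M.low_sum _ _ (by omega)⟩
  · have : P.mu (r+1)^2 ≤ P.N (r+1)/2 := le_trans (Nat.le_mul_of_pos_right _ (by omega)) hQ
    exact_mod_cast this
  obtain ⟨Q, hQd⟩ : ∃ Q, Q = P.N (r+1) / 2 := ⟨_, rfl⟩
  rw [← hQd] at hQ ⊢
  have hQR : (P.mu (r+1) : ℝ)^2 * (P.N r + 1) ≤ Q := by exact_mod_cast hQ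
  apply nrm_le
  intro g hg
  have hcard := M.upper r g hg ((Finset.range Q).filter (fun k =>
    1 / (P.mu (r+1) : ℝ)^2 < |pr g (y (2*k+1) - y (2*k))|)) fun k hk => (Finset.mem_filter.1 hk).2
  have hcR : 2 * ((((Finset.range Q).filter (fun k =>
    1 / (P.mu (r+1) : ℝ)^2 < |pr g (y (2*k+1) - y (2*k))|)).card : ℕ) : ℝ) ≤ P.N r := by exact_mod_cast hcard
  rw [map_sum]
  refine (Finset.abs_sum_le_sum_abs _ _).trans ?_
  rw [← Finset.sum_filter_add_sum_filter_not (Finset.range Q)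
      (fun k => 1 / (P.mu (r+1) : ℝ)^2 < |pr g (y (2*k+1) - y (2*k))|)]
  have h1 := Finset.sum_le_card_nsmul ((Finset.range Q).filter (fun k =>
    1 / (P.mu (r+1) : ℝ)^2 < |pr g (y (2*k+1) - y (2*k))|)) (fun k => |pr g (y (2*k+1) - y (2*k))|) 132
    (fun k _ => M.w_bound g hg k)
  have h2 : ∑ k ∈ (Finset.range Q).filter (fun k =>
      ¬ 1 / (P.mu (r+1) : ℝ)^2 < |pr g (y (2*k+1) - y (2*k))|), |pr g (y (2*k+1) - y (2*k))| ≤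
      Q * (1 / (P.mu (r+1) : ℝ)^2) := by
    calc _ ≤ ∑ k ∈ (Finset.range Q).filter (fun k =>
          ¬ 1 / (P.mu (r+1) : ℝ)^2 < |pr g (y (2*k+1) - y (2*k))|), 1 / (P.mu (r+1) : ℝ)^2 :=
          Finset.sum_le_sum fun k hk => not_lt.1 (Finset.mem_filter.1 hk).2
      _ ≤ ∑ k ∈ Finset.range Q, 1 / (P.mu (r+1) : ℝ)^2 :=
          Finset.sum_le_sum_of_subset_of_nonneg (Finset.filter_subset _ _) (by intros; positivity)
      _ = _ := by simp
  rw [nsmul_eq_mul] at h1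
  have h3 : (P.N r : ℝ) ≤ Q / (P.mu (r+1) : ℝ)^2 := by
    rw [le_div_iff₀ (by positivity)]
    have : 0 ≤ (P.mu (r+1) : ℝ)^2 := by positivity
    linarith
  have h4 : 67 * (Q:ℝ) / (P.mu (r+1) : ℝ)^2 = 66 * (Q / (P.mu (r+1) : ℝ)^2) + Q * (1 / (P.mu (r+1) : ℝ)^2) := by
    ring
  rw [h4]
  linarith

end Main
end GM


namespace GM
variable {P : Par}

section unc
variable {E : Type*} [NormedAddCommGroup E] [NormedSpace ℝ E]

/-- unconditionality with constant `C` -/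
def Unc (C : ℝ) (x : ℕ → E) : Prop :=
  ∀ (a εs : ℕ → ℝ), (∀ n, εs n = 1 ∨ εs n = -1) →
    ∀ s : Finset ℕ, ‖∑ n ∈ s, (εs n * a n) • x n‖ ≤ C * ‖∑ n ∈ s, a n • x n‖

lemma Unc.blocks {C : ℝ} {x : ℕ → E} (h : Unc C x) (T : ℕ → Finset ℕ)
    (hT : ∀ n n' i, i ∈ T n → i ∈ T n' → n = n') (c : ℕ → ℕ → ℝ) :
    Unc C (fun n => ∑ i ∈ T n, c n i • x i) := by
  classical
  intro a ε hε s
  have hex : ∀ i, ∃ n, ∀ n', i ∈ T n' → n = n' := by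
    intro i
    by_cases hi : ∃ n, i ∈ T n
    · obtain ⟨n, hn⟩ := hi
      exact ⟨n, fun n' hn' => hT n n' i hn hn'⟩
    · exact ⟨0, fun n' hn' => absurd ⟨n', hn'⟩ hi⟩
  choose ν hν using hex
  have key : ∀ b : ℕ → ℝ, ∑ n ∈ s, b n • ∑ i ∈ T n, c n i • x i
      = ∑ i ∈ s.biUnion T, (b (ν i) * c (ν i) i) • x i := by
    intro b
    rw [Finset.sum_biUnion]
    · apply Finset.sum_congr rfl
      intro n _
      rw [Finset.smul_sum]
      apply Finset.sum_congr rfl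
      intro i hi
      rw [hν i n hi, smul_smul]
    · intro n _ n' _ hne
      rw [Function.onFun, Finset.disjoint_left]
      intro i hi hi'
      exact hne (hT n n' i hi hi')
  have := h (fun i => a (ν i) * c (ν i) i) (fun i => ε (ν i)) (fun i => hε _) (s.biUnion T)
  rw [key a, key (fun n => ε n * a n)]
  simpa only [mul_assoc] using this

lemma linInd_of_basic {x : ℕ → E} {K : ℝ} (hne : ∀ n, x n ≠ 0)
    (hK : ∀ (a : ℕ → ℝ) (m n : ℕ), m ≤ n →
    ‖∑ i ∈ Finset.range m, a i • x i‖ ≤ K * ‖∑ i ∈ Finset.range n, a i • x i‖) :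
    LinearIndependent ℝ x := by
  classical
  rw [linearIndependent_iff']
  intro s g hg i hi
  have hs : s ⊆ Finset.range (s.sup id + 1) := fun k hk =>
    Finset.mem_range.2 (Nat.lt_succ_of_le (Finset.le_sup (f := id) hk))
  have h0 : ∑ k ∈ Finset.range (s.sup id + 1), (if k ∈ s then g k else 0) • x k = 0 := by
    rw [← hg, ← Finset.sum_subset hs]
    · apply Finset.sum_congr rfl; intro k hk; simp [hk]
    · intro k _ hk; simp [hk]
  have h1 : ∀ m ≤ s.sup id + 1, ∑ k ∈ Finset.range m, (if k ∈ s then g k else 0) • x k = 0 := by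
    intro m hm
    have := hK (fun k => if k ∈ s then g k else 0) m _ hm
    rw [h0, norm_zero, mul_zero] at this
    exact norm_le_zero_iff.1 this
  have hi' := Finset.mem_range.1 (hs hi)
  have h2 := h1 (i+1) (by omega)
  rw [Finset.sum_range_succ, h1 i (by omega), zero_add, if_pos hi] at h2
  exact (smul_eq_zero.1 h2).resolve_right (hne i)

end unc

/-- coordinate functional on the ambient space -/
noncomputable def coo (P : Par) (i : ℕ) : LL P →ₗ[ℝ] ℝ where
  toFun x := x ⟨Finsupp.single i 1, ⟨_, Wt.unit i 1 (Or.inl rfl)⟩⟩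
  map_add' _ _ := rfl
  map_smul' _ _ := rfl

lemma coo_le (i : ℕ) (x : LL P) : |coo P i x| ≤ ‖x‖ :=
  lp.norm_apply_le_norm (by simp) x _

lemma coo_iota (i : ℕ) (x : VV) : coo P i (iota P x) = x i := by
  have h2 : pr (Finsupp.single i 1) x = x i := by
    rw [pr_eq_sum _ x (s := insert i x.support) (by simp)]
    rw [Finset.sum_eq_single i]
    · simp
    · intro b _ hb; rw [Finsupp.single_apply, if_neg (Ne.symm hb)]; simp
    · simp
  exact h2

lemma nrm_single (i : ℕ) (a : ℝ) : nrm P (Finsupp.single i a) ≤ |a| := by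
  apply nrm_le
  rintro f ⟨τ, hf⟩
  rw [pr_single, abs_mul]
  have : |(f i : ℝ)| ≤ 1 := by exact_mod_cast hf.abs_le i
  nlinarith [abs_nonneg a]

lemma step {x : ℕ → LL P} (hx : ∀ n, x n ∈ (LinearMap.range (iota P)).topologicalClosure)
    (hli : LinearIndependent ℝ x) (M n0 : ℕ) {δ : ℝ} (hδ : 0 < δ) :
    ∃ (G : Finset ℕ) (c : ℕ → ℝ) (v : VV), (∀ i ∈ G, n0 ≤ i) ∧ ‖∑ i ∈ G, c i • x i‖ = 1 ∧
      (∀ i, v i ≠ 0 → M ≤ i) ∧ ‖∑ i ∈ G, c i • x i - iota P v‖ ≤ δ := by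
  classical
  let L : (Fin (M+1) → ℝ) →ₗ[ℝ] (Fin M → ℝ) :=
    (LinearMap.pi fun i : Fin M => coo P i).comp
      (Fintype.linearCombination ℝ (fun k : Fin (M+1) => x (n0 + k)))
  have hker : LinearMap.ker L ≠ ⊥ := LinearMap.ker_ne_bot_of_finrank_lt (by simp)
  obtain ⟨a, ha, ha0⟩ := (Submodule.ne_bot_iff _).1 hker
  have hli' : LinearIndependent ℝ (fun k : Fin (M+1) => x (n0 + k)) :=
    hli.comp (fun k : Fin (M+1) => n0 + (k:ℕ)) (fun i j h => Fin.ext (by simpa using h))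
  obtain ⟨w, hw⟩ : ∃ w, w = ∑ k : Fin (M+1), a k • x (n0 + k) := ⟨_, rfl⟩
  have hw0 : w ≠ 0 := by
    intro h
    apply ha0
    funext k
    exact Fintype.linearIndependent_iff.1 hli' a (by rw [← hw, h]) k
  have hwc : ∀ i < M, coo P i w = 0 := by
    intro i hi
    have := congrFun (LinearMap.mem_ker.1 ha) ⟨i, hi⟩
    rw [hw]
    simpa [L, Fintype.linearCombination_apply] using this
  have hwn : 0 < ‖w‖ := norm_pos_iff.2 hw0
  let a' : ℕ → ℝ := fun k => if h : k < M+1 then a ⟨k, h⟩ else 0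
  have hsum : ∑ i ∈ Finset.Ico n0 (n0 + (M+1)), (‖w‖⁻¹ * a' (i - n0)) • x i = ‖w‖⁻¹ • w := by
    rw [Finset.sum_Ico_eq_sum_range, hw, Finset.smul_sum]
    simp only [Nat.add_sub_cancel_left]
    rw [← Fin.sum_univ_eq_sum_range (fun k => (‖∑ k : Fin (M+1), a k • x (n0 + k)‖⁻¹ * a' k) • x (n0 + k))]
    apply Finset.sum_congr rfl
    intro k _
    rw [mul_smul]
    have : a' k = a k := by simp only [a']; rw [dif_pos k.2]
    rw [this]
  have hmem : ‖w‖⁻¹ • w ∈ (LinearMap.range (iota P)).topologicalClosure := by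
    rw [← hsum]
    exact Submodule.sum_mem _ fun i _ => Submodule.smul_mem _ _ (hx i)
  have hδ' : 0 < δ / (M + 1) := by positivity
  obtain ⟨_, ⟨v', rfl⟩, hv'⟩ := Metric.mem_closure_iff.1 hmem _ hδ'
  rw [dist_eq_norm] at hv'
  have hco : ∀ i < M, |v' i| ≤ δ / (M+1) := by
    intro i hi
    have h1 := coo_le i (‖w‖⁻¹ • w - iota P v')
    rw [map_sub, map_smul, hwc i hi, coo_iota] at h1
    simp only [smul_zero, zero_sub, abs_neg] at h1
    linarith
  refine ⟨Finset.Ico n0 (n0 + (M+1)), fun i => ‖w‖⁻¹ * a' (i - n0),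
    v' - ∑ i ∈ Finset.range M, Finsupp.single i (v' i), ?_, ?_, ?_, ?_⟩
  · intro i hi; exact (Finset.mem_Ico.1 hi).1
  · rw [hsum, norm_smul, norm_inv, norm_norm]; field_simp
  · intro i hi
    by_contra hc
    apply hi
    rw [Finsupp.sub_apply, Finsupp.finsetSum_apply, Finset.sum_eq_single i]
    · simp
    · intro b _ hb; rw [Finsupp.single_apply, if_neg hb]
    · intro h; simp at h; omega
  · rw [hsum, map_sub]
    have h1 : ‖iota P (∑ i ∈ Finset.range M, Finsupp.single i (v' i))‖ ≤ M * (δ / (M+1)) := by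
      rw [map_sum]
      refine (norm_sum_le _ _).trans ?_
      calc _ ≤ ∑ i ∈ Finset.range M, δ / ((M:ℝ)+1) := Finset.sum_le_sum fun i hi =>
            (nrm_single i _).trans (hco i (Finset.mem_range.1 hi))
        _ = _ := by simp
    have h2 : ‖w‖⁻¹ • w - (iota P v' - iota P (∑ i ∈ Finset.range M, Finsupp.single i (v' i)))
      = (‖w‖⁻¹ • w - iota P v') + iota P (∑ i ∈ Finset.range M, Finsupp.single i (v' i)) := by abel
    rw [h2]
    refine (norm_add_le _ _).trans ?_
    have h3 : δ = δ / (M+1) + M * (δ / (M+1)) := by field_simp; ring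
    linarith

lemma sum_pairs {E : Type*} [AddCommMonoid E] (f : ℕ → E) (Q : ℕ) :
    ∑ n ∈ Finset.range (2*Q), f n = ∑ k ∈ Finset.range Q, (f (2*k) + f (2*k+1)) := by
  induction Q with
  | zero => simp
  | succ Q ih =>
    rw [Finset.sum_range_succ, ← ih, show 2*(Q+1) = 2*Q+1+1 by ring, Finset.sum_range_succ,
      Finset.sum_range_succ, add_assoc]

lemma geo_fin (S : Finset ℕ) : ∑ k ∈ S, (1/2:ℝ)^k ≤ 2 := by
  have := summable_geometric_two.sum_le_tsum S (fun i _ => by positivity)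
  rwa [tsum_geometric_two] at this

/-- approximating block sequence -/
lemma exists_approx {x : ℕ → LL P}
    (hx : ∀ n, x n ∈ (LinearMap.range (iota P)).topologicalClosure)
    (hli : LinearIndependent ℝ x) :
    ∃ (G : ℕ → Finset ℕ) (c : ℕ → ℕ → ℝ) (v : ℕ → VV),
      (∀ n n' i, i ∈ G n → i ∈ G n' → n = n') ∧ Blk v ∧ (∀ n, 3/4 < nrm P (v n)) ∧
      ∀ n, ‖∑ i ∈ G n, c n i • x i - iota P (v n)‖ ≤ (1/2)^n / 1000 := by
  obtain ⟨F, hF⟩ := exists_seq (α := Finset ℕ × (ℕ → ℝ) × VV) (fun l p =>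
    ‖∑ i ∈ p.1, p.2.1 i • x i‖ = 1 ∧
    ‖∑ i ∈ p.1, p.2.1 i • x i - iota P p.2.2‖ ≤ (1/2)^l.length / 1000 ∧
    (∀ p' ∈ l, ∀ i ∈ p'.1, ∀ i' ∈ p.1, i < i') ∧
    (∀ p' ∈ l, ∀ i i', p'.2.2 i ≠ 0 → p.2.2 i' ≠ 0 → i < i')) (by
    intro l
    obtain ⟨G, c, v, h1, h2, h3, h4⟩ := step hx hli (l.map (fun p => hi p.2.2)).sum
      (l.map (fun p => p.1.sup id + 1)).sum (δ := (1/2)^l.length / 1000) (by positivity)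
    refine ⟨⟨G, c, v⟩, h2, h4, ?_, ?_⟩
    · intro p' hp' i hi1 i' hi1'
      have := List.single_le_sum (l := l.map (fun p => p.1.sup id + 1)) (by simp) (p'.1.sup id + 1)
        (List.mem_map.2 ⟨p', hp', rfl⟩)
      have h5 := Finset.le_sup (f := id) hi1
      have := h1 i' hi1'
      simp only [id] at h5
      omega
    · intro p' hp' i i' hi1 hi1'
      have := List.single_le_sum (l := l.map (fun p => hi p.2.2)) (by simp) (hi p'.2.2)
        (List.mem_map.2 ⟨p', hp', rfl⟩)
      have := lt_hi hi1
      have := h3 i' hi1'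
      omega)
  have hsG : ∀ n n', n < n' → ∀ i ∈ (F n).1, ∀ i' ∈ (F n').1, i < i' := fun n n' h =>
    (hF n').2.2.1 (F n) (List.mem_map.2 ⟨n, by simpa using h, rfl⟩)
  have hd : ∀ n, ‖∑ i ∈ (F n).1, (F n).2.1 i • x i - iota P (F n).2.2‖ ≤ (1/2)^n / 1000 := by
    intro n; have := (hF n).2.1; simpa using this
  have hn : ∀ n, 3/4 < nrm P (F n).2.2 := by
    intro n
    have h1 := hd n
    have h2 : (1/2:ℝ)^n ≤ 1 := pow_le_one₀ (by norm_num) (by norm_num)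
    have h3 := norm_sub_norm_le (∑ i ∈ (F n).1, (F n).2.1 i • x i) (iota P (F n).2.2)
    rw [(hF n).1] at h3
    rw [nrm]; linarith
  refine ⟨fun n => (F n).1, fun n => (F n).2.1, fun n => (F n).2.2, ?_, ⟨?_, ?_⟩, hn, hd⟩
  · intro n n' i h h'
    by_contra hc
    rcases lt_or_gt_of_ne hc with h1 | h1
    · exact lt_irrefl _ (hsG n n' h1 i h i h')
    · exact lt_irrefl _ (hsG n' n h1 i h' i h)
  · intro n n' h
    exact (hF n').2.2.2 (F n) (List.mem_map.2 ⟨n, by simpa using h, rfl⟩)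
  · intro n h0
    have := hn n
    simp only at h0
    rw [h0] at this
    simp [nrm] at this
    linarith

theorem no_uncond {x : ℕ → LL P}
    (hx : ∀ n, x n ∈ (LinearMap.range (iota P)).topologicalClosure)
    (hli : LinearIndependent ℝ x) {C : ℝ} (hC : 1 ≤ C) (hU : Unc C x) : False := by
  classical
  obtain ⟨G, c, v, hG, hv, hvn, happ⟩ := exists_approx hx hli
  obtain ⟨j, s, y, p, M, hspan⟩ := exists_main (P := P) hv
  have h1 : ∀ n, ∃ β : ℕ →₀ ℝ, y n = ∑ k ∈ β.support, β k • v k := by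
    intro n
    obtain ⟨β, hβ⟩ := Finsupp.mem_span_range_iff_exists_finsupp.1 (hspan n)
    exact ⟨β, hβ.symm⟩
  choose β hβ using h1
  have hb1 : ∀ n k, |β n k| ≤ 88 := by
    intro n k
    obtain ⟨f, hf, hlt⟩ := exists_lt_pr (hvn k)
    have h2 := (M.isY n).h1 _ (hf.res (lo (v k)) (hi (v k)))
    rw [hβ n, map_sum] at h2
    simp only [map_smul, smul_eq_mul, diag_pr hv.1 hv.2] at h2
    by_cases hk : k ∈ (β n).support
    · rw [Finset.sum_eq_single k] at h2
      · rw [if_pos rfl, abs_mul, abs_of_pos (by linarith : 0 < pr f (v k))] at h2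
        nlinarith [abs_nonneg (β n k)]
      · intro b _ hb; rw [if_neg hb, mul_zero]
      · intro h; exact absurd hk h
    · simp at hk; simp [hk]
  have hcoord : ∀ n k, k ∈ (β n).support → y n (lo (v k)) ≠ 0 := by
    intro n k hk
    rw [hβ n, Finsupp.finsetSum_apply, Finset.sum_eq_single k]
    · rw [Finsupp.smul_apply, smul_eq_mul]
      exact mul_ne_zero (by simpa using hk) (exists_lo (hv.2 k))
    · intro b _ hb
      rw [Finsupp.smul_apply, smul_eq_mul]
      by_contra h0
      have h3 := right_ne_zero_of_mul h0
      rcases lt_or_gt_of_ne hb with h | h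
      · exact lt_irrefl _ (hv.1 b k h _ _ h3 (exists_lo (hv.2 k)))
      · exact lt_irrefl _ (hv.1 k b h _ _ (exists_lo (hv.2 k)) h3)
    · intro h; exact absurd hk h
  have hdisj : ∀ n n' k, k ∈ (β n).support → k ∈ (β n').support → n = n' := by
    intro n n' k h h'
    by_contra hc
    rcases lt_or_gt_of_ne hc with h1 | h1
    · exact lt_irrefl _ (M.blk.1 n n' h1 _ _ (hcoord _ _ h) (hcoord _ _ h'))
    · exact lt_irrefl _ (M.blk.1 n' n h1 _ _ (hcoord _ _ h') (hcoord _ _ h))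
  obtain ⟨u, hu⟩ : ∃ u : ℕ → LL P, u = fun n => ∑ i ∈ G n, c n i • x i := ⟨_, rfl⟩
  obtain ⟨U, hUd⟩ : ∃ U : ℕ → LL P, U = fun n => ∑ k ∈ (β n).support, β n k • u k := ⟨_, rfl⟩
  have hUu : Unc C u := by rw [hu]; exact hU.blocks G hG c
  have hUU : Unc C U := by rw [hUd]; exact hUu.blocks _ hdisj (fun n k => β n k)
  have hud : ∀ k, ‖u k - iota P (v k)‖ ≤ (1/2)^k / 1000 := by intro k; rw [hu]; exact happ k
  have hUy : ∀ n, ‖U n - iota P (y n)‖ ≤ ∑ k ∈ (β n).support, 88 * ((1/2)^k / 1000) := by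
    intro n
    have : U n - iota P (y n) = ∑ k ∈ (β n).support, β n k • (u k - iota P (v k)) := by
      rw [hβ n, map_sum, hUd]
      simp only [map_smul, smul_sub, Finset.sum_sub_distrib]
    rw [this]
    refine (norm_sum_le _ _).trans (Finset.sum_le_sum fun k _ => ?_)
    rw [norm_smul]
    exact mul_le_mul (hb1 n k) (hud k) (norm_nonneg _) (by norm_num)
  have htot : ∀ (F : Finset ℕ) (ε : ℕ → ℝ), (∀ n, |ε n| ≤ 1) →
      ‖∑ n ∈ F, ε n • U n - ∑ n ∈ F, ε n • iota P (y n)‖ ≤ 1 := by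
    intro F ε hε
    rw [← Finset.sum_sub_distrib]
    simp only [← smul_sub]
    calc _ ≤ ∑ n ∈ F, ∑ k ∈ (β n).support, 88 * ((1/2:ℝ)^k / 1000) := by
          refine (norm_sum_le _ _).trans (Finset.sum_le_sum fun n _ => ?_)
          rw [norm_smul]
          refine le_trans ?_ (hUy n)
          exact mul_le_of_le_one_left (norm_nonneg _) (hε n)
      _ = ∑ k ∈ F.biUnion (fun n => (β n).support), 88 * ((1/2:ℝ)^k / 1000) := by
          rw [Finset.sum_biUnion]
          intro n _ n' _ hne
          rw [Function.onFun, Finset.disjoint_left]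
          intro i hi hi'
          exact hne (hdisj n n' i hi hi')
      _ = 88 / 1000 * ∑ k ∈ F.biUnion (fun n => (β n).support), (1/2:ℝ)^k := by
          rw [Finset.mul_sum]; apply Finset.sum_congr rfl; intros; ring
      _ ≤ 88 / 1000 * 2 := by gcongr; exact geo_fin _
      _ ≤ 1 := by norm_num
  obtain ⟨r, hr⟩ := exists_nat_gt (68 * C)
  obtain ⟨Q, hQ1, hQ2, hQ3⟩ := M.est_a r
  have hmur : (r:ℝ) ≤ P.mu (r+1) := by
    have := P.mu_strict.le_apply (x := r+1)
    have : r ≤ P.mu (r+1) := by omega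
    exact_mod_cast this
  have hmu := P.muR (r+1)
  obtain ⟨ε, hεd⟩ : ∃ ε : ℕ → ℝ, ε = fun n => if n % 2 = 1 then 1 else -1 := ⟨_, rfl⟩
  have hε : ∀ n, ε n = 1 ∨ ε n = -1 := by
    intro n; rw [hεd]; simp only; split_ifs <;> simp
  have e1 := hUU ε ε hε (Finset.range (2*Q))
  have hεε : ∀ n, ε n * ε n = 1 := by intro n; rcases hε n with h | h <;> rw [h] <;> norm_num
  simp only [hεε] at e1
  have e2 := htot (Finset.range (2*Q)) (fun _ => 1) (by simp)
  have e3 := htot (Finset.range (2*Q)) ε (by intro n; rcases hε n with h | h <;> rw [h] <;> simp)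
  have e4 : ‖∑ n ∈ Finset.range (2*Q), (1:ℝ) • iota P (y n)‖
      = nrm P (∑ k ∈ Finset.range Q, (y (2*k) + y (2*k+1))) := by
    rw [nrm, sum_pairs]; simp
  have e5 : ‖∑ n ∈ Finset.range (2*Q), ε n • iota P (y n)‖
      = nrm P (∑ k ∈ Finset.range Q, (y (2*k+1) - y (2*k))) := by
    rw [nrm, sum_pairs, map_sum]
    congr 1
    apply Finset.sum_congr rfl
    intro k _
    have h1 : ε (2*k) = -1 := by rw [hεd]; simp
    have h2 : ε (2*k+1) = 1 := by rw [hεd]; simp [Nat.add_mod]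
    rw [h1, h2, map_sub, neg_smul, one_smul, one_smul]; abel
  have e6 := norm_sub_norm_le (∑ n ∈ Finset.range (2*Q), (1:ℝ) • iota P (y n))
    (∑ n ∈ Finset.range (2*Q), (1:ℝ) • U n)
  have e7 := norm_sub_norm_le (∑ n ∈ Finset.range (2*Q), ε n • U n)
    (∑ n ∈ Finset.range (2*Q), ε n • iota P (y n))
  rw [norm_sub_rev] at e6
  rw [e4] at e6
  rw [e5] at e7
  obtain ⟨μ, hμ⟩ : ∃ μ : ℝ, μ = P.mu (r+1) := ⟨_, rfl⟩
  rw [← hμ] at hQ1 hQ2 hQ3 hmur hmu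
  have f1 : 2 * Q / μ ≤ 1 + C * (67 * Q / μ^2 + 1) := by
    have : C * ‖∑ n ∈ Finset.range (2*Q), ε n • U n‖ ≤ C * (67 * Q / μ^2 + 1) :=
      mul_le_mul_of_nonneg_left (by linarith) (by linarith)
    linarith
  have hμ0 : 0 < μ := by linarith
  have f2 : 1 ≤ Q / μ^2 := by rw [le_div_iff₀ (by positivity)]; linarith
  have f3 : (Q:ℝ)/μ = Q/μ^2 * μ := by field_simp
  obtain ⟨t, ht⟩ : ∃ t : ℝ, t = Q/μ^2 := ⟨_, rfl⟩
  have f4 : 2 * (Q:ℝ) / μ = 2 * (t * μ) := by rw [ht, ← f3]; ring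
  have f5 : 67 * (Q:ℝ) / μ^2 = 67 * t := by rw [ht]; ring
  rw [f4, f5] at f1
  rw [← ht] at f2
  have f6 : 68 * C < μ := by linarith
  have f7 : t * (68*C) < t * μ := mul_lt_mul_of_pos_left f6 (by linarith)
  have f8 : C * 1 ≤ C * t := mul_le_mul_of_nonneg_left f2 (by linarith)
  nlinarith

end GM

namespace GM

noncomputable def pmu (j : ℕ) : ℕ := 2 ^ (8 * 64 ^ j)
noncomputable def pm (j : ℕ) : ℕ := 2 ^ (64 * 64 ^ j)
noncomputable def pT (j : ℕ) : ℕ := 64 * 64 ^ j + 1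
noncomputable def pN (j n : ℕ) : ℕ := n + 2 * cnt (j+10) (n + j + 1) (140 * pmu (j+1)^2)
noncomputable def pk : ℕ → ℕ
  | 0 => pm 0 ^ 4
  | (j+1) => pm (j+1) ^ 4 * (cnt 1 (pk j ^ pT j + j + 1) (pm (j+1)) + 1) * (pN j (pk j ^ pT j) + 1)

theorem exists_par : Nonempty Par := by
  obtain ⟨g, hg⟩ := exists_surjective_nat (Finset (ℕ × FF))
  exact ⟨{
    mu := pmu
    m := pm
    n := fun j => pk j ^ pT j
    N := fun j => pN j (pk j ^ pT j)
    k := pk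
    T := pT
    H := fun c => g (c / 2).unpair.1
    hmu0 := by norm_num [pmu]
    hm := fun j => by
      rw [pm, pmu, ← pow_mul]; congr 1; ring
    hmu := fun j => by
      rw [pm, pmu, ← pow_mul]; congr 1; ring
    hn := fun j => rfl
    hT := fun j => by rw [pT, pm, pow_succ, mul_comm]
    hk0 := by rw [pk]
    hk := fun j => by rw [pk]
    hNn := fun j => Nat.le_add_right _ _
    hNc := fun j => Nat.le_add_left _ _
    hH := fun S n0 => by
      obtain ⟨i, hi⟩ := hg S
      refine ⟨2 * Nat.pair i n0 + 1, ?_, ⟨_, rfl⟩, ?_⟩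
      · have := Nat.right_le_pair i n0; omega
      · have : (2 * Nat.pair i n0 + 1) / 2 = Nat.pair i n0 := by omega
        simp only [this, Nat.unpair_pair]; exact hi }⟩

variable (P : Par)

/-- the space -/
noncomputable abbrev VX : Submodule ℝ (LL P) := (LinearMap.range (iota P)).topologicalClosure

/-- embedding of finitely supported vectors -/
noncomputable def em : VV →ₗ[ℝ] VX P :=
  (iota P).codRestrict (VX P) fun x => Submodule.le_topologicalClosure _ ⟨x, rfl⟩

variable {P}

lemma norm_em (x : VV) : ‖em P x‖ = nrm P x := rfl

/-- the basis -/
noncomputable def ee (P : Par) (n : ℕ) : VX P := em P (Finsupp.single n 1)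

lemma sum_ee (a : ℕ → ℝ) (s : Finset ℕ) :
    ∑ i ∈ s, a i • ee P i = em P (∑ i ∈ s, Finsupp.single i (a i)) := by
  rw [map_sum]
  apply Finset.sum_congr rfl
  intro i _
  rw [ee, ← map_smul, Finsupp.smul_single, smul_eq_mul, mul_one]

lemma sum_single_apply (a : ℕ → ℝ) (s : Finset ℕ) (i : ℕ) :
    (∑ k ∈ s, Finsupp.single k (a k) : VV) i = if i ∈ s then a i else 0 := by
  classical
  rw [Finsupp.finsetSum_apply]
  simp only [Finsupp.single_apply]
  rw [Finset.sum_ite_eq' ]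

lemma em_eq (x : VV) : em P x = ∑ i ∈ x.support, x i • ee P i := by
  rw [sum_ee]
  congr 1
  ext i
  rw [sum_single_apply]
  split_ifs with h
  · rfl
  · simpa using h

lemma ee_ne (n : ℕ) : ee P n ≠ 0 := by
  intro h
  have h1 : ‖ee P n‖ = 0 := by rw [h, norm_zero]
  rw [ee, norm_em] at h1
  have h2 : (Finsupp.single n 1 : VV) ≠ 0 := by simp
  have := nrm_pos (P := P) h2
  linarith

lemma ee_mono (a : ℕ → ℝ) (m n : ℕ) (h : m ≤ n) :
    ‖∑ i ∈ Finset.range m, a i • ee P i‖ ≤ 1 * ‖∑ i ∈ Finset.range n, a i • ee P i‖ := by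
  rw [one_mul, sum_ee, sum_ee, norm_em, norm_em]
  have : ∑ i ∈ Finset.range m, Finsupp.single i (a i)
      = resV 0 m (∑ i ∈ Finset.range n, Finsupp.single i (a i)) := by
    ext i
    rw [resV_apply, sum_single_apply, sum_single_apply]
    simp only [Finset.mem_range]
    split_ifs <;> first | rfl | omega
  rw [this]
  exact nrm_resV_le _ _ _

lemma ee_basis : IsSchauderBasis (ee P) := by
  refine ⟨ee_ne, ?_, 1, le_rfl, ee_mono⟩
  intro u
  rw [Metric.mem_closure_iff]
  intro ε hε
  obtain ⟨_, ⟨x, rfl⟩, hx⟩ := Metric.mem_closure_iff.1 u.2 ε hε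
  refine ⟨em P x, ?_, hx⟩
  rw [em_eq]
  exact Submodule.sum_mem _ fun i _ => Submodule.smul_mem _ _ (Submodule.subset_span ⟨i, rfl⟩)

lemma ee_infinite : ¬ FiniteDimensional ℝ (VX P) := by
  intro h
  have hli := linInd_of_basic (ee_ne (P := P)) ee_mono
  have := hli.finite_of_isNoetherian
  exact not_finite ℕ

lemma part_a : ¬ ∃ (x : ℕ → VX P) (C : ℝ), 1 ≤ C ∧ Seminormalized x ∧ IsBasicSeq x ∧
        ∀ (a εs : ℕ → ℝ), (∀ n, εs n = 1 ∨ εs n = -1) →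
          ∀ s : Finset ℕ, ‖∑ n ∈ s, (εs n * a n) • x n‖ ≤ C * ‖∑ n ∈ s, a n • x n‖ := by
  rintro ⟨x, C, hC, -, ⟨hne, K, -, hK⟩, hU⟩
  have hli := linInd_of_basic hne hK
  have hli' : LinearIndependent ℝ (fun n => (x n : LL P)) :=
    hli.map' (VX P).subtype (by simp)
  refine no_uncond (P := P) (x := fun n => (x n : LL P)) (fun n => (x n).2) hli' hC ?_
  intro a ε hε s
  have h := hU a ε hε s
  have hc : ∀ b : ℕ → ℝ, ‖∑ n ∈ s, b n • x n‖ = ‖∑ n ∈ s, b n • (x n : LL P)‖ := by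
    intro b
    have e : ((∑ n ∈ s, b n • x n : VX P) : LL P) = ∑ n ∈ s, b n • (x n : LL P) := by push_cast; rfl
    rw [← e]
    rfl
  rw [hc, hc] at h
  exact h

lemma part_b (z : ℕ → VX P) (hz : IsBlockSeq (ee P) z) :
    ∃ y : ℕ → VX P, IsBlockSeq (ee P) y ∧
      (∀ n, y n ∈ Submodule.span ℝ (Set.range z)) ∧
      SeqEquiv (fun n => y (2 * n)) (fun n => y (2 * n + 1)) := by
  obtain ⟨hz0, I, a, hI, hs⟩ := hz
  obtain ⟨ζ, hζ⟩ : ∃ ζ : ℕ → VV, ζ = fun n => ∑ i ∈ I n, Finsupp.single i (a n i) := ⟨_, rfl⟩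
  have hzζ : z = fun n => em P (ζ n) := by
    funext n; rw [hI n, sum_ee, hζ]
  have hsupp : ∀ n i, ζ n i ≠ 0 → i ∈ I n := by
    intro n i h
    rw [hζ] at h
    simp only at h
    rw [sum_single_apply] at h
    by_contra hc
    exact h (if_neg hc)
  have hblk : Blk ζ := by
    refine ⟨fun n n' h i i' hi hi' => hs n n' h i (hsupp _ _ hi) i' (hsupp _ _ hi'), ?_⟩
    intro n h
    apply hz0 n
    rw [hzζ]
    simp only
    rw [h, map_zero]
  obtain ⟨j, s, y, p, M, hspan⟩ := exists_main (P := P) hblk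
  refine ⟨fun n => em P (y n), ⟨?_, fun n => (y n).support, fun n i => y n i, fun n => em_eq _, ?_⟩, ?_, ?_⟩
  · intro n h
    simp only at h
    have h1 : ‖em P (y n)‖ = 0 := by rw [h, norm_zero]
    rw [norm_em] at h1
    have := nrm_pos (P := P) (M.yne n)
    linarith
  · intro n m h i hi i' hi'
    exact M.blk.1 n m h i i' (by simpa using hi) (by simpa using hi')
  · intro n
    have h1 := Submodule.mem_map_of_mem (f := em P) (hspan n)
    rw [Submodule.map_span, ← Set.range_comp] at h1
    rw [hzζ]
    exact h1
  · have hmu := P.muR 0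
    have key : ∀ (b : ℕ → ℝ) (S : Finset ℕ) (δ : ℕ), δ < 2 →
        ‖∑ n ∈ S, b n • em P (y (2*n+δ))‖ = nrm P (∑ n ∈ S, b n • y (2*n+δ)) := by
      intro b S δ _
      rw [← norm_em, map_sum]
      simp only [map_smul]
    have hdiff : ∀ (b : ℕ → ℝ) (S : Finset ℕ),
        nrm P (∑ n ∈ S, b n • (y (2*n+1) - y (2*n+0)))
          = ‖∑ n ∈ S, b n • em P (y (2*n+1)) - ∑ n ∈ S, b n • em P (y (2*n+0))‖ := by
      intro b S
      rw [← norm_em, map_sum, ← Finset.sum_sub_distrib]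
      simp only [map_smul, map_sub, smul_sub]
    refine ⟨1 / (264 * P.mu 0 + 2), 264 * P.mu 0 + 2, by positivity, ?_⟩
    intro b S
    have e0 := M.est_b b S 0 (by norm_num)
    have e1 := M.est_b b S 1 (by norm_num)
    have hd := hdiff b S
    have k0 := key b S 0 (by norm_num)
    have k1 := key b S 1 (by norm_num)
    simp only [add_zero] at e0 e1 hd k0 k1
    rw [hd] at e0 e1
    rw [← k0] at e0
    rw [← k1] at e1
    have t1 := norm_sub_norm_le (∑ n ∈ S, b n • em P (y (2*n+1))) (∑ n ∈ S, b n • em P (y (2*n)))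
    have t2 := norm_sub_norm_le (∑ n ∈ S, b n • em P (y (2*n))) (∑ n ∈ S, b n • em P (y (2*n+1)))
    rw [norm_sub_rev] at t2
    constructor
    · rw [one_div, inv_mul_le_iff₀ (by positivity)]
      linarith
    · linarith

end GM


theorem exists_GM_space :
    ∃ (X : Type) (_ : NormedAddCommGroup X) (_ : NormedSpace ℝ X) (e : ℕ → X),
      CompleteSpace X ∧ ¬FiniteDimensional ℝ X ∧ IsSchauderBasis e ∧
      -- (a) no unconditional basic sequence
      (¬ ∃ (x : ℕ → X) (C : ℝ), 1 ≤ C ∧ Seminormalized x ∧ IsBasicSeq x ∧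
        ∀ (a εs : ℕ → ℝ), (∀ n, εs n = 1 ∨ εs n = -1) →
          ∀ s : Finset ℕ, ‖∑ n ∈ s, (εs n * a n) • x n‖ ≤ C * ‖∑ n ∈ s, a n • x n‖) ∧
      -- (b) every block subspace contains a block sequence whose even and odd parts are
      -- equivalent
      (∀ z : ℕ → X, IsBlockSeq e z →
        ∃ y : ℕ → X, IsBlockSeq e y ∧
          (∀ n, y n ∈ Submodule.span ℝ (Set.range z)) ∧
          SeqEquiv (fun n => y (2 * n)) (fun n => y (2 * n + 1))) := by
  obtain ⟨P⟩ := GM.exists_par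
  refine ⟨GM.VX P, inferInstance, inferInstance, GM.ee P, ?_, GM.ee_infinite, GM.ee_basis,
    GM.part_a, GM.part_b⟩
  exact (Submodule.isClosed_topologicalClosure _).completeSpace_coe
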